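/- arXiv:1803.03294 — 4 statements merged into one kernel-verified Lean document; each statement's English description precedes it below -/
import Mathlib

section
/- Suppose f is a homeomorphism of the torus 𝕋² = ℝ²/ℤ² homotopic to the identity, with a lift F : ℝ² → ℝ² whose rotation set is ρ(F) = {α} × [ρ⁻, ρ⁺] with ρ⁻ < ρ⁺ and α irrational, and suppose f has the horizontal bounded deviation property: sup over x ∈ ℝ² and n ∈ ℕ of |pr₁(Fⁿ(x) − x) − nα| < +∞. Then some finite cover of f is an extension of an irrational rotation: there exist an integer k ≥ 1, an irrational number β, and a continuous surjective map H : ℝ² → ℝ such that H(x + (k,0)) = H(x) + 1 and H(x + (0,1)) = H(x) for all x ∈ ℝ², and H(F(x)) = H(x) + β for all x ∈ ℝ² (so H descends to a semiconjugacy from the lift of f to the finite cover ℝ²/(kℤ × ℤ) onto the rotation by β on ℝ/ℤ). -/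
open Filter Metric Set

noncomputable section

abbrev R2 := ℝ × ℝ

/-- The rotation set of a lift F : ℝ² → ℝ² :
ρ(F) = { lim_i (F^{n_i}(x_i) − x_i)/n_i : x_i ∈ ℝ², n_i ↗ +∞ }. -/
def rotSet (F : R2 → R2) : Set R2 :=
  {w | ∃ (x : ℕ → R2) (n : ℕ → ℕ), StrictMono n ∧
    Tendsto (fun i => ((n i : ℝ))⁻¹ • (F^[n i] (x i) - x i)) atTop (nhds w)}

section RotationLift

open Complex (exp log)
open scoped unitInterval Topology

theorem exp_lift_eqOn {X : Type*} [TopologicalSpace X] {S : Set X} (hS : IsPreconnected S)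
    {u v : X → ℂ} (hu : ContinuousOn u S) (hv : ContinuousOn v S)
    (h : ∀ x ∈ S, exp (u x) = exp (v x)) {a : X} (ha : a ∈ S) (hav : u a = v a) :
    EqOn u v S := by
  refine Complex.isCoveringMap_exp.eqOn_of_comp_eqOn hS hu hv ?_ ha hav
  intro x hx
  exact Subtype.ext (h x hx)

theorem exp_lift_sub_const {X : Type*} [TopologicalSpace X] {S : Set X} (hS : IsPreconnected S)
    {u v : X → ℂ} (hu : ContinuousOn u S) (hv : ContinuousOn v S) {c : ℂ} (hc : c ≠ 0)
    (h : ∀ x ∈ S, exp (u x) = c * exp (v x)) {a b : X} (ha : a ∈ S) (hb : b ∈ S) :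
    u a - u b = v a - v b := by
  have h1 := exp_lift_eqOn hS hu (v := fun x => v x + (u b - v b)) (hv.add continuousOn_const)
    (fun x hx => by
      rw [h x hx, Complex.exp_add, Complex.exp_sub, h b hb]
      field_simp [Complex.exp_ne_zero]) hb (by ring) ha
  simp only at h1
  rw [h1]; ring

/-- A continuous function with constant exponential on a preconnected set is constant. -/
theorem eq_of_exp_const {X : Type*} [TopologicalSpace X] {S : Set X} (hS : IsPreconnected S)
    {u : X → ℂ} (hu : ContinuousOn u S) {c : ℂ} (h : ∀ x ∈ S, exp (u x) = c)
    {a b : X} (ha : a ∈ S) (hb : b ∈ S) : u a = u b := by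
  have h1 := exp_lift_eqOn hS hu (v := fun _ => u b) continuousOn_const
    (fun x hx => by rw [h x hx, h b hb]) hb rfl ha
  exact h1

/-- Total variation of a continuous logarithm of `g` along the unit interval. -/
def logVar (g : I → ℂ) : ℂ :=
  open Classical in
  if h : ∃ u : I → ℂ, Continuous u ∧ ∀ t, exp (u t) = g t then h.choose 1 - h.choose 0 else 0

theorem exists_log_lift {g : I → ℂ} (hg : Continuous g) (h0 : ∀ t, g t ≠ 0) :
    ∃ u : I → ℂ, Continuous u ∧ ∀ t, exp (u t) = g t := by
  obtain ⟨u, hu, -⟩ := Complex.isCoveringMap_exp.exists_path_lifts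
    (⟨fun t => ⟨g t, h0 t⟩, by fun_prop⟩ : C(I, {z : ℂ // z ≠ 0})) (log (g 0))
    (Subtype.ext (Complex.exp_log (h0 0)).symm)
  exact ⟨u, u.continuous, fun t => congr_arg Subtype.val (congr_fun hu t)⟩

theorem logVar_eq {g : I → ℂ} {u : I → ℂ} (hu : Continuous u) {c : ℂ} (hc : c ≠ 0)
    (h : ∀ t, exp (u t) = c * g t) : logVar g = u 1 - u 0 := by
  have hex : ∃ u : I → ℂ, Continuous u ∧ ∀ t, exp (u t) = g t := by
    refine ⟨fun t => u t - log c, by fun_prop, fun t => ?_⟩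
    rw [Complex.exp_sub, h, Complex.exp_log hc]; field_simp
  rw [logVar, dif_pos hex]
  have h2 := hex.choose_spec
  exact (exp_lift_sub_const isPreconnected_univ hu.continuousOn h2.1.continuousOn hc
    (fun x _ => by rw [h, h2.2]) (mem_univ 1) (mem_univ 0)).symm

theorem logVar_eq' {g : I → ℂ} {u : I → ℂ} (hu : Continuous u)
    (h : ∀ t, exp (u t) = g t) : logVar g = u 1 - u 0 :=
  logVar_eq hu one_ne_zero (fun t => by rw [h, one_mul])

theorem exp_logVar {g : I → ℂ} (hg : Continuous g) (h0 : ∀ t, g t ≠ 0) :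
    exp (logVar g) = g 1 / g 0 := by
  obtain ⟨u, hu, h⟩ := exists_log_lift hg h0
  rw [logVar_eq' hu h, Complex.exp_sub, h, h]

theorem logVar_mul {f g : I → ℂ} (hf : Continuous f) (hg : Continuous g) (hf0 : ∀ t, f t ≠ 0)
    (hg0 : ∀ t, g t ≠ 0) : logVar (fun t => f t * g t) = logVar f + logVar g := by
  obtain ⟨u, hu, h⟩ := exists_log_lift hf hf0
  obtain ⟨v, hv, h'⟩ := exists_log_lift hg hg0
  rw [logVar_eq' hu h, logVar_eq' hv h', logVar_eq' (u := fun t => u t + v t) (hu.add hv)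
    (fun t => by rw [Complex.exp_add, h, h'])]
  ring

theorem logVar_slit {g : I → ℂ} (hg : Continuous g) (h0 : ∀ t, g t ∈ Complex.slitPlane) :
    logVar g = log (g 1) - log (g 0) :=
  logVar_eq' (hg.clog h0) (fun t => Complex.exp_log (Complex.slitPlane_ne_zero (h0 t)))

/-- In a continuous family of nonvanishing functions the variation of the logarithm is
continuous. -/
theorem continuous_logVar {X : Type*} [TopologicalSpace X] {g : X → I → ℂ}
    (hg : Continuous (fun p : X × I => g p.1 p.2)) (h0 : ∀ x t, g x t ≠ 0) :
    Continuous (fun x => logVar (g x)) := by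
  rw [continuous_iff_continuousAt]
  intro x
  have hx : ∀ y, Continuous (g y) := fun y => hg.comp (by fun_prop : Continuous fun t : I => (y, t))
  have hq : Continuous (fun p : X × I => g p.1 p.2 / g x p.2) :=
    hg.div ((hx x).comp continuous_snd) (fun p => h0 x p.2)
  have hopen : IsOpen {p : X × I | g p.1 p.2 / g x p.2 ∈ Complex.slitPlane} :=
    Complex.isOpen_slitPlane.preimage hq
  have htube : ∀ᶠ y in 𝓝 x, ∀ t : I, g y t / g x t ∈ Complex.slitPlane := by
    have := isCompact_univ.eventually_forall_of_forall_eventually (x₀ := x)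
      (P := fun (y : X) (t : I) => g y t / g x t ∈ Complex.slitPlane) (K := univ)
      (fun t _ => hopen.mem_nhds (by
        show g x t / g x t ∈ Complex.slitPlane
        rw [div_self (h0 x t)]; exact Complex.one_mem_slitPlane))
    simpa using this
  have hev : (fun y => logVar (g x) + (log (g y 1 / g x 1) - log (g y 0 / g x 0)))
      =ᶠ[𝓝 x] fun y => logVar (g y) := by
    filter_upwards [htube] with y hy
    have hq' : Continuous (fun t => g y t / g x t) := (hx y).div (hx x) (h0 x)
    rw [← logVar_slit hq' hy, ← logVar_mul (hx x) hq' (h0 x)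
      (fun t => Complex.slitPlane_ne_zero (hy t))]
    congr 1
    funext t
    have := h0 x t
    field_simp
  refine ContinuousAt.congr ?_ hev
  have hc : ∀ s : I, ContinuousAt (fun y => log (g y s / g x s)) x := by
    intro s
    refine ContinuousAt.clog ?_ ?_
    · exact (hq.comp (by fun_prop : Continuous fun y : X => (y, s))).continuousAt
    · rw [div_self (h0 x s)]; exact Complex.one_mem_slitPlane
  exact continuousAt_const.add ((hc 1).sub (hc 0))

/-- Variation of the argument (as a complex logarithm) of the path `γ` seen from `z`. -/
def ang {a b : ℂ} (γ : Path a b) (z : ℂ) : ℂ := logVar (fun t => γ t - z)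

theorem sub_ne_of_notMem {a b : ℂ} {γ : Path a b} {z : ℂ} (hz : z ∉ range γ) (t : I) :
    γ t - z ≠ 0 := fun h => hz ⟨t, sub_eq_zero.1 h⟩

theorem exp_ang {a b : ℂ} {γ : Path a b} {z : ℂ} (hz : z ∉ range γ) :
    exp (ang γ z) = (b - z) / (a - z) := by
  rw [ang, exp_logVar (by fun_prop) (sub_ne_of_notMem hz), γ.source, γ.target]

theorem ang_symm {a b : ℂ} {γ : Path a b} {z : ℂ} (hz : z ∉ range γ) :
    ang γ.symm z = - ang γ z := by
  obtain ⟨u, hu, h⟩ := exists_log_lift (g := fun t => γ t - z) (by fun_prop) (sub_ne_of_notMem hz)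
  rw [ang, ang, logVar_eq' hu h, logVar_eq' (u := fun t => u (unitInterval.symm t)) (by fun_prop)
    (fun t => by rw [h]; rfl)]
  simp

theorem ang_trans {a b c : ℂ} {γ : Path a b} {δ : Path b c} {z : ℂ} (hz : z ∉ range γ)
    (hz' : z ∉ range δ) : ang (γ.trans δ) z = ang γ z + ang δ z := by
  obtain ⟨u, hu, h⟩ := exists_log_lift (g := fun t => γ t - z) (by fun_prop) (sub_ne_of_notMem hz)
  obtain ⟨v, hv, h'⟩ := exists_log_lift (g := fun t => δ t - z) (by fun_prop) (sub_ne_of_notMem hz')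
  let p : Path (u 0) (u 1) := ⟨⟨u, hu⟩, rfl, rfl⟩
  let q : Path (u 1) (v 1 - v 0 + u 1) := ⟨⟨fun t => v t - v 0 + u 1, by fun_prop⟩, by simp, by simp⟩
  have hpq : ∀ t, exp ((p.trans q) t) = (γ.trans δ) t - z := by
    intro t
    rw [Path.trans_apply, Path.trans_apply]
    split_ifs with ht
    · exact h _
    · have : exp (v 0) = exp (u 1) := by rw [h, h']; simp
      show exp (v _ - v 0 + u 1) = _
      rw [Complex.exp_add, Complex.exp_sub, this, h', div_mul_cancel₀ _ (Complex.exp_ne_zero _)]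
  rw [ang, ang, ang, logVar_eq' hu h, logVar_eq' hv h', logVar_eq' (p.trans q).continuous hpq]
  simp
  ring

/-- The variation along a path staying in the domain of a branch of the logarithm. -/
theorem ang_eq_branch {a b : ℂ} {γ : Path a b} {z : ℂ} {S : Set ℂ} {br : ℂ → ℂ}
    (hbr : ContinuousOn br S) {c : ℂ} (hc : c ≠ 0) (h : ∀ x ∈ S, exp (br x) = c * (x - z))
    (hγ : range γ ⊆ S) : ang γ z = br b - br a := by
  have hγ' : ∀ t, γ t ∈ S := fun t => hγ ⟨t, rfl⟩
  have hcont : Continuous (fun t => br (γ t)) :=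
    hbr.comp_continuous γ.continuous hγ'
  rw [ang, logVar_eq hcont hc (fun t => h _ (hγ' t)), γ.source, γ.target]

theorem continuousOn_ang {a b : ℂ} (γ : Path a b) : ContinuousOn (ang γ) (range γ)ᶜ := by
  rw [continuousOn_iff_continuous_domRestrict]
  have := continuous_logVar (X := ((range γ)ᶜ : Set ℂ)) (g := fun z t => γ t - z.1) (by fun_prop)
    (fun z t => sub_ne_of_notMem z.2 t)
  exact this

theorem Path.exists_split {X : Type*} [TopologicalSpace X] {a b : X} (γ : Path a b) (s : I) :
    ∃ (γ₁ : Path a (γ s)) (γ₂ : Path (γ s) b), range γ₁ ⊆ γ '' Iic s ∧ range γ₂ ⊆ γ '' Ici s := by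
  refine ⟨⟨⟨fun t => γ (t * s), by fun_prop⟩, by simp, by simp⟩,
    ⟨⟨fun t => γ (unitInterval.symm (unitInterval.symm t * unitInterval.symm s)), by fun_prop⟩,
      by simp, by simp⟩, ?_, ?_⟩
  · rintro _ ⟨t, rfl⟩
    exact ⟨_, show t * s ≤ s from unitInterval.mul_le_right, rfl⟩
  · rintro _ ⟨t, rfl⟩
    refine ⟨_, ?_, rfl⟩
    show s ≤ _
    exact unitInterval.le_symm_comm.1 unitInterval.mul_le_right

/-- `ε = 1` or `ε = -1`. -/
def IsSgn (ε : ℝ) : Prop := ε = 1 ∨ ε = -1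

theorem IsSgn.neg {ε : ℝ} (h : IsSgn ε) : IsSgn (-ε) := by
  rcases h with rfl | rfl
  · right; rfl
  · left; norm_num

theorem IsSgn.mul_self {ε : ℝ} (h : IsSgn ε) : ε * ε = 1 := by
  rcases h with rfl | rfl <;> norm_num

theorem IsSgn.ne_zero {ε : ℝ} (h : IsSgn ε) : ε ≠ 0 := by
  rcases h with rfl | rfl <;> norm_num

theorem IsSgn.abs {ε : ℝ} (h : IsSgn ε) : |ε| = 1 := by
  rcases h with rfl | rfl <;> norm_num

theorem arg_mem_of_re_nonneg {w : ℂ} (hw : 0 ≤ w.re) : |w.arg| ≤ Real.pi / 2 :=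
  Complex.abs_arg_le_pi_div_two_iff.2 hw

theorem log_mul_I_right {ε : ℝ} (hε : IsSgn ε) {w : ℂ} (hw : 0 ≤ w.re) (hi : ε * w.im < 0) :
    log (ε * Complex.I * w) = log w + ε * (Real.pi / 2) * Complex.I := by
  have hw0 : w ≠ 0 := by rintro rfl; simp at hi
  have h1 := abs_le.1 (arg_mem_of_re_nonneg hw)
  have hpi := Real.pi_pos
  have hexp : exp (log w + ε * (Real.pi / 2) * Complex.I) = ε * Complex.I * w := by
    rw [Complex.exp_add, Complex.exp_log hw0, mul_comm]
    congr 1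
    rcases hε with rfl | rfl
    · simp [Complex.exp_pi_div_two_mul_I]
    · have : ((-1 : ℝ) : ℂ) * (Real.pi / 2) * Complex.I = -(Real.pi / 2 * Complex.I) := by push_cast; ring
      rw [this, Complex.exp_neg, Complex.exp_pi_div_two_mul_I]; simp
  have him : (log w + ε * (Real.pi / 2) * Complex.I).im = w.arg + ε * (Real.pi / 2) := by
    simp [Complex.log_im]
  rw [← hexp]
  apply Complex.log_exp
  · rw [him]
    rcases hε with rfl | rfl
    · linarith
    · have : 0 ≤ w.arg := Complex.arg_nonneg_iff.2 (by linarith)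
      linarith
  · rw [him]
    rcases hε with rfl | rfl <;> linarith

theorem log_mul_I_left {ε : ℝ} (hε : IsSgn ε) {w : ℂ} (hw : w.re ≤ 0) (hi : ε * w.im < 0) :
    log (ε * Complex.I * w) = log (-w) - ε * (Real.pi / 2) * Complex.I := by
  have := log_mul_I_right hε.neg (w := -w) (by simpa using hw) (by simpa using hi)
  rw [← sub_eq_zero] at this ⊢
  rw [← this]
  push_cast
  ring_nf

/-- The crossing number of a path from the left of `z` to the right of `z`: it is `± π * Complex.I` if the
path passes below or above `z` respectively. -/
def cross {a b : ℂ} (γ : Path a b) (z : ℂ) : ℂ := ang γ z - log (b - z) + log (z - a)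

theorem cross_of_side {a b : ℂ} {γ : Path a b} {z : ℂ} {ε : ℝ} (hε : IsSgn ε)
    (hγ : ∀ x ∈ range γ, ε * (x - z).im < 0) (ha : a.re ≤ z.re) (hb : z.re ≤ b.re) :
    cross γ z = ε * Real.pi * Complex.I := by
  have hne : (ε * Complex.I : ℂ) ≠ 0 := mul_ne_zero (by exact_mod_cast hε.ne_zero) Complex.I_ne_zero
  have hside : ∀ x ∈ {x : ℂ | ε * (x - z).im < 0}, ε * Complex.I * (x - z) ∈ Complex.slitPlane := by
    intro x hx
    left
    simp at hx ⊢
    linarith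
  have hbr : ContinuousOn (fun x : ℂ => log (ε * Complex.I * (x - z))) {x : ℂ | ε * (x - z).im < 0} :=
    ContinuousOn.clog (by fun_prop) hside
  rw [cross, ang_eq_branch hbr hne (fun x hx =>
    Complex.exp_log (Complex.slitPlane_ne_zero (hside x hx))) hγ,
    log_mul_I_right hε (w := b - z) (by simpa using hb) (hγ b ⟨1, γ.target⟩),
    log_mul_I_left hε (w := a - z) (by simpa using ha) (hγ a ⟨0, γ.source⟩), neg_sub]
  ring

theorem exp_cross {a b : ℂ} {γ : Path a b} {z : ℂ} (hz : z ∉ range γ) :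
    exp (cross γ z) = -1 := by
  have ha : a - z ≠ 0 := by simpa using sub_ne_of_notMem hz 0
  have hb : b - z ≠ 0 := by simpa using sub_ne_of_notMem hz 1
  have ha' : z - a ≠ 0 := by rw [← neg_sub]; exact neg_ne_zero.2 ha
  rw [cross, Complex.exp_add, Complex.exp_sub, exp_ang hz, Complex.exp_log hb, Complex.exp_log ha',
    ← neg_sub a z]
  field_simp

theorem mem_slitPlane_of_re_nonneg {w : ℂ} (hw : 0 ≤ w.re) (h0 : w ≠ 0) :
    w ∈ Complex.slitPlane := by
  rcases hw.lt_or_eq with h | h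
  · exact Or.inl h
  · right
    intro hi
    exact h0 (Complex.ext h.symm hi)

/-- A preconnected set off a path crossing a vertical strip close to the line `im = j` stays on one
side of that path. -/
theorem not_both_sides {a b : ℂ} {γ : Path a b} {E : Set ℂ} (hE : IsPreconnected E)
    (hdisj : ∀ x ∈ E, x ∉ range γ) (hstrip : ∀ x ∈ E, a.re ≤ x.re ∧ x.re ≤ b.re)
    {M j ε : ℝ} (hε : IsSgn ε) (hM : ∀ x ∈ range γ, |x.im - j| ≤ M) {x y : ℂ}
    (hx : x ∈ E) (hy : y ∈ E) (hxM : ε * (x.im - j) < -M) (hyM : M < ε * (y.im - j)) : False := by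
  have hcont : ContinuousOn (cross γ) E := by
    refine ContinuousOn.add (ContinuousOn.sub ((continuousOn_ang γ).mono hdisj) ?_) ?_
    · refine ContinuousOn.clog (by fun_prop) fun w hw => mem_slitPlane_of_re_nonneg ?_ ?_
      · simpa using (hstrip w hw).2
      · simpa using sub_ne_of_notMem (hdisj w hw) 1
    · refine ContinuousOn.clog (by fun_prop) fun w hw => mem_slitPlane_of_re_nonneg ?_ ?_
      · simpa using (hstrip w hw).1
      · rw [← neg_sub, neg_ne_zero]
        simpa using sub_ne_of_notMem (hdisj w hw) 0
  have heq := eq_of_exp_const hE hcont (fun w hw => exp_cross (hdisj w hw)) hx hy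
  have hb : ∀ w ∈ range γ, |ε * (w.im - j)| ≤ M := fun w hw => by
    rw [abs_mul, hε.abs, one_mul]; exact hM w hw
  rw [cross_of_side hε.neg (fun w hw => ?_) (hstrip x hx).1 (hstrip x hx).2,
    cross_of_side hε (fun w hw => ?_) (hstrip y hy).1 (hstrip y hy).2] at heq
  · have h2 := congr_arg Complex.im heq
    have hpi := Real.pi_pos
    rcases hε with rfl | rfl <;> simp at h2 <;> linarith
  · have := abs_le.1 (hb w hw)
    simp only [Complex.sub_im]
    linarith
  · have := abs_le.1 (hb w hw)
    simp only [Complex.sub_im]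
    linarith

/-- Loops in `U` do not wind around `z`. -/
def NoWind (U : Set ℂ) (z : ℂ) : Prop := ∀ (a : ℂ) (γ : Path a a), range γ ⊆ U → ang γ z = 0

theorem NoWind.ang_eq {U : Set ℂ} {z : ℂ} (h : NoWind U z) (hz : z ∉ U) {a b : ℂ} {γ δ : Path a b}
    (hγ : range γ ⊆ U) (hδ : range δ ⊆ U) : ang γ z = ang δ z := by
  have h1 := h a (γ.trans δ.symm) (by
    rw [Path.trans_range, Path.symm_range]; exact union_subset hγ hδ)
  rw [ang_trans (fun h => hz (hγ h)) (by rw [Path.symm_range]; exact fun h => hz (hδ h)),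
    ang_symm (fun h => hz (hδ h))] at h1
  linear_combination h1

/-- The points that can be connected to infinity, in direction `ε`, off the closure of `A`. -/
def farComp (A : Set ℂ) (ε : ℝ) : Set ℂ :=
  {x | ∃ P : Set ℂ, IsPreconnected P ∧ P ⊆ (closure A)ᶜ ∧ x ∈ P ∧ ∀ M : ℝ, ∃ y ∈ P, M < ε * y.re}

theorem farComp_subset {A : Set ℂ} {ε : ℝ} : farComp A ε ⊆ (closure A)ᶜ := by
  rintro x ⟨P, -, hP, hx, -⟩
  exact hP hx

theorem mem_farComp_of_preconnected {A : Set ℂ} {ε : ℝ} {S : Set ℂ} (hS : IsPreconnected S)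
    (hSA : S ⊆ (closure A)ᶜ) {x y : ℂ} (hx : x ∈ S) (hy : y ∈ S) (hxA : x ∈ farComp A ε) :
    y ∈ farComp A ε := by
  obtain ⟨P, hP, hPA, hxP, hfar⟩ := hxA
  refine ⟨P ∪ S, hP.union x hxP hx hS, union_subset hPA hSA, Or.inr hy, fun M => ?_⟩
  obtain ⟨w, hw, h⟩ := hfar M
  exact ⟨w, Or.inl hw, h⟩

theorem isOpen_farComp (A : Set ℂ) (ε : ℝ) : IsOpen (farComp A ε) := by
  rw [Metric.isOpen_iff]
  intro x hx
  obtain ⟨r, hr, h⟩ := Metric.isOpen_iff.1 isClosed_closure.isOpen_compl x (farComp_subset hx)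
  exact ⟨r, hr, fun y hy => mem_farComp_of_preconnected (convex_ball x r).isPreconnected h
    (mem_ball_self hr) hy hx⟩

theorem farComp_anti {A B : Set ℂ} (h : A ⊆ B) (ε : ℝ) : farComp B ε ⊆ farComp A ε := by
  rintro x ⟨P, hP, hPB, hx, hfar⟩
  exact ⟨P, hP, hPB.trans (compl_subset_compl.2 (closure_mono h)), hx, hfar⟩

theorem noWind_farComp {A : Set ℂ} {ε : ℝ} (hε : IsSgn ε) (hA : IsPreconnected A)
    (hfar : ∀ M : ℝ, ∃ y ∈ A, ε * y.re < M) {z : ℂ} (hz : z ∉ farComp A ε) :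
    NoWind (farComp A ε) z := by
  intro a γ hγ
  obtain ⟨E, hE, hzE, hAE, hdisj⟩ : ∃ E : Set ℂ, IsPreconnected E ∧ z ∈ E ∧ A ⊆ E ∧
      ∀ x ∈ E, x ∉ farComp A ε := by
    by_cases hzA : z ∈ closure A
    · exact ⟨closure A, hA.closure, hzA, subset_closure, fun x hx h => farComp_subset h hx⟩
    · set N := connectedComponentIn (closure A)ᶜ z with hN
      have hNo : IsOpen N := isClosed_closure.isOpen_compl.connectedComponentIn
      have hzN : z ∈ N := mem_connectedComponentIn hzA
      have hNA : N ⊆ (closure A)ᶜ := connectedComponentIn_subset _ _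
      have hNc : IsPreconnected N := isPreconnected_connectedComponentIn
      have hmeet : (closure N ∩ closure A).Nonempty := by
        by_contra hcon
        have h1 : closure N ⊆ (closure A)ᶜ := fun x hx hxA => hcon ⟨x, hx, hxA⟩
        have h2 : closure N ⊆ N :=
          hNc.closure.subset_connectedComponentIn (subset_closure hzN) h1
        have h3 : IsClopen N := ⟨isClosed_of_closure_subset h2, hNo⟩
        have h4 := h3.eq_univ ⟨z, hzN⟩
        obtain ⟨y, hy, -⟩ := hfar 0
        exact hNA (h4 ▸ mem_univ y) (subset_closure hy)
      obtain ⟨w, hwN, hwA⟩ := hmeet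
      refine ⟨closure N ∪ closure A, hNc.closure.union w hwN hwA hA.closure,
        Or.inl (subset_closure hzN), fun x hx => Or.inr (subset_closure hx), ?_⟩
      rintro x (hx | hx) hxf
      · obtain ⟨y, hyf, hyN⟩ := mem_closure_iff.1 hx _ (isOpen_farComp A ε) hxf
        exact hz (mem_farComp_of_preconnected hNc hNA hyN hzN hyf)
      · exact farComp_subset hxf hx
  have hoff : ∀ x ∈ E, x ∉ range γ := fun x hx h => hdisj x hx (hγ h)
  have hcont : ContinuousOn (ang γ) E := (continuousOn_ang γ).mono hoff
  obtain ⟨m, hm⟩ := (isCompact_range γ.continuous).bddBelow_image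
    (f := fun x : ℂ => ε * x.re) (by fun_prop)
  obtain ⟨y, hyA, hy⟩ := hfar m
  have hyE := hAE hyA
  have hexp : ∀ x ∈ E, exp (ang γ x) = 1 := fun x hx => by
    rw [exp_ang (hoff x hx), div_self]
    simpa using sub_ne_of_notMem (hoff x hx) 0
  rw [eq_of_exp_const hE hcont hexp hzE hyE]
  have hside : ∀ x ∈ {x : ℂ | 0 < ε * (x - y).re}, (ε : ℂ) * (x - y) ∈ Complex.slitPlane := by
    intro x hx
    left
    simpa using hx
  rw [ang_eq_branch (S := {x : ℂ | 0 < ε * (x - y).re}) (br := fun x : ℂ => log (ε * (x - y)))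
    (ContinuousOn.clog (by fun_prop) hside) (by exact_mod_cast hε.ne_zero)
    (fun x hx => Complex.exp_log (Complex.slitPlane_ne_zero (hside x hx))) (fun x hx => ?_),
    sub_self]
  have := hm ⟨x, hx, rfl⟩
  simp only [mem_ofPred_eq, Complex.sub_re, mul_sub]
  linarith

theorem log_div_of_re_pos {u v : ℂ} (hu : 0 < u.re) (hv : 0 < v.re) :
    log (u / v) = log u - log v := by
  have hu0 : u ≠ 0 := by rintro rfl; simp at hu
  have hv0 : v ≠ 0 := by rintro rfl; simp at hv
  have h1 := abs_lt.1 (Complex.abs_arg_lt_pi_div_two_iff.2 (Or.inl hu))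
  have h2 := abs_lt.1 (Complex.abs_arg_lt_pi_div_two_iff.2 (Or.inl hv))
  have : exp (log u - log v) = u / v := by
    rw [Complex.exp_sub, Complex.exp_log hu0, Complex.exp_log hv0]
  rw [← this]
  apply Complex.log_exp <;> simp only [Complex.sub_im, Complex.log_im] <;> linarith

/-- The crossing number is invariant under homeomorphisms at bounded distance from the identity. -/
theorem cross_map {G : ℂ → ℂ} (hG : Continuous G) (hinj : Function.Injective G) {D : ℝ}
    (hD : ∀ x, ‖G x - x‖ ≤ D) {a b : ℂ} {γ : Path a b} {z : ℂ} (hz : z ∉ range γ)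
    (ha : 2 * D < z.re - a.re) (hb : 2 * D < b.re - z.re) :
    cross (γ.map hG) (G z) = cross γ z := by
  obtain ⟨u, hu, hexp⟩ := exists_log_lift (g := fun t => γ t - z) (by fun_prop)
    (sub_ne_of_notMem hz)
  set Φ : ℝ → I → ℂ := fun c t => (G (z + exp (u t + c)) - G z) / exp (u t + c) with hΦ
  have hΦc : Continuous (fun p : ℝ × I => Φ p.1 p.2) := by
    refine Continuous.div (by fun_prop) (by fun_prop) (fun p => Complex.exp_ne_zero _)
  have hΦ0 : ∀ c t, Φ c t ≠ 0 := fun c t => by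
    refine div_ne_zero (sub_ne_zero.2 fun h => ?_) (Complex.exp_ne_zero _)
    exact Complex.exp_ne_zero _ (add_eq_left.1 (hinj h))
  have hslit : ∀ (c : ℝ) t, 2 * D < ‖exp (u t + c)‖ → Φ c t ∈ Complex.slitPlane := by
    intro c t h
    set e := exp (u t + c) with he
    have he0 : e ≠ 0 := Complex.exp_ne_zero _
    have : Φ c t = 1 + (((G (z + e) - (z + e)) - (G z - z)) / e) := by
      simp only [hΦ, ← he]
      field_simp
      ring
    rw [this]
    apply Complex.mem_slitPlane_of_norm_lt_one
    rw [norm_div, div_lt_one (norm_pos_iff.2 he0)]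
    calc _ ≤ ‖G (z + e) - (z + e)‖ + ‖G z - z‖ := norm_sub_le _ _
      _ ≤ D + D := add_le_add (hD _) (hD _)
      _ < ‖e‖ := by linarith
  have hnorm : ∀ (c : ℝ) t, ‖exp (u t + c)‖ = ‖γ t - z‖ * Real.exp c := fun c t => by
    rw [Complex.exp_add, norm_mul, hexp, Complex.norm_exp_ofReal]
  have hend : ∀ c : ℝ, 0 ≤ c → ∀ t, 2 * D < ‖γ t - z‖ → Φ c t ∈ Complex.slitPlane := by
    intro c hc t ht
    refine hslit c t (ht.trans_le ?_)
    rw [hnorm]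
    exact le_mul_of_one_le_right (norm_nonneg _) (Real.one_le_exp hc)
  have h1 : 2 * D < ‖γ 1 - z‖ := by
    rw [γ.target]
    exact hb.trans_le ((le_abs_self _).trans (Complex.abs_re_le_norm (b - z)))
  have h0 : 2 * D < ‖γ 0 - z‖ := by
    rw [γ.source, norm_sub_rev]
    exact ha.trans_le ((le_abs_self _).trans (Complex.abs_re_le_norm (z - a)))
  have hJc : ContinuousOn (fun c : ℝ => logVar (Φ c) - log (Φ c 1) + log (Φ c 0)) (Ici 0) := by
    have hs : ∀ s : I, Continuous (fun c : ℝ => Φ c s) := fun s =>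
      hΦc.comp (by fun_prop : Continuous fun c : ℝ => (c, s))
    refine ((continuous_logVar hΦc hΦ0).continuousOn.sub ?_).add ?_
    · exact (hs 1).continuousOn.clog fun c hc => hend c hc 1 h1
    · exact (hs 0).continuousOn.clog fun c hc => hend c hc 0 h0
  have hΦs : ∀ c, Continuous (Φ c) := fun c =>
    hΦc.comp (by fun_prop : Continuous fun t : I => (c, t))
  have hJe : ∀ c ∈ Ici (0 : ℝ), exp (logVar (Φ c) - log (Φ c 1) + log (Φ c 0)) = 1 := by
    intro c _
    rw [Complex.exp_add, Complex.exp_sub, exp_logVar (hΦs c) (hΦ0 c), Complex.exp_log (hΦ0 _ _),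
      Complex.exp_log (hΦ0 _ _)]
    have e1 := hΦ0 c 1
    have e0 := hΦ0 c 0
    field_simp
  obtain ⟨m, hm⟩ := (isCompact_range hu).bddBelow_image (f := fun x : ℂ => x.re) (by fun_prop)
  have hC := eq_of_exp_const isPreconnected_Ici hJc hJe
    (show (0 : ℝ) ∈ Ici 0 from self_mem_Ici) (show max 0 (2 * D - m) ∈ Ici (0 : ℝ) from mem_Ici.2 (le_max_left _ _))
  rw [logVar_slit (hΦs (max 0 (2 * D - m))) (fun t => hslit _ t ?_)] at hC
  swap
  · rw [Complex.norm_exp]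
    have h2 : m ≤ (u t).re := hm ⟨u t, ⟨t, rfl⟩, rfl⟩
    have h3 := le_max_right 0 (2 * D - m)
    have h4 := Real.add_one_le_exp ((u t + ((max 0 (2 * D - m) : ℝ) : ℂ)).re)
    have h5 : (u t + ((max 0 (2 * D - m) : ℝ) : ℂ)).re = (u t).re + max 0 (2 * D - m) := by simp
    rw [h5] at h4 ⊢
    linarith
  have hang : ang (γ.map hG) (G z) = logVar (Φ 0) + ang γ z := by
    rw [ang, ang, ← logVar_mul (hΦs 0) (by fun_prop) (hΦ0 0) (sub_ne_of_notMem hz)]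
    congr 1
    funext t
    have : γ t = z + exp (u t) := by rw [hexp]; ring
    simp only [hΦ, Path.map_coe, Function.comp_apply, Complex.ofReal_zero, add_zero, this]
    field_simp [Complex.exp_ne_zero]
    ring
  have hre : ∀ x, |(G x).re - x.re| ≤ D := fun x =>
    (Complex.abs_re_le_norm (G x - x)).trans (hD x)
  have hz' := abs_le.1 (hre z)
  have ha' := abs_le.1 (hre a)
  have hb' := abs_le.1 (hre b)
  have hD0 : 0 ≤ D := (norm_nonneg _).trans (hD z)
  have e1 : Φ 0 1 = (G b - G z) / (b - z) := by
    simp only [hΦ, Complex.ofReal_zero, add_zero, hexp]; simp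
  have e0 : Φ 0 0 = (G z - G a) / (z - a) := by
    simp only [hΦ, Complex.ofReal_zero, add_zero, hexp]; simp
    rw [← neg_sub (G z), ← neg_sub z, neg_div_neg_eq]
  rw [e1, e0, log_div_of_re_pos (by simp; linarith) (by simp; linarith),
    log_div_of_re_pos (by simp; linarith) (by simp; linarith)] at hC
  rw [cross, cross, hang]
  linear_combination hC

/-- Replace the beginning of a path `ℓ`, up to its last visit to `Λ`, by a piece of a path `γ`
running in `Λ`. -/
theorem exists_reroute {U Λ : Set ℂ} {z a c e : ℂ} (hU : NoWind U z) (hzU : z ∉ U)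
    {γ : Path a c} {ℓ : Path a e} (hγ : range γ ⊆ U) (hγΛ : range γ ⊆ Λ) (hℓ : range ℓ ⊆ U)
    (hΛ : IsClosed Λ) (hhit : ∀ x ∈ range ℓ, x ∈ Λ → x ∈ range γ) (he : e ∉ Λ) :
    ∃ (χ : Path a e) (E : Set ℂ), IsPreconnected E ∧ e ∈ E ∧ E ⊆ range ℓ ∧ Disjoint E Λ ∧
      range χ ⊆ Λ ∪ E ∧ range χ ⊆ U ∧ ang χ z = ang ℓ z := by
  set T : Set I := ℓ ⁻¹' Λ with hT
  have hTc : IsCompact T := (hΛ.preimage ℓ.continuous).isCompact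
  have hT0 : (0 : I) ∈ T := by
    show ℓ 0 ∈ Λ
    rw [ℓ.source]
    exact hγΛ ⟨0, γ.source⟩
  obtain ⟨t₀, ht₀, hmax⟩ := hTc.exists_isGreatest ⟨0, hT0⟩
  obtain ⟨s, hs⟩ := hhit (ℓ t₀) ⟨t₀, rfl⟩ ht₀
  obtain ⟨κ, -, hκ, -⟩ := γ.exists_split s
  obtain ⟨ℓ₁, ℓ₂, hℓ₁, hℓ₂⟩ := ℓ.exists_split t₀
  have hκr : range (κ.cast rfl hs.symm) ⊆ range γ := hκ.trans (image_subset_range _ _)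
  have hℓ₁r : range ℓ₁ ⊆ range ℓ := hℓ₁.trans (image_subset_range _ _)
  have hℓ₂r : range ℓ₂ ⊆ range ℓ := hℓ₂.trans (image_subset_range _ _)
  have ht₀1 : t₀ < 1 := by
    refine lt_of_le_of_ne unitInterval.le_one' fun h => he ?_
    have : ℓ t₀ ∈ Λ := ht₀
    rwa [h, ℓ.target] at this
  refine ⟨(κ.cast rfl hs.symm).trans ℓ₂, ℓ '' Ioc t₀ 1, isPreconnected_Ioc.image _
    ℓ.continuous.continuousOn, ⟨1, ⟨ht₀1, le_rfl⟩, ℓ.target⟩, image_subset_range _ _, ?_, ?_, ?_, ?_⟩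
  · rw [Set.disjoint_left]
    rintro _ ⟨t, ht, rfl⟩ htΛ
    exact absurd (hmax htΛ) (not_le.2 ht.1)
  · rw [Path.trans_range]
    refine union_subset (fun x hx => Or.inl (hγΛ (hκr hx))) fun x hx => ?_
    obtain ⟨t, ht, rfl⟩ := hℓ₂ hx
    rcases (mem_Ici.1 ht).eq_or_lt with h | h
    · left; rw [← h]; exact ht₀
    · exact Or.inr ⟨t, ⟨h, unitInterval.le_one'⟩, rfl⟩
  · rw [Path.trans_range]
    exact union_subset (hκr.trans hγ) (hℓ₂r.trans hℓ)
  · have h1 : ang ℓ z = ang (ℓ₁.trans ℓ₂) z := hU.ang_eq hzU hℓ (by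
      rw [Path.trans_range]; exact union_subset (hℓ₁r.trans hℓ) (hℓ₂r.trans hℓ))
    rw [h1]
    refine hU.ang_eq hzU ?_ ?_ <;> rw [Path.trans_range]
    · exact union_subset (hκr.trans hγ) (hℓ₂r.trans hℓ)
    · exact union_subset (hℓ₁r.trans hℓ) (hℓ₂r.trans hℓ)

/-- A path which must follow a given near horizontal path to its left and to its right end, except
in places separated by this path from `z`, passes `z` on the prescribed side. -/
theorem cross_of_separated {U V U' V' : Set ℂ} {z a b c c' e e' : ℂ} {ε M j : ℝ} (hε : IsSgn ε)
    (hU : NoWind U z) (hzU : z ∉ U) (hV : NoWind V z) (hzV : z ∉ V)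
    (hU' : U' ⊆ U) (hV' : V' ⊆ V)
    {γL : Path a c} {γM : Path c c'} {γR : Path c' b} (hγL : range γL ⊆ U) (hγR : range γR ⊆ V)
    (hLV : Disjoint (range γL) V') (hMU : Disjoint (range γM) U') (hMV : Disjoint (range γM) V')
    (hRU : Disjoint (range γR) U')
    (hM : ∀ x ∈ range γL ∪ range γM ∪ range γR, |x.im - j| ≤ M)
    {ℓL : Path a e} {ℓM : Path e e'} {ℓR : Path e' b} (hℓL : range ℓL ⊆ U') (hℓR : range ℓR ⊆ V')
    (hℓM : ∀ x ∈ range ℓM, ε * (x.im - j) < -M)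
    (hstrip : ∀ x ∈ range ℓL ∪ range ℓM ∪ range ℓR, a.re ≤ x.re ∧ x.re ≤ b.re)
    (hz : M < ε * (z.im - j)) (hza : a.re ≤ z.re) (hzb : z.re ≤ b.re) :
    cross ((ℓL.trans ℓM).trans ℓR) z = ε * Real.pi * Complex.I := by
  set Λ := range γL ∪ range γM ∪ range γR with hΛ
  have hΛr : range ((γL.trans γM).trans γR) = Λ := by rw [Path.trans_range, Path.trans_range]
  have hΛc : IsClosed Λ := by
    rw [← hΛr]; exact (isCompact_range (Path.continuous _)).isClosed
  have hb : ∀ w ∈ Λ, |ε * (w.im - j)| ≤ M := fun w hw => by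
    rw [abs_mul, hε.abs, one_mul]; exact hM w hw
  have hMoff : ∀ x ∈ range ℓM, x ∉ Λ := fun x hx hxΛ => by
    have := (abs_le.1 (hb x hxΛ)).1
    linarith [hℓM x hx]
  have heM : e ∈ range ℓM := ⟨0, ℓM.source⟩
  have heM' : e' ∈ range ℓM := ⟨1, ℓM.target⟩
  obtain ⟨χ, E, hE, heE, hEℓ, hEΛ, hχ, hχU, hχa⟩ := exists_reroute hU hzU (ℓ := ℓL) hγL
    (fun x hx => Or.inl (Or.inl hx)) (hℓL.trans hU') hΛc (by
      rintro x hx ((h | h) | h)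
      · exact h
      · exact absurd (hℓL hx) (disjoint_left.1 hMU h)
      · exact absurd (hℓL hx) (disjoint_left.1 hRU h)) (hMoff e heM)
  obtain ⟨χ', E', hE', heE', hEℓ', hEΛ', hχ', hχV, hχa'⟩ := exists_reroute hV hzV
    (γ := γR.symm) (ℓ := ℓR.symm) (Λ := Λ) (by rwa [Path.symm_range])
    (by rw [Path.symm_range]; exact fun x hx => Or.inr hx)
    (by rw [Path.symm_range]; exact hℓR.trans hV') hΛc (by
      rw [Path.symm_range, Path.symm_range]
      rintro x hx ((h | h) | h)
      · exact absurd (hℓR hx) (disjoint_left.1 hLV h)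
      · exact absurd (hℓR hx) (disjoint_left.1 hMV h)
      · exact h) (hMoff e' heM')
  rw [Path.symm_range] at hEℓ'
  have hEE : IsPreconnected (E ∪ range ℓM ∪ E') :=
    (hE.union e heE heM (isPreconnected_range ℓM.continuous)).union e' (Or.inr heM') heE' hE'
  have hside : ∀ x ∈ E ∪ range ℓM ∪ E', ε * (x - z).im < 0 := by
    intro x hx
    by_contra hcon
    rw [Complex.sub_im] at hcon
    refine not_both_sides (γ := (γL.trans γM).trans γR) hEE ?_ ?_ hε (by rwa [hΛr])
      (Or.inl (Or.inr heM)) hx (hℓM e heM) (by linarith)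
    · rw [hΛr]
      rintro y ((hy | hy) | hy)
      · exact disjoint_left.1 hEΛ hy
      · exact hMoff y hy
      · exact disjoint_left.1 hEΛ' hy
    · rintro y ((hy | hy) | hy)
      · exact hstrip y (Or.inl (Or.inl (hEℓ hy)))
      · exact hstrip y (Or.inl (Or.inr hy))
      · exact hstrip y (Or.inr (hEℓ' hy))
  have hsideΛ : ∀ x ∈ Λ, ε * (x - z).im < 0 := by
    intro x hx
    have := (abs_le.1 (hb x hx)).2
    rw [Complex.sub_im]
    linarith
  have hzM : z ∉ range ℓM := fun h => by simpa using hside z (Or.inl (Or.inr h))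
  have h1 : ang ((ℓL.trans ℓM).trans ℓR) z = ang ((χ.trans ℓM).trans χ'.symm) z := by
    have a1 : z ∉ range ℓL := fun h => hzU (hU' (hℓL h))
    have a2 : z ∉ range ℓR := fun h => hzV (hV' (hℓR h))
    have a3 : z ∉ range χ := fun h => hzU (hχU h)
    have a4 : z ∉ range χ' := fun h => hzV (hχV h)
    have a5 : z ∉ range χ'.symm := by rwa [Path.symm_range]
    rw [ang_trans _ a2, ang_trans a1 hzM, ang_trans _ a5, ang_trans a3 hzM, hχa, ang_symm a4, hχa',
      ang_symm a2, neg_neg]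
    · rw [Path.trans_range]; exact fun h => h.elim a3 hzM
    · rw [Path.trans_range]; exact fun h => h.elim a1 hzM
  rw [← cross_of_side (γ := (χ.trans ℓM).trans χ'.symm) hε ?_ hza hzb, cross, cross, h1]
  rw [Path.trans_range, Path.trans_range, Path.symm_range]
  rintro x ((hx | hx) | hx)
  · rcases hχ hx with h | h
    · exact hsideΛ x h
    · exact hside x (Or.inl (Or.inl h))
  · exact hside x (Or.inl (Or.inr hx))
  · rcases hχ' hx with h | h
    · exact hsideΛ x h
    · exact hside x (Or.inr h)

theorem Convex.exists_path {S : Set ℂ} (hS : Convex ℝ S) {x y : ℂ} (hx : x ∈ S) (hy : y ∈ S) :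
    ∃ γ : Path x y, range γ ⊆ S := by
  obtain ⟨γ, hγ⟩ := (hS.isPathConnected ⟨x, hx⟩).joinedIn x hx y hy
  exact ⟨γ, by rintro _ ⟨t, rfl⟩; exact hγ t⟩

theorem ang_of_left {a b z : ℂ} {γ : Path a b} (h : ∀ x ∈ range γ, x.re < z.re) :
    ang γ z = log (z - b) - log (z - a) := by
  have hside : ∀ x ∈ {x : ℂ | x.re < z.re}, z - x ∈ Complex.slitPlane := fun x hx =>
    Or.inl (by simpa using hx)
  exact ang_eq_branch (S := {x : ℂ | x.re < z.re}) (br := fun x => log (z - x))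
    (ContinuousOn.clog (by fun_prop) hside) (c := -1) (by norm_num)
    (fun x hx => by rw [Complex.exp_log (Complex.slitPlane_ne_zero (hside x hx))]; ring) h

theorem ang_of_right {a b z : ℂ} {γ : Path a b} (h : ∀ x ∈ range γ, z.re < x.re) :
    ang γ z = log (b - z) - log (a - z) := by
  have hside : ∀ x ∈ {x : ℂ | z.re < x.re}, x - z ∈ Complex.slitPlane := fun x hx =>
    Or.inl (by simpa using hx)
  exact ang_eq_branch (S := {x : ℂ | z.re < x.re}) (br := fun x => log (x - z))
    (ContinuousOn.clog (by fun_prop) hside) (c := 1) (by norm_num)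
    (fun x hx => by rw [Complex.exp_log (Complex.slitPlane_ne_zero (hside x hx))]; ring) h

/-- A version of `cross_of_separated` where the two paths need not have the same end points. -/
theorem cross_of_separated_of_far {U V U' V' : Set ℂ} {z a a₁ b b₁ c c' e e' : ℂ} {ε M j p q : ℝ}
    (hε : IsSgn ε)
    (hU : NoWind U z) (hzU : z ∉ U) (hV : NoWind V z) (hzV : z ∉ V)
    (hU' : U' ⊆ U) (hV' : V' ⊆ V) (hUV : Disjoint U' V') (hp : {x : ℂ | x.re < p} ⊆ U')
    (hq : {x : ℂ | q < x.re} ⊆ V')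
    (ha : a.re < p) (ha₁ : a₁.re < p) (hb : q < b.re) (hb₁ : q < b₁.re)
    {γL : Path a c} {γM : Path c c'} {γR : Path c' b} (hγL : range γL ⊆ U) (hγR : range γR ⊆ V)
    (hLV : Disjoint (range γL) V') (hMU : Disjoint (range γM) U') (hMV : Disjoint (range γM) V')
    (hRU : Disjoint (range γR) U')
    (hM : ∀ x ∈ range γL ∪ range γM ∪ range γR, |x.im - j| ≤ M)
    {ℓL : Path a₁ e} {ℓM : Path e e'} {ℓR : Path e' b₁} (hℓL : range ℓL ⊆ U') (hℓR : range ℓR ⊆ V')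
    (hℓM : ∀ x ∈ range ℓM, ε * (x.im - j) < -M)
    (hz : M < ε * (z.im - j)) :
    cross ((ℓL.trans ℓM).trans ℓR) z = ε * Real.pi * Complex.I := by
  have hpz : p ≤ z.re := not_lt.1 fun h => hzU (hU' (hp h))
  have hqz : z.re ≤ q := not_lt.1 fun h => hzV (hV' (hq h))
  have hcomp : IsCompact (range ℓL ∪ range ℓM ∪ range ℓR) :=
    ((isCompact_range ℓL.continuous).union (isCompact_range ℓM.continuous)).union
      (isCompact_range ℓR.continuous)
  obtain ⟨m₁, hm₁⟩ := hcomp.bddBelow_image (f := fun x : ℂ => x.re) (by fun_prop)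
  obtain ⟨m₂, hm₂⟩ := hcomp.bddAbove_image (f := fun x : ℂ => x.re) (by fun_prop)
  have hm₁' : ∀ x ∈ range ℓL ∪ range ℓM ∪ range ℓR, m₁ ≤ x.re := fun x hx => hm₁ ⟨x, hx, rfl⟩
  have hm₂' : ∀ x ∈ range ℓL ∪ range ℓM ∪ range ℓR, x.re ≤ m₂ := fun x hx => hm₂ ⟨x, hx, rfl⟩
  have ha₁m : m₁ ≤ a₁.re := hm₁' a₁ (Or.inl (Or.inl ⟨0, ℓL.source⟩))
  have hb₁m : b₁.re ≤ m₂ := hm₂' b₁ (Or.inr ⟨1, ℓR.target⟩)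
  set A : ℂ := ⟨min m₁ a.re, a.im⟩ with hA
  set B : ℂ := ⟨max m₂ b.re, b.im⟩ with hB
  have hAp : A.re < p := (min_le_right _ _).trans_lt ha
  have hBq : q < B.re := hb.trans_le (le_max_right _ _)
  have hcl : Convex ℝ {x : ℂ | A.re ≤ x.re ∧ x.re < p} :=
    (convex_halfSpace_re_ge _).inter (convex_halfSpace_re_lt _)
  have hcr : Convex ℝ {x : ℂ | x.re ≤ B.re ∧ q < x.re} :=
    (convex_halfSpace_re_le _).inter (convex_halfSpace_re_gt _)
  have him : ∀ j : ℝ, Convex ℝ {x : ℂ | x.im = j} := fun j => by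
    convert (convex_halfSpace_im_ge j).inter (convex_halfSpace_im_le j) using 1
    ext x
    exact ⟨fun h => ⟨h.ge, h.le⟩, fun h => le_antisymm h.2 h.1⟩
  obtain ⟨σL, hσL⟩ := (hcl.inter (him a.im)).exists_path (x := A) (y := a)
    ⟨⟨le_rfl, hAp⟩, rfl⟩ ⟨⟨min_le_right _ _, ha⟩, rfl⟩
  obtain ⟨σR, hσR⟩ := (hcr.inter (him b.im)).exists_path (x := b) (y := B)
    ⟨⟨le_max_right _ _, hb⟩, rfl⟩ ⟨⟨le_rfl, hBq⟩, rfl⟩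
  obtain ⟨τL, hτL⟩ := hcl.exists_path (x := A) (y := a₁)
    ⟨le_rfl, hAp⟩ ⟨(min_le_left _ _).trans ha₁m, ha₁⟩
  obtain ⟨τR, hτR⟩ := hcr.exists_path (x := b₁) (y := B)
    ⟨hb₁m.trans (le_max_left _ _), hb₁⟩ ⟨le_rfl, hBq⟩
  have hσLU : range σL ⊆ U' := fun x hx => hp (hσL hx).1.2
  have hσRV : range σR ⊆ V' := fun x hx => hq (hσR hx).1.2
  have hτLU : range τL ⊆ U' := fun x hx => hp (hτL hx).2
  have hτRV : range τR ⊆ V' := fun x hx => hq (hτR hx).2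
  have haj : |a.im - j| ≤ M := hM a (Or.inl (Or.inl ⟨0, γL.source⟩))
  have hbj : |b.im - j| ≤ M := hM b (Or.inr ⟨1, γR.target⟩)
  have key := cross_of_separated (γL := σL.trans γL) (γM := γM) (γR := γR.trans σR)
    (ℓL := τL.trans ℓL) (ℓM := ℓM) (ℓR := ℓR.trans τR) hε hU hzU hV hzV hU' hV' (M := M) (j := j)
    (by rw [Path.trans_range]; exact union_subset (hσLU.trans hU') hγL)
    (by rw [Path.trans_range]; exact union_subset hγR (hσRV.trans hV'))
    (by rw [Path.trans_range]; exact disjoint_union_left.2 ⟨hUV.mono_left hσLU, hLV⟩) hMU hMV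
    (by rw [Path.trans_range]; exact disjoint_union_left.2 ⟨hRU, hUV.symm.mono_left hσRV⟩)
    (by
      rw [Path.trans_range, Path.trans_range]
      rintro x (((hx | hx) | hx) | (hx | hx))
      · rw [show x.im = a.im from (hσL hx).2]; exact haj
      · exact hM x (Or.inl (Or.inl hx))
      · exact hM x (Or.inl (Or.inr hx))
      · exact hM x (Or.inr hx)
      · rw [show x.im = b.im from (hσR hx).2]; exact hbj)
    (by rw [Path.trans_range]; exact union_subset hτLU hℓL)
    (by rw [Path.trans_range]; exact union_subset hℓR hτRV) hℓM
    (by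
      have hmid : ∀ x ∈ range ℓL ∪ range ℓM ∪ range ℓR, A.re ≤ x.re ∧ x.re ≤ B.re := fun x hx =>
        ⟨(min_le_left _ _).trans (hm₁' x hx), (hm₂' x hx).trans (le_max_left _ _)⟩
      rw [Path.trans_range, Path.trans_range]
      rintro x (((hx | hx) | hx) | (hx | hx))
      · exact ⟨(hτL hx).1, by linarith [(hτL hx).2, hBq]⟩
      · exact hmid x (Or.inl (Or.inl hx))
      · exact hmid x (Or.inl (Or.inr hx))
      · exact hmid x (Or.inr hx)
      · exact ⟨by linarith [(hτR hx).2, hAp], (hτR hx).1⟩)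
    hz (hAp.le.trans hpz) (hqz.trans hBq.le)
  have hzM : z ∉ range ℓM := fun h => by
    have h1 := hℓM z h
    have h2 := (abs_nonneg _).trans haj
    linarith
  have n1 : z ∉ range ℓL := fun h => hzU (hU' (hℓL h))
  have n2 : z ∉ range ℓR := fun h => hzV (hV' (hℓR h))
  have n3 : z ∉ range τL := fun h => hzU (hU' (hτLU h))
  have n4 : z ∉ range τR := fun h => hzV (hV' (hτRV h))
  rw [← key, cross, cross, ang_trans _ n2, ang_trans n1 hzM, ang_trans, ang_trans _ hzM,
    ang_trans n3 n1, ang_trans n2 n4, ang_of_left fun x hx => (hτL hx).2.trans_le hpz,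
    ang_of_right fun x hx => hqz.trans_lt (hτR hx).2]
  · ring
  · rw [Path.trans_range]; exact fun h => h.elim n3 n1
  · rw [Path.trans_range, Path.trans_range]; exact fun h => h.elim (fun h => h.elim n3 n1) hzM
  · rw [Path.trans_range]; exact fun h => h.elim n2 n4
  · rw [Path.trans_range]; exact fun h => h.elim n1 hzM

theorem mem_farComp_image {A : Set ℂ} {ε D : ℝ} (hε : IsSgn ε) (h : ℂ ≃ₜ ℂ)
    (hD : ∀ x, ‖h x - x‖ ≤ D) {x : ℂ} (hx : x ∈ farComp A ε) : h x ∈ farComp (h '' A) ε := by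
  obtain ⟨P, hP, hPA, hxP, hfar⟩ := hx
  refine ⟨h '' P, hP.image _ h.continuous.continuousOn, ?_, ⟨x, hxP, rfl⟩, fun M => ?_⟩
  · rw [← h.image_closure, ← image_compl_eq h.bijective]
    exact image_mono hPA
  · obtain ⟨y, hy, hM⟩ := hfar (M + D)
    refine ⟨h y, ⟨y, hy, rfl⟩, ?_⟩
    have h1 := (Complex.abs_re_le_norm (h y - y)).trans (hD y)
    have h2 : |ε * (h y - y).re| ≤ D := by rwa [abs_mul, hε.abs, one_mul]
    have h3 := (abs_le.1 h2).1
    rw [Complex.sub_re, mul_sub] at h3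
    linarith

theorem mem_farComp_image_iff {A B : Set ℂ} {ε D : ℝ} (hε : IsSgn ε) (h : ℂ ≃ₜ ℂ)
    (hD : ∀ x, ‖h x - x‖ ≤ D) (hAB : h '' A = B) {x : ℂ} :
    h x ∈ farComp B ε ↔ x ∈ farComp A ε := by
  refine ⟨fun hx => ?_, fun hx => hAB ▸ mem_farComp_image hε h hD hx⟩
  have := mem_farComp_image (D := D) hε h.symm (fun y => by
    have := hD (h.symm y)
    rwa [h.apply_symm_apply, norm_sub_rev] at this) hx
  rwa [h.symm_apply_apply, ← hAB, ← image_comp, h.symm_comp_self, image_id] at this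

theorem preconnected_subset_farComp {A P : Set ℂ} {ε : ℝ} (hP : IsPreconnected P)
    (hPA : P ⊆ (closure A)ᶜ) (hfar : ∀ M : ℝ, ∃ y ∈ P, M < ε * y.re) : P ⊆ farComp A ε :=
  fun _ hx => ⟨P, hP, hPA, hx, hfar⟩

theorem convex_far (ε M : ℝ) : Convex ℝ {x : ℂ | M < ε * x.re} := by
  have : {x : ℂ | M < ε * x.re} = (ε • Complex.reLm) ⁻¹' Ioi M := by
    ext x; simp
  rw [this]
  exact (convex_Ioi M).linear_preimage _

theorem exists_far {ε : ℝ} (hε : IsSgn ε) (M M' : ℝ) : ∃ y ∈ {x : ℂ | M < ε * x.re}, M' < ε * y.re := by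
  refine ⟨((ε * (max M M' + 1) : ℝ) : ℂ), ?_, ?_⟩
  · show M < ε * _
    rw [Complex.ofReal_re, ← mul_assoc, hε.mul_self]
    linarith [le_max_left M M']
  · rw [Complex.ofReal_re, ← mul_assoc, hε.mul_self]
    linarith [le_max_right M M']

theorem far_subset_farComp {A : Set ℂ} {ε M : ℝ} (hε : IsSgn ε)
    (hM : {x : ℂ | M < ε * x.re} ⊆ (closure A)ᶜ) : {x : ℂ | M < ε * x.re} ⊆ farComp A ε :=
  preconnected_subset_farComp (convex_far ε M).isPreconnected hM (exists_far hε M)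

theorem isPreconnected_farComp {A : Set ℂ} {ε M : ℝ} (hε : IsSgn ε)
    (hM : {x : ℂ | M < ε * x.re} ⊆ (closure A)ᶜ) : IsPreconnected (farComp A ε) := by
  obtain ⟨c, hc, -⟩ := exists_far hε M M
  refine isPreconnected_of_forall c fun x hx => ?_
  have hx' := hx
  obtain ⟨P, hP, hPA, hxP, hfar⟩ := hx
  obtain ⟨y, hy, hyM⟩ := hfar M
  exact ⟨P ∪ {x : ℂ | M < ε * x.re}, union_subset (preconnected_subset_farComp hP hPA hfar)
    (far_subset_farComp hε hM), Or.inr hc, Or.inl hxP,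
    hP.union y hy hyM (convex_far ε M).isPreconnected⟩

/-- The lattice vector with coordinates `m` and `n`. -/
def lat (m n : ℤ) : ℂ := ⟨m, n⟩

@[simp] theorem lat_re (m n : ℤ) : (lat m n).re = m := rfl
@[simp] theorem lat_im (m n : ℤ) : (lat m n).im = n := rfl

theorem lat_zero : lat 0 0 = 0 := by apply Complex.ext <;> simp

theorem lat_add (m n m' n' : ℤ) : lat m n + lat m' n' = lat (m + m') (n + n') := by
  apply Complex.ext <;> simp

theorem lat_neg (m n : ℤ) : -lat m n = lat (-m) (-n) := by
  apply Complex.ext <;> simp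

theorem exists_lat_add (x : ℂ) : ∃ (m n : ℤ) (y : ℂ), x = y + lat m n ∧
    y ∈ Icc (0 : ℝ) 1 ×ℂ Icc (0 : ℝ) 1 := by
  refine ⟨⌊x.re⌋, ⌊x.im⌋, ⟨Int.fract x.re, Int.fract x.im⟩, ?_, ?_⟩
  · apply Complex.ext <;> simp
  · rw [Complex.mem_reProdIm]
    exact ⟨⟨Int.fract_nonneg _, (Int.fract_lt_one _).le⟩, ⟨Int.fract_nonneg _, (Int.fract_lt_one _).le⟩⟩

theorem isCompact_cell : IsCompact (Icc (0 : ℝ) 1 ×ℂ Icc (0 : ℝ) 1) :=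
  isCompact_Icc.reProdIm isCompact_Icc

theorem exists_bound_of_periodic {g : ℂ → ℂ} (hg : Continuous g)
    (hper : ∀ x m n, g (x + lat m n) = g x) : ∃ D, ∀ x, ‖g x‖ ≤ D := by
  obtain ⟨D, hD⟩ := isCompact_cell.bddAbove_image (f := fun x => ‖g x‖) (by fun_prop)
  refine ⟨D, fun x => ?_⟩
  obtain ⟨m, n, y, rfl, hy⟩ := exists_lat_add x
  rw [hper]
  exact hD ⟨y, hy, rfl⟩

/-- `G` is a lift of a torus homeomorphism with horizontal bounded deviation from the irrational
number `α`. -/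
structure IsRotLift (G : ℂ ≃ₜ ℂ) (α C : ℝ) : Prop where
  irr : Irrational α
  per : ∀ x m n, G (x + lat m n) = G x + lat m n
  bdd : ∀ (k : ℤ) x, |((G ^ k) x).re - x.re - k * α| ≤ C

/-- The homeomorphism `G ^ k` followed by a translation. -/
def act (G : ℂ ≃ₜ ℂ) (k m n : ℤ) : ℂ ≃ₜ ℂ := (G ^ k).trans (Homeomorph.addRight (lat m n))

theorem act_apply (G : ℂ ≃ₜ ℂ) (k m n : ℤ) (x : ℂ) : act G k m n x = (G ^ k) x + lat m n := rfl

/-- The points which lie to the left of the line `re = s`, up to the rotation, at some time. -/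
def leftSet (G : ℂ ≃ₜ ℂ) (α s : ℝ) : Set ℂ := ⋃ k : ℤ, {x | ((G ^ k) x).re - k * α < s}

def rSet (G : ℂ ≃ₜ ℂ) (α s : ℝ) : Set ℂ := farComp (leftSet G α s) 1

def lSet (G : ℂ ≃ₜ ℂ) (α s : ℝ) : Set ℂ := farComp (rSet G α s) (-1)

theorem isSgn_one : IsSgn 1 := Or.inl rfl
theorem isSgn_neg_one : IsSgn (-1) := Or.inr rfl

namespace IsRotLift

variable {G : ℂ ≃ₜ ℂ} {α C : ℝ}

theorem zpow_add_apply (G : ℂ ≃ₜ ℂ) (j k : ℤ) (x : ℂ) : (G ^ (j + k)) x = (G ^ j) ((G ^ k) x) := by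
  rw [zpow_add]; rfl

theorem zpow_per (h : IsRotLift G α C) (k : ℤ) (x : ℂ) (m n : ℤ) :
    (G ^ k) (x + lat m n) = (G ^ k) x + lat m n := by
  have hsymm : ∀ x, G.symm (x + lat m n) = G.symm x + lat m n := fun x => by
    rw [G.symm_apply_eq, h.per, G.apply_symm_apply]
  induction k generalizing x with
  | zero => rfl
  | succ k ih => rw [add_comm (k : ℤ) 1, zpow_add_apply, zpow_add_apply, ih, zpow_one, h.per]
  | pred k ih =>
    have hinv : G ^ (-1 : ℤ) = G.symm := by rw [zpow_neg_one]; rfl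
    rw [sub_eq_add_neg, add_comm _ (-1 : ℤ), zpow_add_apply, zpow_add_apply, ih, hinv, hsymm]

theorem C_nonneg (h : IsRotLift G α C) : 0 ≤ C := (abs_nonneg _).trans (h.bdd 0 0)

theorem act_bdd (h : IsRotLift G α C) (k m n : ℤ) : ∃ D, ∀ x, ‖act G k m n x - x‖ ≤ D :=
  exists_bound_of_periodic (g := fun x => act G k m n x - x) (by fun_prop) fun x m' n' => by
    simp only [act_apply, h.zpow_per]; ring

theorem zpow_bdd (h : IsRotLift G α C) (k : ℤ) : ∃ D, ∀ x, ‖(G ^ k) x - x‖ ≤ D := by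
  simpa [act_apply, lat_zero] using h.act_bdd k 0 0

theorem zpow_act (h : IsRotLift G α C) (j k m n : ℤ) (x : ℂ) :
    (G ^ j) (act G k m n x) = (G ^ (j + k)) x + lat m n := by
  rw [act_apply, h.zpow_per, zpow_add_apply]

theorem act_act (h : IsRotLift G α C) (k m n k' m' n' : ℤ) (x : ℂ) :
    act G k m n (act G k' m' n' x) = act G (k + k') (m + m') (n + n') x := by
  rw [act_apply, h.zpow_act, act_apply, add_assoc, lat_add, add_comm m', add_comm n']

theorem act_zero (G : ℂ ≃ₜ ℂ) (x : ℂ) : act G 0 0 0 x = x := by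
  rw [act_apply, lat_zero, add_zero]; rfl

theorem act_mem_leftSet (h : IsRotLift G α C) (k m n : ℤ) (s : ℝ) {x : ℂ} :
    act G k m n x ∈ leftSet G α (s + (k * α + m)) ↔ x ∈ leftSet G α s := by
  simp only [leftSet, mem_iUnion, mem_ofPred_eq, h.zpow_act, Complex.add_re, lat_re]
  constructor
  · rintro ⟨j, hj⟩
    refine ⟨j + k, ?_⟩
    push_cast
    linarith
  · rintro ⟨j, hj⟩
    refine ⟨j - k, ?_⟩
    rw [sub_add_cancel]
    push_cast
    linarith

theorem act_image_of_iff {S T : Set ℂ} {g : ℂ ≃ₜ ℂ} (hg : ∀ x, g x ∈ T ↔ x ∈ S) : g '' S = T := by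
  ext y
  constructor
  · rintro ⟨x, hx, rfl⟩
    exact (hg x).2 hx
  · intro hy
    exact ⟨g.symm y, (hg _).1 (by rwa [g.apply_symm_apply]), g.apply_symm_apply y⟩

theorem act_mem_rSet (h : IsRotLift G α C) (k m n : ℤ) (s : ℝ) {x : ℂ} :
    act G k m n x ∈ rSet G α (s + (k * α + m)) ↔ x ∈ rSet G α s := by
  obtain ⟨D, hD⟩ := h.act_bdd k m n
  exact mem_farComp_image_iff isSgn_one _ hD
    (act_image_of_iff fun x => h.act_mem_leftSet k m n s)

theorem act_mem_lSet (h : IsRotLift G α C) (k m n : ℤ) (s : ℝ) {x : ℂ} :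
    act G k m n x ∈ lSet G α (s + (k * α + m)) ↔ x ∈ lSet G α s := by
  obtain ⟨D, hD⟩ := h.act_bdd k m n
  exact mem_farComp_image_iff isSgn_neg_one _ hD (act_image_of_iff fun x => h.act_mem_rSet k m n s)

theorem leftSet_mono {s t : ℝ} (hst : s ≤ t) : leftSet G α s ⊆ leftSet G α t :=
  iUnion_mono fun _ _ hx => lt_of_lt_of_le hx hst

theorem rSet_anti {s t : ℝ} (hst : s ≤ t) : rSet G α t ⊆ rSet G α s :=
  farComp_anti (leftSet_mono hst) 1

theorem lSet_mono {s t : ℝ} (hst : s ≤ t) : lSet G α s ⊆ lSet G α t :=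
  farComp_anti (rSet_anti hst) (-1)

theorem isOpen_leftSet (G : ℂ ≃ₜ ℂ) (α s : ℝ) : IsOpen (leftSet G α s) :=
  isOpen_iUnion fun k => isOpen_lt (by fun_prop) (by fun_prop)

theorem isOpen_rSet (G : ℂ ≃ₜ ℂ) (α s : ℝ) : IsOpen (rSet G α s) := isOpen_farComp _ _

theorem isOpen_lSet (G : ℂ ≃ₜ ℂ) (α s : ℝ) : IsOpen (lSet G α s) := isOpen_farComp _ _

theorem subset_leftSet (G : ℂ ≃ₜ ℂ) (α s : ℝ) : {x : ℂ | x.re < s} ⊆ leftSet G α s :=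
  fun x hx => mem_iUnion.2 ⟨0, by simpa using hx⟩

theorem leftSet_subset (h : IsRotLift G α C) (s : ℝ) : leftSet G α s ⊆ {x : ℂ | x.re < s + C} := by
  intro x hx
  obtain ⟨k, hk⟩ := mem_iUnion.1 hx
  have h1 := (abs_le.1 (h.bdd k x)).1
  simp only [mem_ofPred_eq] at hk ⊢
  linarith

theorem isPreconnected_leftSet (h : IsRotLift G α C) (s : ℝ) : IsPreconnected (leftSet G α s) := by
  refine isPreconnected_iUnion ⟨((s - C - 1 : ℝ) : ℂ), mem_iInter.2 fun k => ?_⟩ fun k => ?_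
  · have h1 := (abs_le.1 (h.bdd k ((s - C - 1 : ℝ) : ℂ))).2
    rw [Complex.ofReal_re] at h1
    simp only [mem_ofPred_eq]
    linarith
  · have : {x | ((G ^ k) x).re - k * α < s} = (G ^ k) ⁻¹' {x | x.re < s + k * α} := by
      ext x
      simp only [mem_ofPred_eq, mem_preimage]
      exact sub_lt_iff_lt_add
    rw [this]
    exact (Homeomorph.isPreconnected_preimage (G ^ k)).2 (convex_halfSpace_re_lt _).isPreconnected

theorem leftSet_far (G : ℂ ≃ₜ ℂ) (α s M : ℝ) : ∃ y ∈ leftSet G α s, 1 * y.re < M := by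
  refine ⟨((min s M - 1 : ℝ) : ℂ), subset_leftSet G α s ?_, ?_⟩
  · show (_ : ℝ) < s
    rw [Complex.ofReal_re]; linarith [min_le_left s M]
  · rw [Complex.ofReal_re]; linarith [min_le_right s M]

theorem noWind_rSet (h : IsRotLift G α C) {s : ℝ} {z : ℂ} (hz : z ∉ rSet G α s) :
    NoWind (rSet G α s) z :=
  noWind_farComp isSgn_one (h.isPreconnected_leftSet s) (leftSet_far G α s) hz

theorem far_compl_leftSet (h : IsRotLift G α C) (s : ℝ) :
    {x : ℂ | s + C < 1 * x.re} ⊆ (closure (leftSet G α s))ᶜ := by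
  intro x hx hxc
  have h1 : closure (leftSet G α s) ⊆ {x : ℂ | x.re ≤ s + C} :=
    closure_minimal
      (fun y hy => show y.re ≤ s + C from le_of_lt (h.leftSet_subset s hy)) (isClosed_le (by fun_prop) (by fun_prop))
  have h2 : x.re ≤ s + C := h1 hxc
  rw [mem_ofPred_eq, one_mul] at hx
  linarith

theorem isPreconnected_rSet (h : IsRotLift G α C) (s : ℝ) : IsPreconnected (rSet G α s) :=
  isPreconnected_farComp isSgn_one (h.far_compl_leftSet s)

theorem subset_rSet (h : IsRotLift G α C) (s : ℝ) : {x : ℂ | s + C < x.re} ⊆ rSet G α s := by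
  intro x hx
  refine far_subset_farComp isSgn_one (h.far_compl_leftSet s) ?_
  rwa [mem_ofPred_eq, one_mul]

theorem rSet_far (h : IsRotLift G α C) (s M : ℝ) : ∃ y ∈ rSet G α s, -1 * y.re < M := by
  refine ⟨((max (s + C) (-M) + 1 : ℝ) : ℂ), h.subset_rSet s ?_, ?_⟩
  · show _ < (_ : ℝ)
    rw [Complex.ofReal_re]; linarith [le_max_left (s + C) (-M)]
  · rw [Complex.ofReal_re]; linarith [le_max_right (s + C) (-M)]

theorem noWind_lSet (h : IsRotLift G α C) {s : ℝ} {z : ℂ} (hz : z ∉ lSet G α s) :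
    NoWind (lSet G α s) z :=
  noWind_farComp isSgn_neg_one (h.isPreconnected_rSet s) (h.rSet_far s) hz

theorem leftSet_disjoint_closure_rSet (G : ℂ ≃ₜ ℂ) (α s : ℝ) :
    leftSet G α s ⊆ (closure (rSet G α s))ᶜ := by
  intro x hx hxc
  obtain ⟨y, hy, hyR⟩ := mem_closure_iff.1 hxc _ (isOpen_leftSet G α s) hx
  exact farComp_subset hyR (subset_closure hy)

theorem leftSet_subset_lSet (h : IsRotLift G α C) (s : ℝ) : leftSet G α s ⊆ lSet G α s :=
  preconnected_subset_farComp (h.isPreconnected_leftSet s) (leftSet_disjoint_closure_rSet G α s)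
    fun M => by
      obtain ⟨y, hy, hM⟩ := leftSet_far G α s (-M)
      exact ⟨y, hy, by linarith⟩

theorem subset_lSet (h : IsRotLift G α C) (s : ℝ) : {x : ℂ | x.re < s} ⊆ lSet G α s :=
  (subset_leftSet G α s).trans (h.leftSet_subset_lSet s)

theorem isPreconnected_lSet (G : ℂ ≃ₜ ℂ) (α s : ℝ) : IsPreconnected (lSet G α s) := by
  refine isPreconnected_farComp (M := -s) isSgn_neg_one fun x hx => ?_
  refine leftSet_disjoint_closure_rSet G α s (subset_leftSet G α s ?_)
  rw [mem_ofPred_eq] at hx ⊢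
  linarith

theorem disjoint_lSet_rSet {s t : ℝ} (hst : s ≤ t) : Disjoint (lSet G α s) (rSet G α t) :=
  disjoint_left.2 fun _ hx hxt => farComp_subset hx (subset_closure (rSet_anti hst hxt))

theorem re_of_mem_rSet {s : ℝ} {x : ℂ} (hx : x ∈ rSet G α s) : s ≤ x.re :=
  not_lt.1 fun hlt => farComp_subset hx (subset_closure (subset_leftSet G α s hlt))

theorem exists_path_lSet {s : ℝ} {x y : ℂ} (hx : x ∈ lSet G α s)
    (hy : y ∈ lSet G α s) : ∃ γ : Path x y, range γ ⊆ lSet G α s := by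
  obtain ⟨γ, hγ⟩ := ((isOpen_lSet G α s).isConnected_iff_isPathConnected.1
    ⟨⟨x, hx⟩, isPreconnected_lSet G α s⟩).joinedIn x hx y hy
  exact ⟨γ, by rintro _ ⟨t, rfl⟩; exact hγ t⟩

theorem exists_path_rSet (h : IsRotLift G α C) {s : ℝ} {x y : ℂ} (hx : x ∈ rSet G α s)
    (hy : y ∈ rSet G α s) : ∃ γ : Path x y, range γ ⊆ rSet G α s := by
  obtain ⟨γ, hγ⟩ := ((isOpen_rSet G α s).isConnected_iff_isPathConnected.1
    ⟨⟨x, hx⟩, h.isPreconnected_rSet s⟩).joinedIn x hx y hy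
  exact ⟨γ, by rintro _ ⟨t, rfl⟩; exact hγ t⟩

end IsRotLift

/-- The height of `x` with respect to the family of right regions. -/
def hgt (G : ℂ ≃ₜ ℂ) (α : ℝ) (x : ℂ) : ℝ := sSup {t | x ∈ rSet G α t}

namespace IsRotLift

variable {G : ℂ ≃ₜ ℂ} {α C : ℝ}

theorem bddAbove_rSet (G : ℂ ≃ₜ ℂ) (α : ℝ) (x : ℂ) : BddAbove {t | x ∈ rSet G α t} :=
  ⟨x.re, fun _ ht => re_of_mem_rSet ht⟩

theorem nonempty_rSet (h : IsRotLift G α C) (x : ℂ) : {t | x ∈ rSet G α t}.Nonempty :=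
  ⟨x.re - C - 1, h.subset_rSet _ (show _ < x.re by linarith)⟩

theorem le_hgt {x : ℂ} {t : ℝ} (hx : x ∈ rSet G α t) : t ≤ hgt G α x :=
  le_csSup (bddAbove_rSet G α x) hx

theorem mem_of_lt_hgt (h : IsRotLift G α C) {x : ℂ} {t : ℝ} (ht : t < hgt G α x) :
    x ∈ rSet G α t := by
  obtain ⟨t', ht', hlt⟩ := exists_lt_of_lt_csSup (h.nonempty_rSet x) ht
  exact rSet_anti hlt.le ht'

theorem hgt_le_re (h : IsRotLift G α C) (x : ℂ) : hgt G α x ≤ x.re :=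
  csSup_le (h.nonempty_rSet x) fun _ ht => re_of_mem_rSet ht

theorem re_le_hgt (h : IsRotLift G α C) (x : ℂ) : x.re - C ≤ hgt G α x :=
  le_of_forall_lt fun t ht => by
    obtain ⟨t', h1, h2⟩ := exists_between ht
    exact h1.trans_le (le_hgt (h.subset_rSet _ (show _ < x.re by linarith)))

theorem hgt_act (h : IsRotLift G α C) (k m n : ℤ) (x : ℂ) :
    hgt G α (act G k m n x) = hgt G α x + (k * α + m) := by
  apply le_antisymm
  · refine csSup_le (h.nonempty_rSet _) fun t ht => ?_
    rw [mem_ofPred_eq, ← sub_add_cancel t (k * α + m : ℝ), h.act_mem_rSet] at ht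
    linarith [le_hgt ht]
  · rw [← le_sub_iff_add_le]
    refine csSup_le (h.nonempty_rSet _) fun t ht => ?_
    linarith [le_hgt ((h.act_mem_rSet k m n t).2 ht)]

theorem continuous_hgt (h : IsRotLift G α C)
    (hcl : ∀ s t, s < t → closure (rSet G α t) ⊆ rSet G α s) : Continuous (hgt G α) := by
  rw [continuous_iff_continuousAt]
  intro x
  rw [ContinuousAt, tendsto_order]
  constructor
  · intro c hc
    obtain ⟨c', h1, h2⟩ := exists_between hc
    filter_upwards [(isOpen_rSet G α c').mem_nhds (h.mem_of_lt_hgt h2)] with y hy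
    exact h1.trans_le (le_hgt hy)
  · intro c hc
    obtain ⟨c₁, h1, h2⟩ := exists_between hc
    obtain ⟨c₂, h3, h4⟩ := exists_between h2
    have hx : x ∈ (closure (rSet G α c₂))ᶜ := fun hx => (le_hgt (hcl _ _ h3 hx)).not_gt h1
    filter_upwards [isClosed_closure.isOpen_compl.mem_nhds hx] with y hy
    refine lt_of_le_of_lt (not_lt.1 fun hlt => ?_) h4
    exact hy (subset_closure (h.mem_of_lt_hgt hlt))

theorem surjective_hgt (h : IsRotLift G α C) (hc : Continuous (hgt G α)) :
    Function.Surjective (hgt G α) := by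
  have hs : Function.Surjective (fun t : ℝ => hgt G α (t : ℂ)) := by
    refine (hc.comp Complex.continuous_ofReal).surjective ?_ ?_
    · refine tendsto_atTop_mono (fun t => ?_) (tendsto_atTop_add_const_right atTop (-C) tendsto_id)
      simpa using h.re_le_hgt (t : ℂ)
    · refine tendsto_atBot_mono (fun t => ?_) tendsto_id
      simpa using h.hgt_le_re (t : ℂ)
  intro r
  obtain ⟨t, ht⟩ := hs r
  exact ⟨_, ht⟩

/-- If `hgt` is not continuous then there is a contact point. -/
theorem exists_contact (h : IsRotLift G α C)
    (hcl : ¬ ∀ s t, s < t → closure (rSet G α t) ⊆ rSet G α s) :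
    ∃ s t p, s < t ∧ p ∈ closure (lSet G α s) ∧ p ∈ closure (rSet G α t) := by
  push Not at hcl
  obtain ⟨s, t, hst, hsub⟩ := hcl
  obtain ⟨p, hp, hps⟩ := not_subset.1 hsub
  refine ⟨s, t, p, hst, closure_mono (h.leftSet_subset_lSet s) ?_, hp⟩
  by_contra hcon
  obtain ⟨r, hr, hball⟩ := Metric.isOpen_iff.1 isClosed_closure.isOpen_compl p hcon
  obtain ⟨y, hy, hyt⟩ := mem_closure_iff.1 hp _ isOpen_ball (mem_ball_self hr)
  exact hps (mem_farComp_of_preconnected (convex_ball p r).isPreconnected hball hy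
    (mem_ball_self hr) (rSet_anti hst.le hyt))

theorem act_mem_closure_lSet (h : IsRotLift G α C) (k m n : ℤ) {s : ℝ} {p : ℂ}
    (hp : p ∈ closure (lSet G α s)) : act G k m n p ∈ closure (lSet G α (s + (k * α + m))) := by
  rw [← act_image_of_iff (fun x => h.act_mem_lSet k m n s (x := x)), ← Homeomorph.image_closure]
  exact ⟨p, hp, rfl⟩

theorem act_mem_closure_rSet (h : IsRotLift G α C) (k m n : ℤ) {s : ℝ} {p : ℂ}
    (hp : p ∈ closure (rSet G α s)) : act G k m n p ∈ closure (rSet G α (s + (k * α + m))) := by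
  rw [← act_image_of_iff (fun x => h.act_mem_rSet k m n s (x := x)), ← Homeomorph.image_closure]
  exact ⟨p, hp, rfl⟩

theorem exists_near (h : IsRotLift G α C) (r : ℝ) {η : ℝ} (hη : 0 < η) :
    ∃ k m : ℤ, |k * α + m - r| < η := by
  have hd := dense_addSubgroupClosure_pair_iff.2 (show Irrational (α / 1) by simpa using h.irr)
  obtain ⟨y, hy, hyr⟩ := hd.exists_dist_lt r hη
  rw [SetLike.mem_coe, AddSubgroup.mem_closure_pair] at hy
  obtain ⟨k, m, rfl⟩ := hy
  refine ⟨k, m, ?_⟩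
  rw [dist_comm, Real.dist_eq] at hyr
  simpa using hyr

theorem exists_finite_near (h : IsRotLift G α C) {η : ℝ} (hη : 0 < η) :
    ∃ K : Finset ℤ, ∀ r : ℝ, ∃ k ∈ K, ∃ m : ℤ, |k * α + m - r| < η := by
  choose k m hkm using fun r => h.exists_near r (half_pos hη)
  obtain ⟨T, -, hT⟩ := (isCompact_Icc (a := (0 : ℝ)) (b := 1)).elim_nhds_subcover
    (fun r => ball r (η / 2)) (fun r _ => ball_mem_nhds r (half_pos hη))
  refine ⟨T.image k, fun r => ?_⟩
  have hr := hT (show Int.fract r ∈ Icc (0 : ℝ) 1 from ⟨Int.fract_nonneg r, (Int.fract_lt_one r).le⟩)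
  simp only [mem_iUnion] at hr
  obtain ⟨w, hwT, hw⟩ := hr
  refine ⟨k w, Finset.mem_image_of_mem k hwT, m w + ⌊r⌋, ?_⟩
  have h1 := abs_lt.1 (hkm w)
  rw [mem_ball, Real.dist_eq] at hw
  have h2 := abs_lt.1 hw
  have h3 := Int.floor_add_fract r
  push_cast
  rw [abs_lt]
  constructor <;> linarith

theorem nonempty_inter (h : IsRotLift G α C) {u v : ℝ} (huv : u < v) :
    (lSet G α v ∩ rSet G α u).Nonempty := by
  by_contra hcon
  have h1 : rSet G α u ⊆ rSet G α v := by
    refine preconnected_subset_farComp (h.isPreconnected_rSet u) (fun x hx hxc => ?_) fun M => ?_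
    · obtain ⟨y, hy, hyv⟩ := mem_closure_iff.1 hxc _ (isOpen_rSet G α u) hx
      exact hcon ⟨y, h.leftSet_subset_lSet v hyv, hy⟩
    · obtain ⟨y, hy, hM⟩ := h.rSet_far u (-M)
      exact ⟨y, hy, by linarith⟩
  obtain ⟨k, m, hkm⟩ := h.exists_near ((u + v) / 2 - u) (show 0 < (v - u) / 2 by linarith)
  have hkm' := abs_lt.1 hkm
  set θ : ℝ := k * α + m with hθ
  have h2 : rSet G α u ⊆ rSet G α (u + θ) := h1.trans (rSet_anti (by linarith))
  obtain ⟨x, hx, -⟩ := h.rSet_far u 0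
  have h3 : ∀ n : ℕ, x ∈ rSet G α (u + n * θ) := by
    have h4 : ∀ n : ℕ, rSet G α u ⊆ rSet G α (u + n * θ) := by
      intro n
      induction n with
      | zero => simp
      | succ n ih =>
        intro y hy
        have hy' := h2 hy
        rw [← (act G k m 0).apply_symm_apply y, h.act_mem_rSet] at hy'
        have h5 := (h.act_mem_rSet k m 0 (u + n * θ)).2 (ih hy')
        rw [(act G k m 0).apply_symm_apply] at h5
        convert h5 using 2
        push_cast
        ring
    exact fun n => h4 n hx
  obtain ⟨n, hn⟩ := exists_nat_gt ((x.re - u) / θ)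
  rw [div_lt_iff₀ (by linarith)] at hn
  linarith [re_of_mem_rSet (h3 n)]

end IsRotLift

/-- A path crossing the plane from left to right, made of a piece to the left of level `κ`, a piece
between the levels `s` and `t`, and a piece to the right of level `τ`. -/
structure IsBaseLine (G : ℂ ≃ₜ ℂ) (α C s t κ τ δ : ℝ) {a c c' b : ℂ} (γL : Path a c)
    (γM : Path c c') (γR : Path c' b) : Prop where
  pos : 0 < δ
  left : range γL ⊆ lSet G α κ
  mid_left : range γM ⊆ lSet G α (t - δ)
  mid_right : range γM ⊆ rSet G α (s + δ)
  right : range γR ⊆ rSet G α τ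
  le_κ : s + δ ≤ κ
  κ_le : κ + δ ≤ t
  le_τ : s + δ ≤ τ
  τ_le : τ + δ ≤ t
  far_left : a.re + δ + C < s
  far_right : t + δ + 2 * C < b.re

namespace IsRotLift

variable {G : ℂ ≃ₜ ℂ} {α C s t κ τ δ : ℝ} {a c c' b : ℂ} {γL : Path a c} {γM : Path c c'}
  {γR : Path c' b}

theorem cross_of_isBaseLine (h : IsRotLift G α C) (hl : IsBaseLine G α C s t κ τ δ γL γM γR)
    {z : ℂ} (hzl : z ∉ lSet G α (κ + δ)) (hzr : z ∉ rSet G α (τ - δ))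
    {n k m j : ℤ} {M D ε : ℝ} (hε : IsSgn ε) (hkm : |k * α + m - n * α| < δ)
    (hM : ∀ x ∈ range γL ∪ range γM ∪ range γR, |((G ^ k) x).im| ≤ M)
    (hD : ∀ x, ‖(G ^ n) x - x‖ ≤ D) {a₁ b₁ e e' : ℂ}
    (ha₁ : a₁.re < s - 2 * D - C) (hb₁ : t + 2 * D + 2 * C < b₁.re)
    {ℓL : Path a₁ e} {ℓM : Path e e'} {ℓR : Path e' b₁} (hℓL : range ℓL ⊆ lSet G α s)
    (hℓR : range ℓR ⊆ rSet G α t) (hℓM : ∀ x ∈ range ℓM, ε * (((G ^ n) x).im - j) < -M)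
    (hz : M < ε * (((G ^ n) z).im - j)) :
    cross ((ℓL.trans ℓM).trans ℓR) z = ε * Real.pi * Complex.I := by
  obtain ⟨hδ, hL, hML, hMR, hR, h1, h2, h3, h4, h5, h6⟩ := hl
  have hC := h.C_nonneg
  have hD0 : 0 ≤ D := (norm_nonneg _).trans (hD 0)
  have hM0 : 0 ≤ M := (abs_nonneg _).trans (hM a (Or.inl (Or.inl ⟨0, γL.source⟩)))
  have hkm' := abs_lt.1 hkm
  have hzre : s ≤ z.re := by
    by_contra hlt
    exact hzl (h.subset_lSet _ (show z.re < κ + δ by linarith))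
  have hzre' : z.re ≤ t + C := by
    by_contra hlt
    exact hzr (h.subset_rSet _ (show τ - δ + C < z.re by linarith))
  have hgl : ∀ r x, (G ^ n) x ∈ lSet G α (r + n * α) ↔ x ∈ lSet G α r := fun r x => by
    have := h.act_mem_lSet n 0 0 r (x := x)
    simpa [act_apply, lat_zero] using this
  have hgr : ∀ r x, (G ^ n) x ∈ rSet G α (r + n * α) ↔ x ∈ rSet G α r := fun r x => by
    have := h.act_mem_rSet n 0 0 r (x := x)
    simpa [act_apply, lat_zero] using this
  have hzrange : z ∉ range ((ℓL.trans ℓM).trans ℓR) := by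
    rw [Path.trans_range, Path.trans_range]
    rintro ((hx | hx) | hx)
    · exact hzl (lSet_mono (by linarith) (hℓL hx))
    · have := hℓM z hx
      linarith
    · exact hzr (rSet_anti (by linarith) (hℓR hx))
  rw [← cross_map (G ^ n).continuous (G ^ n).injective hD hzrange (by linarith) (by linarith),
    Path.map_trans, Path.map_trans]
  have hrange : ∀ {x y : ℂ} (γ : Path x y) (S T : Set ℂ) (f : ℂ ≃ₜ ℂ), (∀ x ∈ S, f x ∈ T) →
      range γ ⊆ S → range (γ.map f.continuous) ⊆ T := by
    rintro x y γ S T f hf hγ _ ⟨r, rfl⟩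
    exact hf _ (hγ ⟨r, rfl⟩)
  set θ : ℝ := k * α + m with hθ
  have hact : (act G k m j : ℂ → ℂ) = fun x => (G ^ k) x + lat m j := rfl
  have hpmL := hrange γL _ _ (act G k m j) (fun x hx => (h.act_mem_lSet k m j κ).2 hx) hL
  have hpmML := hrange γM _ _ (act G k m j) (fun x hx => (h.act_mem_lSet k m j _).2 hx) hML
  have hpmMR := hrange γM _ _ (act G k m j) (fun x hx => (h.act_mem_rSet k m j _).2 hx) hMR
  have hpmR := hrange γR _ _ (act G k m j) (fun x hx => (h.act_mem_rSet k m j _).2 hx) hR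
  have hzU : (G ^ n) z ∉ lSet G α (κ + θ) := fun hx =>
    hzl ((hgl _ _).1 (lSet_mono (by linarith) hx))
  have hzV : (G ^ n) z ∉ rSet G α (τ + θ) := fun hx =>
    hzr ((hgr _ _).1 (rSet_anti (by linarith) hx))
  refine cross_of_separated_of_far (U := lSet G α (κ + θ)) (V := rSet G α (τ + θ))
    (U' := lSet G α (s + n * α)) (V' := rSet G α (t + n * α)) (j := j) (M := M)
    (p := s + n * α) (q := t + n * α + C) (γL := γL.map (act G k m j).continuous)
    (γM := γM.map (act G k m j).continuous) (γR := γR.map (act G k m j).continuous)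
    hε (h.noWind_lSet hzU) hzU (h.noWind_rSet hzV) hzV (lSet_mono (by linarith))
    (rSet_anti (by linarith)) (disjoint_lSet_rSet (by linarith)) (h.subset_lSet _)
    (h.subset_rSet _) ?_ ?_ ?_ ?_ hpmL hpmR
    ((disjoint_lSet_rSet (by linarith)).mono_left hpmL)
    ((disjoint_lSet_rSet (by linarith)).symm.mono_left hpmMR)
    ((disjoint_lSet_rSet (by linarith)).mono_left hpmML)
    ((disjoint_lSet_rSet (by linarith)).symm.mono_left hpmR) ?_
    (hrange ℓL _ _ (G ^ n) (fun x hx => (hgl _ _).2 hx) hℓL)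
    (hrange ℓR _ _ (G ^ n) (fun x hx => (hgr _ _).2 hx) hℓR) ?_ hz
  · have := (abs_le.1 (h.bdd k a)).2
    rw [act_apply, Complex.add_re, lat_re]
    linarith
  · have := (abs_le.1 (h.bdd n a₁)).2
    linarith
  · have := (abs_le.1 (h.bdd k b)).1
    rw [act_apply, Complex.add_re, lat_re]
    linarith
  · have := (abs_le.1 (h.bdd n b₁)).1
    linarith
  · have key : ∀ x ∈ range γL ∪ range γM ∪ range γR, |(act G k m j x).im - j| ≤ M := fun x hx => by
      rw [act_apply, Complex.add_im, lat_im, add_sub_cancel_right]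
      exact hM x hx
    rintro _ ((⟨r, rfl⟩ | ⟨r, rfl⟩) | ⟨r, rfl⟩)
    · exact key _ (Or.inl (Or.inl ⟨r, rfl⟩))
    · exact key _ (Or.inl (Or.inr ⟨r, rfl⟩))
    · exact key _ (Or.inr ⟨r, rfl⟩)
  · rintro _ ⟨r, rfl⟩
    exact hℓM _ ⟨r, rfl⟩

end IsRotLift

/-- The vertical displacement of `x` after time `n`. -/
def vert (G : ℂ ≃ₜ ℂ) (n : ℤ) (x : ℂ) : ℝ := ((G ^ n) x).im - x.im

theorem exists_int_between {ε u v M : ℝ} (hε : IsSgn ε) (h : 2 * M + 2 < ε * (u - v)) :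
    ∃ j : ℤ, M < ε * (u - j) ∧ ε * (v - j) < -M := by
  refine ⟨round ((u + v) / 2), ?_⟩
  have h1 := abs_le.1 (abs_sub_round ((u + v) / 2))
  rcases hε with rfl | rfl <;> constructor <;> linarith

namespace IsRotLift

variable {G : ℂ ≃ₜ ℂ} {α C s t κ τ δ : ℝ} {a c c' b : ℂ} {γL : Path a c} {γM : Path c c'}
  {γR : Path c' b}

theorem vert_act (h : IsRotLift G α C) (n k m j : ℤ) (x : ℂ) :
    vert G n (act G k m j x) = vert G n ((G ^ k) x) := by
  rw [vert, vert, h.zpow_act, act_apply, Complex.add_im, Complex.add_im, zpow_add_apply]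
  ring

theorem vert_zpow_sub (G : ℂ ≃ₜ ℂ) (n k : ℤ) (x : ℂ) :
    vert G n ((G ^ k) x) - vert G n x = vert G k ((G ^ n) x) - vert G k x := by
  simp only [vert, ← zpow_add_apply, add_comm n k]
  ring

theorem not_swap (h : IsRotLift G α C) (hl : IsBaseLine G α C s t κ τ δ γL γM γR) {p z : ℂ}
    (hps : p ∈ closure (lSet G α s)) (hpt : p ∈ closure (rSet G α t))
    (hzl : z ∉ lSet G α (κ + δ)) (hzr : z ∉ rSet G α (τ - δ))
    {n k m : ℤ} {M ε : ℝ} (hε : IsSgn ε) (hkm : |k * α + m - n * α| < δ)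
    (hM0 : ∀ x ∈ range γL ∪ range γM ∪ range γR, |((G ^ (0 : ℤ)) x).im| ≤ M)
    (hM : ∀ x ∈ range γL ∪ range γM ∪ range γR, |((G ^ k) x).im| ≤ M)
    (h1 : 2 * M + 2 < ε * (z.im - p.im))
    (h2 : 2 * M + 2 < -ε * (((G ^ n) z).im - ((G ^ n) p).im)) : False := by
  obtain ⟨D, hD⟩ := h.zpow_bdd n
  have hD0 : 0 ≤ D := (norm_nonneg _).trans (hD 0)
  have hC := h.C_nonneg
  obtain ⟨j, hj, hjp⟩ := exists_int_between hε h1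
  obtain ⟨j', hj', hjp'⟩ := exists_int_between hε.neg h2
  have hO : IsOpen {x : ℂ | ε * (x.im - j) < -M ∧ -ε * (((G ^ n) x).im - j') < -M} :=
    IsOpen.and (isOpen_lt (by fun_prop) (by fun_prop)) (isOpen_lt (by fun_prop) (by fun_prop))
  obtain ⟨r, hr, hball⟩ := Metric.isOpen_iff.1 hO p ⟨hjp, hjp'⟩
  obtain ⟨e, heb, he⟩ := mem_closure_iff.1 hps _ isOpen_ball (mem_ball_self hr)
  obtain ⟨e', heb', he'⟩ := mem_closure_iff.1 hpt _ isOpen_ball (mem_ball_self hr)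
  obtain ⟨ℓM, hℓM⟩ := (convex_ball p r).exists_path heb heb'
  obtain ⟨ℓL, hℓL⟩ := exists_path_lSet (h.subset_lSet s
    (show ((s - 2 * D - C - 1 : ℝ) : ℂ).re < s by rw [Complex.ofReal_re]; linarith)) he
  obtain ⟨ℓR, hℓR⟩ := h.exists_path_rSet he' (h.subset_rSet t
    (show t + C < ((t + 2 * D + 2 * C + 1 : ℝ) : ℂ).re by rw [Complex.ofReal_re]; linarith))
  have ha₁ : ((s - 2 * D - C - 1 : ℝ) : ℂ).re < s - 2 * D - C := by
    rw [Complex.ofReal_re]; linarith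
  have hb₁ : t + 2 * D + 2 * C < ((t + 2 * D + 2 * C + 1 : ℝ) : ℂ).re := by
    rw [Complex.ofReal_re]; linarith
  have e1 := h.cross_of_isBaseLine hl hzl hzr (n := 0) (k := 0) (m := 0) (j := j) hε
    (by simpa using hl.pos) hM0 (fun x => by simpa using hD0) ha₁ hb₁ hℓL hℓR
    (fun x hx => (hball (hℓM hx)).1) hj
  have e2 := h.cross_of_isBaseLine hl hzl hzr (n := n) (k := k) (m := m) (j := j') hε.neg
    hkm hM hD ha₁ hb₁ hℓL hℓR (fun x hx => (hball (hℓM hx)).2) hj'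
  rw [e1] at e2
  have h3 := congrArg Complex.im e2
  have h4 := Real.pi_pos
  simp at h3
  rcases hε with rfl | rfl <;> linarith

theorem exists_abs_vert_sub_le (h : IsRotLift G α C)
    (hl : IsBaseLine G α C s t κ τ δ γL γM γR) {p : ℂ}
    (hps : p ∈ closure (lSet G α s)) (hpt : p ∈ closure (rSet G α t)) :
    ∃ K, ∀ z, z ∉ lSet G α (κ + δ) → z ∉ rSet G α (τ - δ) → ∀ n : ℤ,
      |vert G n z - vert G n p| ≤ K := by
  obtain ⟨T, hT⟩ := h.exists_finite_near hl.pos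
  have hcomp : IsCompact (range γL ∪ range γM ∪ range γR) :=
    ((isCompact_range γL.continuous).union (isCompact_range γM.continuous)).union
      (isCompact_range γR.continuous)
  have hbound : ∀ k : ℤ, ∃ M : ℝ, ∀ x ∈ range γL ∪ range γM ∪ range γR, |((G ^ k) x).im| ≤ M :=
    fun k => by
      obtain ⟨M, hM⟩ := hcomp.bddAbove_image (f := fun x => |((G ^ k) x).im|) (by fun_prop)
      exact ⟨M, fun x hx => hM ⟨x, hx, rfl⟩⟩
  choose Mf hMf using hbound
  obtain ⟨M, hM⟩ := ((insert 0 T).image Mf).exists_le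
  have hM' : ∀ k ∈ insert 0 T, ∀ x ∈ range γL ∪ range γM ∪ range γR, |((G ^ k) x).im| ≤ M :=
    fun k hk x hx => (hMf k x hx).trans (hM _ (Finset.mem_image_of_mem Mf hk))
  have key : ∀ z, z ∉ lSet G α (κ + δ) → z ∉ rSet G α (τ - δ) → ∀ n : ℤ, ∀ ε, IsSgn ε →
      -(4 * M + 5) ≤ ε * (vert G n z - vert G n p) := by
    intro z hzl hzr n ε hε
    obtain ⟨k, hk, m, hkm⟩ := hT (n * α)
    obtain ⟨v, hv1, hv2⟩ : ∃ v : ℤ, 2 * M + 2 < ε * (z.im - (p.im + v)) ∧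
        ε * (z.im - (p.im + v)) ≤ 2 * M + 3 := by
      rcases hε with rfl | rfl
      · refine ⟨⌈z.im - p.im - (2 * M + 3)⌉, ?_, ?_⟩
        · linarith [Int.ceil_lt_add_one (z.im - p.im - (2 * M + 3))]
        · linarith [Int.le_ceil (z.im - p.im - (2 * M + 3))]
      · refine ⟨⌊z.im - p.im + (2 * M + 3)⌋, ?_, ?_⟩
        · linarith [Int.lt_floor_add_one (z.im - p.im + (2 * M + 3))]
        · linarith [Int.floor_le (z.im - p.im + (2 * M + 3))]
    have hps' := h.act_mem_closure_lSet 0 0 v hps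
    have hpt' := h.act_mem_closure_rSet 0 0 v hpt
    simp only [Int.cast_zero, zero_mul, add_zero] at hps' hpt'
    have hp' : act G 0 0 v p = p + lat 0 v := rfl
    by_contra hcon
    refine h.not_swap hl hps' hpt' hzl hzr hε hkm (hM' 0 (Finset.mem_insert_self _ _))
      (hM' k (Finset.mem_insert_of_mem hk)) ?_ ?_
    · rw [hp', Complex.add_im, lat_im]
      exact hv1
    · rw [hp', h.zpow_per, Complex.add_im, lat_im]
      simp only [vert] at hcon
      linarith
  refine ⟨4 * M + 5, fun z hzl hzr n => abs_le.2 ?_⟩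
  have h1 := key z hzl hzr n 1 (Or.inl rfl)
  have h2 := key z hzl hzr n (-1) (Or.inr rfl)
  constructor <;> linarith

end IsRotLift

/-- All orbits have, uniformly, the same asymptotic vertical speed. -/
def UniformVert (G : ℂ ≃ₜ ℂ) : Prop :=
  ∀ η : ℝ, 0 < η → ∃ a K : ℝ, ∀ (n : ℕ) (x : ℂ), |vert G n x - n * a| ≤ n * η + K

namespace IsRotLift

variable {G : ℂ ≃ₜ ℂ} {α C : ℝ}

theorem exists_abs_vert_le (h : IsRotLift G α C) (T : Finset ℤ) :
    ∃ B, ∀ k ∈ T, ∀ x, |vert G k x| ≤ B := by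
  choose D hD using h.zpow_bdd
  obtain ⟨B, hB⟩ := (T.image D).exists_le
  refine ⟨B, fun k hk x => ?_⟩
  have h1 := (Complex.abs_im_le_norm ((G ^ k) x - x)).trans (hD k x)
  rw [Complex.sub_im] at h1
  exact h1.trans (hB _ (Finset.mem_image_of_mem D hk))

theorem sum_vert (G : ℂ ≃ₜ ℂ) (n : ℕ) (x : ℂ) :
    ∑ i ∈ Finset.range n, vert G 1 ((G ^ (i : ℤ)) x) = vert G n x := by
  have h1 := Finset.sum_range_sub (fun i : ℕ => ((G ^ (i : ℤ)) x).im) n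
  rw [vert]
  convert h1 using 2 with i
  · rw [vert, ← zpow_add_apply]
    push_cast
    rw [add_comm]
  · rfl

theorem sum_vert_comm (G : ℂ ≃ₜ ℂ) (n T : ℕ) (x : ℂ) :
    ∑ i ∈ Finset.range n, vert G T ((G ^ (i : ℤ)) x) =
      ∑ j ∈ Finset.range T, vert G n ((G ^ (j : ℤ)) x) := by
  simp only [← sum_vert, ← zpow_add_apply]
  rw [Finset.sum_comm]
  simp only [add_comm]

open Classical in
theorem exists_abs_mul_vert_sub_le (h : IsRotLift G α C) (T : ℕ) {b K : ℝ} {r : ℕ} {O : Set ℂ}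
    (hO : ∀ x ∈ O, |vert G T x - b| ≤ K)
    (hr : ∀ x (n : ℕ), {i ∈ Finset.range n | (G ^ ((i : ℕ) : ℤ)) x ∉ O}.card ≤ r) :
    ∃ K', ∀ (n : ℕ) x, |T * vert G n x - n * b| ≤ n * K + K' := by
  obtain ⟨B, hB⟩ := h.exists_abs_vert_le ((Finset.range (T + 1)).image Nat.cast)
  have hB' : ∀ j : ℕ, j ≤ T → ∀ x, |vert G j x| ≤ B := fun j hj x =>
    hB _ (Finset.mem_image_of_mem _ (Finset.mem_range.2 (by lia))) x
  have hB0 : 0 ≤ B := (abs_nonneg _).trans (hB' 0 (Nat.zero_le _) 0)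
  set E : ℝ := B + |b| + |K| with hE
  have hE0 : 0 ≤ E := by positivity
  refine ⟨T * (2 * B) + r * E, fun n x => ?_⟩
  have h1 : ∑ j ∈ Finset.range T, vert G n ((G ^ (j : ℤ)) x) - T * vert G n x =
      ∑ j ∈ Finset.range T, (vert G j ((G ^ (n : ℤ)) x) - vert G j x) := by
    rw [Finset.sum_congr rfl fun (j : ℕ) _ => (vert_zpow_sub G n j x).symm]
    simp only [Finset.sum_sub_distrib, Finset.sum_const, Finset.card_range, nsmul_eq_mul]
  have h2 : |∑ j ∈ Finset.range T, (vert G j ((G ^ (n : ℤ)) x) - vert G j x)| ≤ T * (2 * B) := by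
    refine (Finset.abs_sum_le_sum_abs _ _).trans
      ((Finset.sum_le_card_nsmul _ _ (2 * B) fun j hj => ?_).trans_eq (by simp))
    have hj' := (Finset.mem_range.1 hj).le
    linarith [abs_sub (vert G j ((G ^ (n : ℤ)) x)) (vert G j x), hB' j hj' ((G ^ (n : ℤ)) x),
      hB' j hj' x]
  have h3 : ∑ i ∈ Finset.range n, vert G T ((G ^ (i : ℤ)) x) - n * b =
      ∑ i ∈ Finset.range n, (vert G T ((G ^ (i : ℤ)) x) - b) := by
    simp only [Finset.sum_sub_distrib, Finset.sum_const, Finset.card_range, nsmul_eq_mul]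
  have h4 : |∑ i ∈ Finset.range n, (vert G T ((G ^ (i : ℤ)) x) - b)| ≤ n * K + r * E := by
    have h5 : ∀ i ∈ Finset.range n, |vert G T ((G ^ (i : ℤ)) x) - b| ≤
        K + if (G ^ (i : ℤ)) x ∉ O then E else 0 := by
      intro i _
      split_ifs with hi
      · rw [add_zero]
        exact hO _ hi
      · have := abs_sub (vert G T ((G ^ (i : ℤ)) x)) b
        linarith [hB' T le_rfl ((G ^ (i : ℤ)) x), neg_abs_le K]
    refine (Finset.abs_sum_le_sum_abs _ _).trans ((Finset.sum_le_sum h5).trans ?_)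
    rw [Finset.sum_add_distrib, ← Finset.sum_filter]
    simp only [Finset.sum_const, Finset.card_range, nsmul_eq_mul]
    have := mul_le_mul_of_nonneg_right (Nat.cast_le (α := ℝ).2 (hr x n)) hE0
    linarith
  rw [sum_vert_comm] at h3
  rw [← h3] at h4
  rw [← h1] at h2
  rw [abs_le] at h2 h4 ⊢
  constructor <;> linarith

/-- If the vertical displacements are comparable along every orbit, up to finitely many times, then
all orbits have the same vertical speed. -/
theorem uniformVert_of_forall (h : IsRotLift G α C) {p : ℂ} {K : ℝ}
    (H : ∀ T : ℕ, ∃ r : ℕ, ∀ x (n : ℕ), open Classical in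
      {i ∈ Finset.range n | ¬ |vert G T ((G ^ ((i : ℕ) : ℤ)) x) - vert G T p| ≤ K}.card ≤ r) :
    UniformVert G := by
  classical
  intro η hη
  obtain ⟨T, hT⟩ := exists_nat_gt (max (K / η) 0)
  have hT0 : (0 : ℝ) < T := (le_max_right _ _).trans_lt hT
  have hTK : K ≤ T * η := ((div_lt_iff₀ hη).1 ((le_max_left _ _).trans_lt hT)).le
  obtain ⟨r, hr⟩ := H T
  obtain ⟨K', hK'⟩ := h.exists_abs_mul_vert_sub_le T
    (O := {x | |vert G T x - vert G T p| ≤ K}) (r := r) (fun x hx => hx) (fun x n => by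
      convert hr x n using 4; rfl)
  refine ⟨vert G T p / T, K' / T, fun n x => ?_⟩
  have h1 := hK' n x
  have h2 : T * vert G n x - n * vert G T p = T * (vert G n x - n * (vert G T p / T)) := by
    field_simp
  rw [h2, abs_mul, abs_of_pos hT0] at h1
  rw [← mul_le_mul_iff_right₀ hT0]
  refine h1.trans ?_
  rw [mul_add, mul_div_cancel₀ _ hT0.ne']
  have := mul_le_mul_of_nonneg_left hTK (Nat.cast_nonneg (α := ℝ) n)
  linarith

theorem exists_abs_vert_sub_le_of_hgt (h : IsRotLift G α C) {S : Set ℂ}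
    (hS : ∀ k m j x, x ∈ S → act G k m j x ∈ S) {r η : ℝ} (hη : 0 < η) {p : ℂ} {K : ℝ}
    (H : ∀ z ∈ S, |hgt G α z - r| < η → ∀ n : ℤ, |vert G n z - vert G n p| ≤ K) :
    ∃ K', ∀ x ∈ S, ∀ n : ℤ, |vert G n x - vert G n p| ≤ K' := by
  obtain ⟨T, hT⟩ := h.exists_finite_near hη
  obtain ⟨B, hB⟩ := h.exists_abs_vert_le T
  refine ⟨K + 2 * B, fun x hx n => ?_⟩
  obtain ⟨k, hk, m, hkm⟩ := hT (r - hgt G α x)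
  have h1 := H _ (hS k m 0 x hx) (by rw [h.hgt_act]; convert hkm using 2; ring) n
  rw [h.vert_act] at h1
  have h2 := vert_zpow_sub G n k x
  have h3 := hB k hk x
  have h4 := hB k hk ((G ^ n) x)
  rw [abs_le] at *
  constructor <;> linarith

end IsRotLift

namespace IsRotLift

variable {G : ℂ ≃ₜ ℂ} {α C : ℝ}

theorem exists_contact_near (h : IsRotLift G α C) {s t : ℝ} {p : ℂ}
    (hps : p ∈ closure (lSet G α s)) (hpt : p ∈ closure (rSet G α t)) (r : ℝ) {η : ℝ} (hη : 0 < η) :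
    ∃ s' t' p', |s' - r| < η ∧ t' - s' = t - s ∧ p' ∈ closure (lSet G α s') ∧
      p' ∈ closure (rSet G α t') := by
  obtain ⟨k, m, hkm⟩ := h.exists_near (r - s) hη
  exact ⟨_, _, _, by convert hkm using 2; ring, by ring, h.act_mem_closure_lSet k m 0 hps,
    h.act_mem_closure_rSet k m 0 hpt⟩

theorem exists_isBaseLine (h : IsRotLift G α C) {s t κ τ δ : ℝ} {c c' : ℂ} (hδ : 0 < δ)
    (hc : c ∈ lSet G α κ) (hc' : c' ∈ rSet G α τ)
    (hj : JoinedIn (lSet G α (t - δ) ∩ rSet G α (s + δ)) c c')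
    (h1 : s + δ ≤ κ) (h2 : κ + δ ≤ t) (h3 : s + δ ≤ τ) (h4 : τ + δ ≤ t) :
    ∃ (a b : ℂ) (γL : Path a c) (γM : Path c c') (γR : Path c' b),
      IsBaseLine G α C s t κ τ δ γL γM γR := by
  have hC := h.C_nonneg
  obtain ⟨γL, hL⟩ := exists_path_lSet (h.subset_lSet κ
    (show ((s - δ - C - 1 : ℝ) : ℂ).re < κ by rw [Complex.ofReal_re]; linarith)) hc
  obtain ⟨γR, hR⟩ := h.exists_path_rSet hc' (h.subset_rSet τ
    (show τ + C < ((t + δ + 2 * C + 1 : ℝ) : ℂ).re by rw [Complex.ofReal_re]; linarith))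
  obtain ⟨γM, hM⟩ := hj
  refine ⟨_, _, γL, γM, γR, hδ, hL, ?_, ?_, hR, h1, h2, h3, h4, ?_, ?_⟩
  · rintro _ ⟨r, rfl⟩
    exact (hM r).1
  · rintro _ ⟨r, rfl⟩
    exact (hM r).2
  · rw [Complex.ofReal_re]; linarith
  · rw [Complex.ofReal_re]; linarith

theorem notMem_lSet_of_lt_hgt (h : IsRotLift G α C) {x : ℂ} {r : ℝ} (hr : r < hgt G α x) :
    x ∉ lSet G α r := fun hx =>
  disjoint_left.1 (disjoint_lSet_rSet le_rfl) hx (h.mem_of_lt_hgt hr)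

theorem notMem_rSet_of_hgt_lt {x : ℂ} {r : ℝ} (hr : hgt G α x < r) : x ∉ rSet G α r :=
  fun hx => (le_hgt hx).not_gt hr

theorem joinedIn_iterate (h : IsRotLift G α C) {u ω : ℝ} {k m j : ℤ} {x : ℂ}
    (he : 0 ≤ k * α + m)
    (hx : JoinedIn (lSet G α (u + ω) ∩ rSet G α u) x (act G k m j x)) (i : ℕ) :
    JoinedIn (lSet G α (u + ω + i * (k * α + m)) ∩ rSet G α u) x
      (act G (i * k) (i * m) (i * j) x) := by
  induction i with
  | zero =>
    have h0 : act G ((0 : ℕ) * k) ((0 : ℕ) * m) ((0 : ℕ) * j) x = x := by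
      simpa using act_zero G x
    rw [h0]
    exact JoinedIn.refl (by simpa using hx.source_mem)
  | succ i ih =>
    set e : ℝ := k * α + m with hedef
    have hie : (0 : ℝ) ≤ i * e := by positivity
    have hie' : ((i * k : ℤ) : ℝ) * α + ((i * m : ℤ) : ℝ) = i * e := by
      rw [hedef]; push_cast; ring
    refine (ih.mono (inter_subset_inter_left _ (lSet_mono ?_))).trans ?_
    · push_cast; linarith
    · have h1 := JoinedIn.map hx (act G (i * k) (i * m) (i * j)).continuous
      rw [h.act_act] at h1
      have h2 : act G (i * k + k) (i * m + m) (i * j + j) x =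
          act G ((i + 1 : ℕ) * k) ((i + 1 : ℕ) * m) ((i + 1 : ℕ) * j) x := by
        push_cast; congr 2 <;> ring
      rw [h2] at h1
      refine h1.mono ?_
      rintro _ ⟨y, ⟨hy1, hy2⟩, rfl⟩
      constructor
      · refine lSet_mono ?_ ((h.act_mem_lSet (i * k) (i * m) (i * j) _).2 hy1)
        rw [hie']; push_cast; linarith
      · refine rSet_anti ?_ ((h.act_mem_rSet (i * k) (i * m) (i * j) _).2 hy2)
        rw [hie']; linarith

theorem uniformVert_of_abs_le (h : IsRotLift G α C) {p : ℂ} {K : ℝ}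
    (H : ∀ x, ∀ n : ℤ, |vert G n x - vert G n p| ≤ K) : UniformVert G :=
  h.uniformVert_of_forall (p := p) (K := K) fun T => ⟨0, fun x n => by
    classical
    simp [H]⟩

/-- The case where some narrow strip returns to itself. -/
theorem uniformVert_of_return_pos (h : IsRotLift G α C) {s t ω : ℝ} {p : ℂ} (hω : 0 < ω)
    (hst : t - s = 10 * ω)
    (hps : p ∈ closure (lSet G α s)) (hpt : p ∈ closure (rSet G α t)) {u : ℝ} {k m j : ℤ} {x : ℂ}
    (he : 0 < k * α + m)
    (hx : JoinedIn (lSet G α (u + ω) ∩ rSet G α u) x (act G k m j x)) : UniformVert G := by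
  set e : ℝ := k * α + m with hedef
  have heω : e < ω := by
    by_contra hlt
    have h1 := (h.act_mem_rSet k m j u).2 hx.source_mem.2
    exact disjoint_left.1 (disjoint_lSet_rSet (by linarith)) hx.target_mem.1 h1
  obtain ⟨s, t, p, hs, hst', hps, hpt⟩ := h.exists_contact_near hps hpt (u - 3 / 2 * ω) (half_pos hω)
  rw [hst] at hst'
  rw [abs_lt] at hs
  obtain ⟨i, hi⟩ : ∃ i : ℕ, i = ⌈3 * ω / e⌉₊ := ⟨_, rfl⟩
  have hi1 : 3 * ω ≤ i * e := by
    rw [← div_le_iff₀ he, hi]; exact Nat.le_ceil _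
  have hi2 : i * e < 3 * ω + e := by
    have := Nat.ceil_lt_add_one (show 0 ≤ 3 * ω / e by positivity)
    rw [← hi, ← sub_lt_iff_lt_add, lt_div_iff₀ he] at this
    linarith
  have hie' : ((i * k : ℤ) : ℝ) * α + ((i * m : ℤ) : ℝ) = i * e := by
    rw [hedef]; push_cast; ring
  have hr := (h.act_mem_rSet (i * k) (i * m) (i * j) u).2 hx.source_mem.2
  rw [hie'] at hr
  obtain ⟨a, b, γL, γM, γR, hl⟩ := h.exists_isBaseLine (s := s) (t := t) (half_pos hω)
    hx.source_mem.1 hr ((h.joinedIn_iterate he.le hx i).mono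
      (inter_subset_inter (lSet_mono (by linarith)) (rSet_anti (by linarith))))
    (by linarith) (by linarith) (by linarith) (by linarith)
  obtain ⟨K, hK⟩ := h.exists_abs_vert_sub_le hl hps hpt
  obtain ⟨K', hK'⟩ := h.exists_abs_vert_sub_le_of_hgt (S := univ) (fun _ _ _ _ _ => mem_univ _)
    (r := u + 2 * ω) (η := ω / 2) (half_pos hω) (p := p) (K := K) fun z _ hz n => by
      rw [abs_lt] at hz
      exact hK z (h.notMem_lSet_of_lt_hgt (by linarith)) (notMem_rSet_of_hgt_lt (by linarith)) n
  exact h.uniformVert_of_abs_le fun x n => hK' x (mem_univ x) n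

theorem uniformVert_of_return (h : IsRotLift G α C) {s t ω : ℝ} {p : ℂ} (hω : 0 < ω)
    (hst : t - s = 10 * ω)
    (hps : p ∈ closure (lSet G α s)) (hpt : p ∈ closure (rSet G α t)) {u : ℝ} {k m j : ℤ} {x : ℂ}
    (hk : k ≠ 0)
    (hx : JoinedIn (lSet G α (u + ω) ∩ rSet G α u) x (act G k m j x)) : UniformVert G := by
  have he : (k * α + m : ℝ) ≠ 0 := ((h.irr.intCast_mul hk).add_intCast m).ne_zero
  rcases he.lt_or_gt with he | he
  · refine h.uniformVert_of_return_pos hω hst hps hpt (k := -k) (m := -m) (j := -j)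
      (x := act G k m j x) (u := u) (by push_cast; linarith) ?_
    rw [h.act_act, neg_add_cancel, neg_add_cancel, neg_add_cancel, act_zero]
    exact hx.symm
  · exact h.uniformVert_of_return_pos hω hst hps hpt he hx

/-- The case where no narrow strip returns to itself. -/
theorem uniformVert_of_no_return (h : IsRotLift G α C) {s t ω : ℝ} {p : ℂ} (hω : 0 < ω)
    (hst : t - s = 10 * ω)
    (hps : p ∈ closure (lSet G α s)) (hpt : p ∈ closure (rSet G α t))
    (H : ∀ (u : ℝ) (k m j : ℤ) (x : ℂ), k ≠ 0 →
      ¬ JoinedIn (lSet G α (u + ω) ∩ rSet G α u) x (act G k m j x)) : UniformVert G := by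
  obtain ⟨s, t, p, hs, hst', hps, hpt⟩ := h.exists_contact_near hps hpt (- (3 / 2 * ω)) (half_pos hω)
  rw [hst] at hst'
  rw [abs_lt] at hs
  obtain ⟨q, hq1, hq2⟩ := h.nonempty_inter (u := 0) (v := ω / 4) (by positivity)
  obtain ⟨a, b, γL, γM, γR, hl⟩ := h.exists_isBaseLine (s := s) (t := t) (δ := ω / 8) (by positivity)
    hq1 hq2 (JoinedIn.refl ⟨lSet_mono (by linarith) hq1, rSet_anti (by linarith) hq2⟩)
    (by linarith) (by linarith) (by linarith) (by linarith)
  obtain ⟨K, hK⟩ := h.exists_abs_vert_sub_le hl hps hpt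
  set S : Set ℂ := {x | ∀ u, x ∉ lSet G α (u + ω) ∩ rSet G α u} with hSdef
  have hS : ∀ k m j x, x ∈ S → act G k m j x ∈ S := by
    rintro k m j x hx u ⟨h1, h2⟩
    refine hx (u - (k * α + m)) ⟨?_, ?_⟩
    · rw [← h.act_mem_lSet k m j]
      convert h1 using 2; ring
    · rw [← h.act_mem_rSet k m j]
      convert h2 using 2; ring
  obtain ⟨K', hK'⟩ := h.exists_abs_vert_sub_le_of_hgt hS
    (r := -(5 / 16 * ω)) (η := ω / 16) (by positivity) (p := p) (K := K) fun z hzS hz n => by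
      rw [abs_lt] at hz
      refine hK z (fun hzl => ?_) (notMem_rSet_of_hgt_lt (by linarith)) n
      exact hzS (-(3 / 8 * ω)) ⟨lSet_mono (by linarith) hzl, h.mem_of_lt_hgt (by linarith)⟩
  refine h.uniformVert_of_forall (p := p) (K := K' + 1) fun T => ?_
  set O : Set ℂ := {x | |vert G T x - vert G T p| < K' + 1} with hOdef
  have hO : IsOpen O := by
    refine isOpen_lt (Continuous.abs (Continuous.sub ?_ continuous_const)) continuous_const
    unfold vert
    fun_prop
  have hOper : ∀ x m j, x + lat m j ∈ O → x ∈ O := by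
    intro x m j hx
    have h1 := h.vert_act T 0 m j x
    rw [show act G 0 m j x = x + lat m j from rfl, zpow_zero] at h1
    rw [hOdef, mem_ofPred_eq, h1] at hx
    exact hx
  have hwand : ∀ x ∉ O, ∃ r > 0, ∃ u, ball x r ⊆ lSet G α (u + ω) ∩ rSet G α u := by
    intro x hx
    have hxS : x ∉ S := fun hxS => hx (lt_of_le_of_lt (hK' x hxS T) (lt_add_one _))
    rw [hSdef, mem_ofPred_eq] at hxS
    push Not at hxS
    obtain ⟨u, hu⟩ := hxS
    obtain ⟨r, hr, hb⟩ := Metric.isOpen_iff.1 ((isOpen_lSet G α _).inter (isOpen_rSet G α u)) x hu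
    exact ⟨r, hr, u, hb⟩
  choose! r hr u hu using hwand
  obtain ⟨F, hF, hcover⟩ := (isCompact_cell.inter_right hO.isClosed_compl).elim_nhds_subcover
    (fun x => ball x (r x)) fun x hx => ball_mem_nhds x (hr x hx.2)
  refine ⟨F.card, fun x n => ?_⟩
  classical
  have hex : ∀ i : ℕ, ¬ |vert G T ((G ^ (i : ℤ)) x) - vert G T p| ≤ K' + 1 →
      ∃ w ∈ F, ∃ m j, (G ^ (i : ℤ)) x + lat m j ∈ ball w (r w) := by
    intro i hi
    have hi' : (G ^ (i : ℤ)) x ∉ O := fun hiO => hi (le_of_lt hiO)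
    obtain ⟨m, j, y, hy, hycell⟩ := exists_lat_add ((G ^ (i : ℤ)) x)
    have hyO : y ∉ O := fun hyO => hi' (hOper _ (-m) (-j) (by
      rwa [hy, ← lat_neg, add_neg_cancel_right]))
    have := hcover ⟨hycell, hyO⟩
    simp only [mem_iUnion] at this
    obtain ⟨w, hw, hyw⟩ := this
    exact ⟨w, hw, -m, -j, by rwa [hy, ← lat_neg, add_neg_cancel_right]⟩
  choose! f hf using hex
  refine Finset.card_le_card_of_injOn f (fun i hi => ?_) fun i hi i' hi' hii => ?_
  · exact (hf i (Finset.mem_filter.1 hi).2).1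
  · by_contra hne
    obtain ⟨hw, m, j, hm⟩ := hf i (Finset.mem_filter.1 hi).2
    obtain ⟨-, m', j', hm'⟩ := hf i' (Finset.mem_filter.1 hi').2
    rw [← hii] at hm'
    obtain ⟨γ, hγ⟩ := (convex_ball (f i) (r (f i))).exists_path hm hm'
    have hsub := hu (f i) (hF _ hw).2
    refine H (u (f i)) (i' - i) (m' - m) (j' - j) ((G ^ (i : ℤ)) x + lat m j)
      (sub_ne_zero.2 (by exact_mod_cast Ne.symm hne)) ?_
    have h1 : act G (i' - i) (m' - m) (j' - j) ((G ^ (i : ℤ)) x + lat m j) =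
        (G ^ (i' : ℤ)) x + lat m' j' := by
      have := h.act_act (i' - i) (m' - m) (j' - j) i m j x
      rw [sub_add_cancel, sub_add_cancel, sub_add_cancel] at this
      exact this
    rw [h1]
    exact ⟨γ, fun r => hsub (hγ ⟨r, rfl⟩)⟩

/-- If the heights are not continuous, the vertical rotation set is a point. -/
theorem uniformVert_of_contact (h : IsRotLift G α C) {s t : ℝ} {p : ℂ} (hst : s < t)
    (hps : p ∈ closure (lSet G α s)) (hpt : p ∈ closure (rSet G α t)) : UniformVert G := by
  have hω : 0 < (t - s) / 10 := by linarith
  by_cases H : ∃ (u : ℝ) (k m j : ℤ) (x : ℂ), k ≠ 0 ∧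
      JoinedIn (lSet G α (u + (t - s) / 10) ∩ rSet G α u) x (act G k m j x)
  · obtain ⟨u, k, m, j, x, hk, hx⟩ := H
    exact h.uniformVert_of_return hω (by ring) hps hpt hk hx
  · push Not at H
    exact h.uniformVert_of_no_return hω (by ring) hps hpt H

end IsRotLift

/-- The conjugate of a plane homeomorphism by the identification of the plane with `ℂ`. -/
def complexConj (F : R2 ≃ₜ R2) : ℂ ≃ₜ ℂ :=
  (Complex.equivRealProdCLM.toHomeomorph.trans F).trans Complex.equivRealProdCLM.toHomeomorph.symm

theorem complexConj_re (F : R2 ≃ₜ R2) (x : ℂ) : (complexConj F x).re = (F (x.re, x.im)).1 := rfl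

theorem complexConj_im (F : R2 ≃ₜ R2) (x : ℂ) : (complexConj F x).im = (F (x.re, x.im)).2 := rfl

theorem iterate_eq_complexConj (F : R2 ≃ₜ R2) (n : ℕ) (x : ℂ) :
    (⇑F)^[n] (x.re, x.im) =
      (((complexConj F ^ (n : ℤ)) x).re, ((complexConj F ^ (n : ℤ)) x).im) := by
  induction n with
  | zero => rfl
  | succ n ih =>
    rw [Function.iterate_succ_apply', ih, Nat.cast_succ, add_comm, IsRotLift.zpow_add_apply,
      zpow_one]
    rfl

theorem isRotLift_complexConj {F : R2 ≃ₜ R2}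
    (hF : ∀ (x : R2) (v : ℤ × ℤ), F (x + ((v.1 : ℝ), (v.2 : ℝ))) = F x + ((v.1 : ℝ), (v.2 : ℝ)))
    {α M : ℝ} (hα : Irrational α)
    (hbd : ∀ (x : R2) (n : ℕ), |((⇑F)^[n] x - x).1 - (n : ℝ) * α| ≤ M) :
    IsRotLift (complexConj F) α M := by
  have hnat : ∀ (n : ℕ) (x : ℂ), |((complexConj F ^ (n : ℤ)) x).re - x.re - n * α| ≤ M := by
    intro n x
    have := hbd (x.re, x.im) n
    rwa [iterate_eq_complexConj] at this
  refine ⟨hα, fun x m n => ?_, fun k x => ?_⟩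
  · have h1 := hF (x.re, x.im) (m, n)
    apply Complex.ext
    · simpa [complexConj_re] using congrArg Prod.fst h1
    · simpa [complexConj_im] using congrArg Prod.snd h1
  · obtain ⟨n, rfl | rfl⟩ := k.eq_nat_or_neg
    · exact_mod_cast hnat n x
    · have h1 := hnat n ((complexConj F ^ (-n : ℤ)) x)
      rw [← IsRotLift.zpow_add_apply, add_neg_cancel, zpow_zero] at h1
      change |x.re - _ - _| ≤ M at h1
      rw [abs_sub_comm] at h1
      convert h1 using 2
      push_cast
      ring

theorem snd_eq_of_uniformVert {F : R2 ≃ₜ R2} (h : UniformVert (complexConj F)) {v w : R2}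
    (hv : v ∈ rotSet ⇑F) (hw : w ∈ rotSet ⇑F) : v.2 = w.2 := by
  refine eq_of_forall_dist_le fun η hη => ?_
  obtain ⟨a, K, hK⟩ := h (η / 2) (half_pos hη)
  have key : ∀ v ∈ rotSet ⇑F, |v.2 - a| ≤ η / 2 := by
    rintro v ⟨x, n, hn, hlim⟩
    have h1 : Tendsto (fun i => |((n i : ℝ)⁻¹ • ((⇑F)^[n i] (x i) - x i)).2 - a|) atTop
        (𝓝 |v.2 - a|) :=
      (((continuous_snd.tendsto v).comp hlim).sub_const a).abs
    have h2 : Tendsto (fun i => η / 2 + K * (n i : ℝ)⁻¹) atTop (𝓝 (η / 2 + K * 0)) :=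
      ((tendsto_inv_atTop_zero.comp
        (tendsto_natCast_atTop_atTop.comp hn.tendsto_atTop)).const_mul K).const_add _
    rw [mul_zero, add_zero] at h2
    refine le_of_tendsto_of_tendsto h1 h2 ?_
    filter_upwards [eventually_gt_atTop 0] with i hi
    have hni : (0 : ℝ) < n i := by
      exact_mod_cast (Nat.zero_le _).trans_lt (hn hi)
    have h3 := hK (n i) ⟨(x i).1, (x i).2⟩
    have h4 : vert (complexConj F) (n i) ⟨(x i).1, (x i).2⟩ = ((⇑F)^[n i] (x i) - x i).2 :=
      (congrArg (fun y : R2 => y.2 - (x i).2)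
        (iterate_eq_complexConj F (n i) ⟨(x i).1, (x i).2⟩)).symm
    rw [h4] at h3
    have h5 : ((n i : ℝ)⁻¹ • ((⇑F)^[n i] (x i) - x i)).2 - a =
        (n i : ℝ)⁻¹ * (((⇑F)^[n i] (x i) - x i).2 - n i * a) := by
      rw [Prod.smul_snd, smul_eq_mul]
      field_simp
    rw [h5, abs_mul, abs_of_pos (inv_pos.2 hni)]
    calc _ ≤ (n i : ℝ)⁻¹ * (n i * (η / 2) + K) := by gcongr
      _ = _ := by field_simp
  have h1 := abs_le.1 (key v hv)
  have h2 := abs_le.1 (key w hw)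
  rw [Real.dist_eq, abs_le]
  constructor <;> linarith

end RotationLift

/-- If `f` is a torus homeomorphism homotopic to the identity (encoded by its lift
`F`, a homeomorphism of the plane commuting with integer translations) with
rotation set ρ(F) = {α} × [ρ⁻, ρ⁺], ρ⁻ < ρ⁺, α irrational, and `f` has the
horizontal bounded deviation property, then some finite cover of `f` is an
extension of an irrational rotation: there are k ≥ 1, an irrational β, and a
continuous surjection H : ℝ² → ℝ with H(x + (k,0)) = H(x) + 1,
H(x + (0,1)) = H(x) and H(F(x)) = H(x) + β. -/
theorem bounded_horizontal_deviation_gives_extension_of_irrational_rotation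
    (F : R2 ≃ₜ R2)
    (hF : ∀ (x : R2) (v : ℤ × ℤ), F (x + ((v.1 : ℝ), (v.2 : ℝ))) = F x + ((v.1 : ℝ), (v.2 : ℝ)))
    (α ρm ρp : ℝ) (hα : Irrational α) (hρ : ρm < ρp)
    (hrot : rotSet ⇑F = {α} ×ˢ Icc ρm ρp)
    (hbd : ∃ M : ℝ, ∀ (x : R2) (n : ℕ), |((⇑F)^[n] x - x).1 - (n : ℝ) * α| ≤ M) :
    ∃ (k : ℕ), 1 ≤ k ∧ ∃ (β : ℝ), Irrational β ∧ ∃ H : R2 → ℝ,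
      Continuous H ∧ Function.Surjective H ∧
      (∀ x : R2, H (x + ((k : ℝ), 0)) = H x + 1) ∧
      (∀ x : R2, H (x + (0, 1)) = H x) ∧
      (∀ x : R2, H (F x) = H x + β) := by
  obtain ⟨M, hM⟩ := hbd
  have h := isRotLift_complexConj hF hα hM
  by_cases hcl : ∀ s t, s < t →
      closure (rSet (complexConj F) α t) ⊆ rSet (complexConj F) α s
  · have hc := h.continuous_hgt hcl
    have hact := fun k m n (x : R2) => h.hgt_act k m n (Complex.equivRealProdCLM.symm x)
    refine ⟨1, le_rfl, α, hα, fun x => hgt (complexConj F) α (Complex.equivRealProdCLM.symm x),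
      hc.comp Complex.equivRealProdCLM.symm.continuous,
      (h.surjective_hgt hc).comp Complex.equivRealProdCLM.symm.surjective,
      fun x => ?_, fun x => ?_, fun x => ?_⟩
    · have h1 := hact 0 1 0 x
      have h2 : act (complexConj F) 0 1 0 (Complex.equivRealProdCLM.symm x) =
          Complex.equivRealProdCLM.symm (x + (((1 : ℕ) : ℝ), 0)) := by
        rw [act_apply, map_add, zpow_zero]
        congr 1
        apply Complex.ext <;> simp
      rw [h2] at h1
      simpa using h1
    · have h1 := hact 0 0 1 x
      have h2 : act (complexConj F) 0 0 1 (Complex.equivRealProdCLM.symm x) =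
          Complex.equivRealProdCLM.symm (x + (0, 1)) := by
        rw [act_apply, map_add, zpow_zero]
        congr 1
        apply Complex.ext <;> simp
      rw [h2] at h1
      simpa using h1
    · have h1 := hact 1 0 0 x
      have h2 : act (complexConj F) 1 0 0 (Complex.equivRealProdCLM.symm x) =
          Complex.equivRealProdCLM.symm (F x) := by
        rw [act_apply, zpow_one, lat_zero, add_zero]
        rfl
      rw [h2] at h1
      simpa using h1
  · obtain ⟨s, t, p, hst, hps, hpt⟩ := h.exists_contact hcl
    have hu := h.uniformVert_of_contact hst hps hpt
    have h1 : ((α, ρm) : R2) ∈ rotSet ⇑F := by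
      rw [hrot]; exact ⟨rfl, le_rfl, hρ.le⟩
    have h2 : ((α, ρp) : R2) ∈ rotSet ⇑F := by
      rw [hrot]; exact ⟨rfl, hρ.le, le_rfl⟩
    exact absurd (snd_eq_of_uniformVert hu h1 h2) hρ.ne
end
end

section
/- Assume situation (S) holds for circloids C₁, C₂ and an annular continuum A in the annulus 𝔸. Then every connected component of C₁ ∩ C₂ is inessential and contained in A, and every connected component of C₁ ∩ A and every connected component of A ∩ C₂ is inessential. -/
open Filter Metric Set

noncomputable section

/-- The subgroup {0} × ℤ of ℝ², defining the annulus 𝔸 = ℝ²/({0}×ℤ). -/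
def annSub : AddSubgroup R2 := (⊥ : AddSubgroup ℝ).prod (AddSubgroup.zmultiples (1:ℝ))

/-- The annulus 𝔸 = ℝ²/∼ where (u,v)∼(r,s) iff u = r and v − s ∈ ℤ. -/
abbrev Ann := R2 ⧸ annSub

/-- The subgroup ℤ² of ℝ², defining the torus. -/
def torSub : AddSubgroup R2 :=
  (AddSubgroup.zmultiples (1:ℝ)).prod (AddSubgroup.zmultiples (1:ℝ))

/-- The torus 𝕋² = ℝ²/ℤ². -/
abbrev Torus := R2 ⧸ torSub

/-- Covering map π : ℝ² → 𝔸. -/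
def piA : R2 → Ann := QuotientAddGroup.mk' annSub

/-- Covering map π_{𝕋²} : ℝ² → 𝕋². -/
def piT : R2 → Torus := QuotientAddGroup.mk' torSub

/-- Covering map p : 𝔸 → 𝕋². -/
def pAT : Ann → Torus :=
  QuotientAddGroup.map annSub torSub (AddMonoidHom.id R2) (by
    intro x hx
    rw [AddSubgroup.mem_comap]
    rcases AddSubgroup.mem_prod.mp hx with ⟨h1, h2⟩
    refine AddSubgroup.mem_prod.mpr ⟨?_, h2⟩
    rw [AddSubgroup.mem_bot] at h1
    rw [AddMonoidHom.id_apply]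
    simpa [h1] using (AddSubgroup.zero_mem _))

/-- A subset of the annulus is bounded iff the first-coordinate projection of its
lift to ℝ² is bounded. -/
def BoundedA (U : Set Ann) : Prop := Bornology.IsBounded (Prod.fst '' (piA ⁻¹' U))

/-- An annular continuum in 𝔸: a continuum whose complement has exactly two
connected components, both unbounded. -/
def IsAnnularContinuum (A : Set Ann) : Prop :=
  IsCompact A ∧ IsConnected A ∧
  ∃ U V : Set Ann, U ≠ V ∧ ¬ BoundedA U ∧ ¬ BoundedA V ∧
    {C : Set Ann | ∃ x ∈ Aᶜ, C = connectedComponentIn Aᶜ x} = {U, V}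

/-- 𝒰⁺(A): the union of the complementary components of A whose lift has
first-coordinate projection unbounded above (for an annular continuum, a single
component). -/
def UplusSet (A : Set Ann) : Set Ann :=
  {y | y ∈ Aᶜ ∧ ¬ BddAbove (Prod.fst '' (piA ⁻¹' connectedComponentIn Aᶜ y))}

/-- 𝒰⁻(A): similarly with first-coordinate projection unbounded below. -/
def UminusSet (A : Set Ann) : Set Ann :=
  {y | y ∈ Aᶜ ∧ ¬ BddBelow (Prod.fst '' (piA ⁻¹' connectedComponentIn Aᶜ y))}

/-- A ≼ B iff B ⊆ cl(𝒰⁺(A)). -/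
def PrecA (A B : Set Ann) : Prop := B ⊆ closure (UplusSet A)

/-- A circloid: an annular continuum minimal with respect to inclusion among
annular continua. -/
def IsCircloid (C : Set Ann) : Prop :=
  IsAnnularContinuum C ∧ ∀ A : Set Ann, IsAnnularContinuum A → A ⊆ C → A = C

/-- Situation (S): C₁, C₂ circloids, A annular continuum, C₁ ∩ C₂ ≠ ∅,
C₁ ≼ A ≼ C₂, C₁ ⊄ A and C₂ ⊄ A. -/
def SituationS (C₁ C₂ A : Set Ann) : Prop :=
  IsCircloid C₁ ∧ IsCircloid C₂ ∧ IsAnnularContinuum A ∧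
  (C₁ ∩ C₂).Nonempty ∧ PrecA C₁ A ∧ PrecA A C₂ ∧ ¬ C₁ ⊆ A ∧ ¬ C₂ ⊆ A

/-- ℬ is the bunch generated by the circloids C₁, C₂ (appearing in situation (S)). -/
def IsBunch (B C₁ C₂ : Set Ann) : Prop :=
  (∃ A, SituationS C₁ C₂ A) ∧ B = closure (UplusSet C₁ ∩ UminusSet C₂)

/-- Vertical integer translate of a planar set. -/
def vtrans (m : ℤ) (X : Set R2) : Set R2 := (fun y => y + ((0:ℝ), (m:ℝ))) '' X

/-- A subset of the annulus is inessential if every connected component of its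
preimage under π is bounded. -/
def Inessential (S : Set Ann) : Prop :=
  ∀ x ∈ piA ⁻¹' S, Bornology.IsBounded (connectedComponentIn (piA ⁻¹' S) x)

namespace Ann

/-- The first coordinate on the annulus. -/
def height : Ann → ℝ :=
  QuotientAddGroup.lift annSub (AddMonoidHom.fst ℝ ℝ) (fun _ hx =>
    (AddSubgroup.mem_prod.mp hx).1)

/-- The second coordinate on the annulus, as an angle modulo one. -/
def angle : Ann → AddCircle (1 : ℝ) :=
  QuotientAddGroup.lift annSub
    ((QuotientAddGroup.mk' (AddSubgroup.zmultiples (1 : ℝ))).comp (AddMonoidHom.snd ℝ ℝ))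
    (fun x hx => (QuotientAddGroup.eq_zero_iff x.2).mpr (AddSubgroup.mem_prod.mp hx).2)

@[simp] theorem height_piA (w : R2) : height (piA w) = w.1 := rfl

@[simp] theorem angle_piA (w : R2) : angle (piA w) = (w.2 : AddCircle (1 : ℝ)) := rfl

theorem isQuotientMap_piA : Topology.IsQuotientMap piA :=
  QuotientAddGroup.isQuotientMap_mk annSub

theorem isOpenMap_piA : IsOpenMap piA := QuotientAddGroup.isOpenMap_coe

theorem continuous_piA : Continuous piA := isQuotientMap_piA.continuous

theorem surjective_piA : Function.Surjective piA := isQuotientMap_piA.surjective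

theorem continuous_height : Continuous height :=
  isQuotientMap_piA.continuous_iff.mpr continuous_fst

theorem continuous_angle : Continuous angle :=
  isQuotientMap_piA.continuous_iff.mpr ((AddCircle.continuous_mk' (1 : ℝ)).comp continuous_snd)

theorem piA_eq_of_coords {w w' : R2} (h₁ : w.1 = w'.1)
    (h₂ : (w.2 : AddCircle (1 : ℝ)) = w'.2) : piA w = piA w' := by
  refine QuotientAddGroup.eq.mpr (AddSubgroup.mem_prod.mpr ⟨?_, QuotientAddGroup.eq.mp h₂⟩)
  simp [h₁]

instance : T2Space Ann := by
  refine T2Space.of_injective_continuous (f := fun x => (height x, angle x)) ?_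
    (continuous_height.prodMk continuous_angle)
  intro x y h
  obtain ⟨w, rfl⟩ := surjective_piA x
  obtain ⟨w', rfl⟩ := surjective_piA y
  exact piA_eq_of_coords (Prod.ext_iff.mp h).1 (Prod.ext_iff.mp h).2

instance : LocallyPathConnectedSpace Ann := isQuotientMap_piA.locallyPathConnectedSpace

theorem image_fst_preimage_piA (S : Set Ann) : Prod.fst '' (piA ⁻¹' S) = height '' S := by
  ext t
  constructor
  · rintro ⟨w, hw, rfl⟩
    exact ⟨piA w, hw, rfl⟩
  · rintro ⟨x, hx, rfl⟩
    obtain ⟨w, rfl⟩ := surjective_piA x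
    exact ⟨w, hx, rfl⟩

theorem piA_add_one (w : R2) : piA (w.1, w.2 + 1) = piA w :=
  piA_eq_of_coords rfl (by simp)

theorem isConnected_height_preimage {I : Set ℝ} (hI : Convex ℝ I) (hne : I.Nonempty) :
    IsConnected (height ⁻¹' I) := by
  have h : height ⁻¹' I = piA '' (I ×ˢ univ) := by
    ext x
    obtain ⟨w, rfl⟩ := surjective_piA x
    constructor
    · exact fun hx => ⟨w, ⟨hx, trivial⟩, rfl⟩
    · rintro ⟨w', hw', h⟩
      rw [mem_preimage, ← h]
      exact hw'.1
  rw [h]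
  exact ((hI.prod convex_univ).isConnected (hne.prod univ_nonempty)).image _
    continuous_piA.continuousOn

theorem isCompact_height_preimage_Icc (a b : ℝ) : IsCompact (height ⁻¹' Icc a b) := by
  refine ((isCompact_Icc.prod isCompact_Icc).image continuous_piA
    (s := Icc a b ×ˢ Icc (0 : ℝ) 1)).of_isClosed_subset
    (isClosed_Icc.preimage continuous_height) ?_
  intro x hx
  obtain ⟨w, rfl⟩ := surjective_piA x
  refine ⟨(w.1, Int.fract w.2), ⟨hx, Int.fract_nonneg _, (Int.fract_lt_one _).le⟩, ?_⟩
  refine piA_eq_of_coords rfl ?_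
  simp only [Int.fract, AddCircle.coe_sub, sub_eq_self]
  exact (AddCircle.coe_eq_zero_iff 1).mpr ⟨⌊w.2⌋, by simp⟩

instance : ConnectedSpace Ann :=
  connectedSpace_iff_univ.mpr (by
    simpa using isConnected_height_preimage convex_univ univ_nonempty)

end Ann

theorem IsPreconnected.exists_int_of_coe_addCircle_eq_zero {X : Type*} [TopologicalSpace X]
    {S : Set X} (hS : IsPreconnected S) {f : X → ℝ} (hf : ContinuousOn f S)
    (h : ∀ x ∈ S, (f x : AddCircle (1 : ℝ)) = 0) : ∃ n : ℤ, ∀ x ∈ S, f x = n := by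
  obtain ⟨y, ⟨n, rfl⟩, hy⟩ := hS.eqOn_const_of_mapsTo (T := range ((↑) : ℤ → ℝ))
    ⟨Int.isClosedEmbedding_coe_real.isEmbedding.toHomeomorph.symm.isEmbedding.discreteTopology⟩ hf
    (fun x hx => by
      obtain ⟨n, hn⟩ := (AddCircle.coe_eq_zero_iff 1).mp (h x hx)
      exact ⟨n, by simpa using hn⟩) (range_nonempty _)
  exact ⟨n, hy⟩

theorem exists_lift_addCircle {f : R2 → AddCircle (1 : ℝ)} (hf : Continuous f) :
    ∃ F : R2 → ℝ, Continuous F ∧ ∀ w, (F w : AddCircle (1 : ℝ)) = f w := by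
  obtain ⟨t, ht⟩ := QuotientAddGroup.mk_surjective (f 0)
  obtain ⟨F, ⟨-, hF⟩, -⟩ := (AddCircle.isCoveringMap_coe (1 : ℝ)).existsUnique_continuousMap_lifts
    ⟨f, hf⟩ 0 t ht
  exact ⟨F, F.continuous, congrFun hF⟩

namespace Ann

/-- The angle function admits a continuous real-valued lift on `K`. -/
def HasAngleLift (K : Set Ann) : Prop :=
  ∃ g : Ann → ℝ, ContinuousOn g K ∧ ∀ x ∈ K, (g x : AddCircle (1 : ℝ)) = angle x

theorem HasAngleLift.mono {K L : Set Ann} (hL : HasAngleLift L) (h : K ⊆ L) : HasAngleLift K := by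
  obtain ⟨g, hg, hgL⟩ := hL
  exact ⟨g, hg.mono h, fun x hx => hgL x (h hx)⟩

theorem HasAngleLift.inessential {K : Set Ann} (hK : HasAngleLift K) (hc : IsCompact K) :
    Inessential K := by
  obtain ⟨g, hg, hgK⟩ := hK
  intro x hx
  set L := connectedComponentIn (piA ⁻¹' K) x
  have hLK : L ⊆ piA ⁻¹' K := connectedComponentIn_subset _ _
  obtain ⟨n, hn⟩ := (isPreconnected_connectedComponentIn (F := piA ⁻¹' K) (x := x)
    ).exists_int_of_coe_addCircle_eq_zero (f := fun w => w.2 - g (piA w))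
    (continuous_snd.continuousOn.sub (hg.comp continuous_piA.continuousOn hLK))
    (fun w hw => by rw [AddCircle.coe_sub, hgK _ (hLK hw), angle_piA, sub_self])
  have hb := (hc.image continuous_height).isBounded.prod
    ((hc.image_of_continuousOn hg).image (continuous_add_const (n : ℝ))).isBounded
  refine hb.subset fun w hw => ⟨⟨_, hLK hw, rfl⟩, _, ⟨_, hLK hw, rfl⟩, ?_⟩
  have := hn w hw
  simp only at this ⊢
  linarith

/-- A continuous function on a compact set extends to the annulus. -/
theorem exists_continuous_extension {K : Set Ann} (hK : IsClosed K) {g : Ann → ℝ}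
    (hg : ContinuousOn g K) : ∃ G : Ann → ℝ, Continuous G ∧ EqOn G g K := by
  obtain ⟨G, hG⟩ := ContinuousMap.exists_restrict_eq hK ⟨K.domRestrict g, hg.domRestrict⟩
  exact ⟨G, G.continuous, fun x hx => congrArg (fun f => f ⟨x, hx⟩) hG⟩

theorem HasAngleLift.exists_open {K : Set Ann} (hK : IsClosed K) (h : HasAngleLift K) :
    ∃ V, IsOpen V ∧ K ⊆ V ∧ HasAngleLift V := by
  obtain ⟨g, hg, hgK⟩ := h
  obtain ⟨G, hG, hGg⟩ := exists_continuous_extension hK hg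
  let c : Ann → AddCircle (1 : ℝ) := fun x => angle x - (G x : AddCircle (1 : ℝ))
  have hc : Continuous c :=
    continuous_angle.sub ((AddCircle.continuous_mk' (1 : ℝ)).comp hG)
  let a : ℝ := -1 / 2
  have hane : (0 : AddCircle (1 : ℝ)) ≠ (a : AddCircle (1 : ℝ)) := by
    intro h
    obtain ⟨n, hn⟩ := (AddCircle.coe_eq_zero_iff (1 : ℝ)).mp h.symm
    have h2 : (2 * n : ℝ) = (-1 : ℤ) := by
      simp only [a, zsmul_eq_mul, mul_one] at hn
      push_cast
      linarith
    have : 2 * n = -1 := by exact_mod_cast h2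
    omega
  refine ⟨{x | c x ≠ (a : AddCircle (1 : ℝ))}, isOpen_ne_fun hc continuous_const, ?_,
    fun x => G x + (AddCircle.equivIoc 1 a (c x) : ℝ), ?_, ?_⟩
  · intro x hx
    have : c x = 0 := by
      simp only [c]
      rw [hGg hx, hgK x hx, sub_self]
    rw [mem_ofPred_eq, this]
    exact hane
  · intro x hx
    exact (hG.continuousAt.add (continuous_subtype_val.continuousAt.comp
      ((AddCircle.continuousAt_equivIoc 1 a hx).comp hc.continuousAt))).continuousWithinAt
  · intro x _
    rw [AddCircle.coe_add, AddCircle.coe_equivIoc]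
    simp [c]

end Ann

namespace Ann

/-- Lifts of the angle on two disjoint closed sets glue to a lift on their union. -/
theorem HasAngleLift.union {K L : Set Ann} (hK : HasAngleLift K) (hL : HasAngleLift L)
    (hKc : IsClosed K) (hLc : IsClosed L) (hKL : Disjoint K L) : HasAngleLift (K ∪ L) := by
  classical
  obtain ⟨g, hg, hgK⟩ := hK
  obtain ⟨g', hg', hgL⟩ := hL
  have hEqL : EqOn (K.piecewise g g') g' L :=
    fun x hx => piecewise_eq_of_notMem _ _ _ (disjoint_right.mp hKL hx)
  refine ⟨K.piecewise g g', ?_, ?_⟩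
  · exact (hg.congr (piecewise_eqOn K g g')).union_of_isClosed (hg'.congr hEqL) hKc hLc
  · rintro x (hx | hx)
    · rw [piecewise_eq_of_mem _ _ _ hx, hgK x hx]
    · rw [hEqL hx, hgL x hx]

theorem exists_connected_subset_not_hasAngleLift {X : Set Ann} (hX : IsCompact X)
    (h : ¬ HasAngleLift X) : ∃ K ⊆ X, IsCompact K ∧ IsConnected K ∧ ¬ HasAngleLift K := by
  obtain ⟨M, hMX, hM⟩ := zorn_superset_nonempty {K : Set Ann | IsCompact K ∧ ¬ HasAngleLift K}
    (by
      intro c hc hchain hne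
      have := hne.to_subtype
      refine ⟨⋂ K : c, (K : Set Ann), ⟨?_, fun hl => ?_⟩,
        fun s hs => iInter_subset (fun K : c => (K : Set Ann)) ⟨s, hs⟩⟩
      · obtain ⟨s, hs⟩ := hne
        exact (hc hs).1.of_isClosed_subset (isClosed_iInter fun K => (hc K.2).1.isClosed)
          (iInter_subset (fun K : c => (K : Set Ann)) ⟨s, hs⟩)
      · obtain ⟨V, hV, hKV, hVl⟩ :=
          hl.exists_open (isClosed_iInter fun K => (hc K.2).1.isClosed)
        obtain ⟨K, hK⟩ := exists_subset_nhds_of_isCompact (V := fun K : c => (K : Set Ann))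
          (fun K L => (hchain.total K.2 L.2).elim (fun h => ⟨K, subset_rfl, h⟩)
            (fun h => ⟨L, h, subset_rfl⟩)) (fun K => (hc K.2).1)
          (fun x hx => hV.mem_nhds (hKV hx))
        exact (hc K.2).2 (hVl.mono hK)) X ⟨hX, h⟩
  obtain ⟨hMc, hMl⟩ := hM.prop
  refine ⟨M, hMX, hMc, ⟨?_, ?_⟩, hMl⟩
  · rw [nonempty_iff_ne_empty]
    rintro rfl
    exact hMl ⟨0, continuousOn_empty _, by simp⟩
  · rw [isPreconnected_closed_iff]
    intro t t' ht ht' hcov hne hne'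
    by_contra hempty
    have hlift : ∀ s s' : Set Ann, IsClosed s → M ∩ (s ∩ s') = ∅ → (M ∩ s').Nonempty →
        HasAngleLift (M ∩ s) := by
      rintro s s' hs hss' ⟨x, hxM, hxs'⟩
      by_contra hl
      have hx := hM.le_of_le ⟨hMc.inter_right hs, hl⟩ inter_subset_left hxM
      exact (eq_empty_iff_forall_notMem.mp hss') x ⟨hxM, hx.2, hxs'⟩
    rw [not_nonempty_iff_eq_empty] at hempty
    have hu := (hlift t t' ht hempty hne').union
      (hlift t' t ht' (by rwa [inter_comm t' t]) hne)
      (hMc.isClosed.inter ht) (hMc.isClosed.inter ht') (by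
        rw [Set.disjoint_left]
        exact fun x hx hx' => (eq_empty_iff_forall_notMem.mp hempty) x ⟨hx.1, hx.2, hx'.2⟩)
    rw [← inter_union_distrib_left, inter_eq_left.mpr hcov] at hu
    exact hMl hu

/-- An open set containing the lower end but not the upper end has a frontier on which the angle
does not lift. -/
theorem not_hasAngleLift_of_frontier_subset {X U : Set Ann} (hX : IsClosed X)
    (hfr : frontier U ⊆ X) {R : ℝ} (hlow : ∀ x, height x < -R → x ∈ U)
    (hhigh : ∀ x, R < height x → x ∉ U) : ¬ HasAngleLift X := by
  classical
  rintro ⟨g, hg, hgX⟩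
  obtain ⟨G, hG, hGg⟩ := exists_continuous_extension hX hg
  let f : Ann → AddCircle (1 : ℝ) := fun x => if x ∈ U then (G x : AddCircle (1 : ℝ)) else angle x
  have hf : Continuous f := by
    refine Continuous.if (fun x hx => ?_) ((AddCircle.continuous_mk' (1 : ℝ)).comp hG)
      continuous_angle
    have hx' : x ∈ X := hfr hx
    change (G x : AddCircle (1 : ℝ)) = angle x
    rw [hGg hx', hgX x hx']
  obtain ⟨F, hF, hFf⟩ := exists_lift_addCircle (hf.comp continuous_piA)
  have hFl : ∀ w : R2, w.1 < -R → (F w : AddCircle (1 : ℝ)) = G (piA w) := fun w hw => by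
    rw [hFf]
    exact if_pos (hlow (piA w) hw)
  have hFh : ∀ w : R2, R < w.1 → (F w : AddCircle (1 : ℝ)) = w.2 := fun w hw => by
    rw [hFf]
    exact if_neg (hhigh (piA w) hw)
  have hconn : ∀ I : Set ℝ, Convex ℝ I → IsPreconnected (I ×ˢ (univ : Set ℝ)) :=
    fun I hI => (hI.prod convex_univ).isPreconnected
  obtain ⟨a, ha⟩ := (hconn (Iio (-R)) (convex_Iio _)).exists_int_of_coe_addCircle_eq_zero
    (f := fun w => F w - G (piA w)) (hF.sub (hG.comp continuous_piA)).continuousOn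
    (fun w hw => by rw [AddCircle.coe_sub, hFl w hw.1, sub_self])
  obtain ⟨b, hb⟩ := (hconn (Ioi R) (convex_Ioi _)).exists_int_of_coe_addCircle_eq_zero
    (f := fun w => F w - w.2) (hF.sub continuous_snd).continuousOn
    (fun w hw => by rw [AddCircle.coe_sub, hFh w hw.1, sub_self])
  obtain ⟨n, hn⟩ := (hconn univ convex_univ).exists_int_of_coe_addCircle_eq_zero
    (f := fun w => F (w.1, w.2 + 1) - F w)
    ((hF.comp (by fun_prop)).sub hF).continuousOn
    (fun w _ => by
      rw [AddCircle.coe_sub, hFf, hFf, Function.comp, Function.comp, piA_add_one, sub_self])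
  have e₁ := ha (-R - 1, 0) ⟨by simp, trivial⟩
  have e₂ := ha (-R - 1, 0 + 1) ⟨by simp, trivial⟩
  have e₃ := hn (-R - 1, 0) ⟨trivial, trivial⟩
  have e₄ := hb (R + 1, 0) ⟨by simp, trivial⟩
  have e₅ := hb (R + 1, 0 + 1) ⟨by simp, trivial⟩
  have e₆ := hn (R + 1, 0) ⟨trivial, trivial⟩
  have e₇ := congrArg G (piA_add_one (-R - 1, 0))
  simp only at e₁ e₂ e₃ e₄ e₅ e₆ e₇
  linarith

/-- The holomorphic coordinate identifying the annulus with the punctured plane. -/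
def toComplex : Ann → ℂ := fun x => Real.exp (2 * Real.pi * height x) * (angle x).toCircle

theorem toComplex_piA (w : R2) :
    toComplex (piA w) = Complex.exp (2 * Real.pi * (w.1 + w.2 * Complex.I)) := by
  rw [toComplex, angle_piA, AddCircle.toCircle_apply_mk, Circle.coe_exp, height_piA,
    Complex.ofReal_exp, ← Complex.exp_add]
  congr 1
  push_cast
  ring

theorem continuous_toComplex : Continuous toComplex := by
  have := continuous_height
  have := AddCircle.continuous_toCircle.comp continuous_angle
  unfold toComplex
  fun_prop

theorem norm_toComplex (x : Ann) : ‖toComplex x‖ = Real.exp (2 * Real.pi * height x) := by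
  rw [toComplex, norm_mul, Circle.norm_coe, mul_one, Complex.norm_real, Real.norm_eq_abs,
    Real.abs_exp]

theorem coe_im_div_eq_angle {x : Ann} {l : ℂ} (h : Complex.exp l = toComplex x) :
    ((l.im / (2 * Real.pi) : ℝ) : AddCircle (1 : ℝ)) = angle x := by
  obtain ⟨w, rfl⟩ := surjective_piA x
  rw [toComplex_piA, Complex.exp_eq_exp_iff_exists_int] at h
  obtain ⟨n, rfl⟩ := h
  rw [angle_piA, ← sub_eq_zero, ← AddCircle.coe_sub, AddCircle.coe_eq_zero_iff]
  refine ⟨n, ?_⟩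
  have := Real.pi_pos
  simp
  field_simp
  ring

theorem injective_toComplex : Function.Injective toComplex := by
  intro x y h
  obtain ⟨w, rfl⟩ := surjective_piA x
  obtain ⟨w', rfl⟩ := surjective_piA y
  have hn := congrArg norm h
  rw [norm_toComplex, norm_toComplex, Real.exp_eq_exp] at hn
  refine piA_eq_of_coords (mul_left_cancel₀ (by positivity) hn) ?_
  rw [toComplex_piA] at h
  rw [← angle_piA w', ← coe_im_div_eq_angle h]
  congr 1
  simp

/-- The function `toComplex - p` has a continuous logarithm on `K`. -/
def HasLog (K : Set Ann) (p : ℂ) : Prop :=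
  ∃ l : Ann → ℂ, ContinuousOn l K ∧ ∀ x ∈ K, Complex.exp (l x) = toComplex x - p

theorem HasLog.hasAngleLift {K : Set Ann} (h : HasLog K 0) : HasAngleLift K := by
  obtain ⟨l, hl, hlK⟩ := h
  exact ⟨fun x => (l x).im / (2 * Real.pi),
    (Complex.continuous_im.comp_continuousOn hl).div_const _,
    fun x hx => coe_im_div_eq_angle (by rw [hlK x hx, sub_zero])⟩

theorem HasLog.of_dist_lt {K : Set Ann} {p q : ℂ} (h : HasLog K p)
    (hpq : ∀ x ∈ K, dist p q < dist (toComplex x) p) : HasLog K q := by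
  obtain ⟨l, hl, hlK⟩ := h
  have hlt : ∀ x ∈ K, ‖(p - q) / (toComplex x - p)‖ < 1 := fun x hx => by
    have hx' := hpq x hx
    rw [dist_eq_norm, dist_eq_norm] at hx'
    rw [norm_div, div_lt_one ((norm_nonneg _).trans_lt hx')]
    exact hx'
  have hne : ∀ x ∈ K, toComplex x - p ≠ 0 := fun x hx => by
    rw [sub_ne_zero, ← dist_pos]
    exact dist_nonneg.trans_lt (hpq x hx)
  refine ⟨fun x => l x + Complex.log (1 + (p - q) / (toComplex x - p)), hl.add ?_, ?_⟩
  · refine ContinuousOn.clog (continuousOn_const.add (continuousOn_const.div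
      (continuous_toComplex.continuousOn.sub continuousOn_const) hne)) fun x hx => ?_
    exact Complex.mem_slitPlane_of_norm_lt_one (hlt x hx)
  · intro x hx
    rw [Complex.exp_add, hlK x hx, Complex.exp_log
      (Complex.slitPlane_ne_zero (Complex.mem_slitPlane_of_norm_lt_one (hlt x hx)))]
    field_simp [hne x hx]
    ring

theorem hasLog_of_norm_lt {K : Set Ann} {p : ℂ} (hp : ∀ x ∈ K, ‖toComplex x‖ < ‖p‖) :
    HasLog K p := by
  rcases K.eq_empty_or_nonempty with rfl | ⟨y, hy⟩
  · exact ⟨0, continuousOn_empty _, by simp⟩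
  have hp0 : p ≠ 0 := norm_pos_iff.mp ((norm_nonneg _).trans_lt (hp y hy))
  have hs : ∀ x ∈ K, 1 + -(toComplex x / p) ∈ Complex.slitPlane := fun x hx => by
    refine Complex.mem_slitPlane_of_norm_lt_one ?_
    rw [norm_neg, norm_div, div_lt_one (norm_pos_iff.mpr hp0)]
    exact hp x hx
  refine ⟨fun x => Complex.log (-p) + Complex.log (1 + -(toComplex x / p)),
    continuousOn_const.add (ContinuousOn.clog
      (continuousOn_const.add (continuous_toComplex.continuousOn.div_const p).neg) hs), ?_⟩
  intro x hx
  rw [Complex.exp_add, Complex.exp_log (neg_ne_zero.mpr hp0),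
    Complex.exp_log (Complex.slitPlane_ne_zero (hs x hx))]
  field_simp
  ring

theorem eventually_hasLog_iff {K : Set Ann} (hK : IsCompact K) {p : ℂ} (hp : p ∉ toComplex '' K) :
    ∀ᶠ q in nhds p, HasLog K p ↔ HasLog K q := by
  obtain ⟨δ, hδ, hball⟩ := Metric.isOpen_iff.mp
    (hK.image continuous_toComplex).isClosed.isOpen_compl p hp
  have hd : ∀ x ∈ K, δ ≤ dist (toComplex x) p := fun x hx => by
    by_contra! hlt
    exact hball (mem_ball.mpr hlt) ⟨x, hx, rfl⟩
  filter_upwards [ball_mem_nhds p (half_pos hδ)] with q hq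
  rw [mem_ball, dist_comm] at hq
  refine ⟨fun h => h.of_dist_lt fun x hx => ?_, fun h => h.of_dist_lt fun x hx => ?_⟩
  · linarith [hd x hx]
  · have := dist_triangle (toComplex x) q p
    rw [dist_comm q p] at this ⊢
    linarith [hd x hx]

/-- If a preconnected set disjoint from the compact set `K` joins the two ends of the annulus, then
the angle lifts on `K`. -/
theorem hasAngleLift_of_joined_ends {K S : Set Ann} (hK : IsCompact K) (hS : IsPreconnected S)
    (hKS : Disjoint S K) (ha : ¬ BddAbove (height '' S)) (hb : ¬ BddBelow (height '' S)) :
    HasAngleLift K := by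
  obtain ⟨M, hM⟩ := (hK.image continuous_height).isBounded.subset_closedBall 0
  have hM' : ∀ x ∈ K, |height x| ≤ M := fun x hx => by
    simpa using hM ⟨x, hx, rfl⟩
  have hnot : ∀ p ∈ toComplex '' S, p ∉ toComplex '' K := by
    rintro _ ⟨x, hx, rfl⟩ ⟨y, hy, hxy⟩
    exact Set.disjoint_left.mp hKS hx (injective_toComplex hxy ▸ hy)
  obtain ⟨_, ⟨s, hs, rfl⟩, hsM⟩ := not_bddAbove_iff.mp ha M
  obtain ⟨_, ⟨t, ht, rfl⟩, htM⟩ := not_bddBelow_iff.mp hb (-M - 1)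
  have hπ := Real.pi_gt_three
  have h₁ : HasLog K (toComplex s) := hasLog_of_norm_lt fun x hx => by
    rw [norm_toComplex, norm_toComplex, Real.exp_lt_exp]
    have := (abs_le.mp (hM' x hx)).2
    nlinarith
  have h₂ : HasLog K (toComplex s) ↔ HasLog K (toComplex t) :=
    (hS.image _ continuous_toComplex.continuousOn).induction₂
      (fun p q => HasLog K p ↔ HasLog K q)
      (fun p hp => (eventually_hasLog_iff hK (hnot p hp)).filter_mono nhdsWithin_le_nhds)
      (fun _ _ _ _ _ _ h h' => h.trans h') (fun _ _ _ _ h => h.symm) ⟨s, hs, rfl⟩ ⟨t, ht, rfl⟩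
  refine (HasLog.of_dist_lt (h₂.mp h₁) fun x hx => ?_).hasAngleLift
  have hx' := (abs_le.mp (hM' x hx)).1
  have h₃ : 2 * ‖toComplex t‖ < ‖toComplex x‖ := by
    rw [norm_toComplex, norm_toComplex]
    have h₄ : Real.exp 1 * Real.exp (2 * Real.pi * height t) < Real.exp (2 * Real.pi * height x) := by
      rw [← Real.exp_add, Real.exp_lt_exp]
      nlinarith
    have := Real.add_one_le_exp (1 : ℝ)
    nlinarith [Real.exp_pos (2 * Real.pi * height t)]
  have h₅ := norm_sub_norm_le (toComplex x) (toComplex t)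
  rw [dist_zero_right, dist_eq_norm]
  linarith

end Ann

theorem IsClosed.frontier_connectedComponentIn_compl_subset {X : Type*} [TopologicalSpace X]
    [LocallyConnectedSpace X] {K : Set X} (hK : IsClosed K) (x : X) :
    frontier (connectedComponentIn Kᶜ x) ⊆ K := by
  intro z hz
  by_contra hzK
  obtain ⟨y, hyz, hyx⟩ := mem_closure_iff.mp hz.1 _
    (hK.isOpen_compl.connectedComponentIn (x := z)) (mem_connectedComponentIn hzK)
  refine hz.2 ?_
  rw [(hK.isOpen_compl.connectedComponentIn).interior_eq, connectedComponentIn_eq hyx,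
    ← connectedComponentIn_eq hyz]
  exact mem_connectedComponentIn hzK

/-- If a property of connected components of `F` holds exactly for those meeting the connected set
`S`, then the union of the components with this property is the component containing `S`. -/
theorem IsConnected.exists_setOf_component_eq {X : Type*} [TopologicalSpace X] {F S : Set X}
    (hS : IsConnected S) (hSF : S ⊆ F) {P : Set X → Prop} (hP : ∀ L, S ⊆ L → P L)
    (hPS : ∀ L, P L → (L ∩ S).Nonempty) :
    ∃ p ∈ F, {y | y ∈ F ∧ P (connectedComponentIn F y)} = connectedComponentIn F p ∧
      S ⊆ connectedComponentIn F p := by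
  obtain ⟨p, hp⟩ := hS.nonempty
  have hSp := hS.isPreconnected.subset_connectedComponentIn hp hSF
  refine ⟨p, hSF hp, ?_, hSp⟩
  ext y
  constructor
  · rintro ⟨hy, hPy⟩
    obtain ⟨z, hzy, hzS⟩ := hPS _ hPy
    rw [connectedComponentIn_eq (hSp hzS), ← connectedComponentIn_eq hzy]
    exact mem_connectedComponentIn hy
  · intro hy
    refine ⟨connectedComponentIn_subset _ _ hy, ?_⟩
    rw [← connectedComponentIn_eq hy]
    exact hP _ hSp

namespace Ann

theorem exists_uplusSet_eq {K : Set Ann} (hK : IsCompact K) :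
    ∃ p ∈ Kᶜ, UplusSet K = connectedComponentIn Kᶜ p ∧
      ∃ R, ∀ x, R < height x → x ∈ UplusSet K := by
  obtain ⟨R, hR⟩ := (hK.image continuous_height).bddAbove
  obtain ⟨p, hp, h, hS⟩ := (isConnected_height_preimage (convex_Ioi R) ⟨R + 1, by simp⟩
    ).exists_setOf_component_eq (F := Kᶜ)
    (P := fun L => ¬ BddAbove (Prod.fst '' (piA ⁻¹' L)))
    (fun x hx hxK => (hR ⟨x, hxK, rfl⟩).not_gt hx)
    (fun L hL => by
      rw [not_bddAbove_iff]
      intro t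
      refine ⟨max R t + 1, ⟨(max R t + 1, 0), hL ?_, rfl⟩, by
        linarith [le_max_right R t]⟩
      change R < max R t + 1
      linarith [le_max_left R t])
    (fun L hL => by
      obtain ⟨_, ⟨w, hw, rfl⟩, hwR⟩ := not_bddAbove_iff.mp hL R
      exact ⟨piA w, hw, hwR⟩)
  exact ⟨p, hp, h, R, fun x hx => h.symm.subset (hS hx)⟩

theorem exists_uminusSet_eq {K : Set Ann} (hK : IsCompact K) :
    ∃ p ∈ Kᶜ, UminusSet K = connectedComponentIn Kᶜ p ∧
      ∃ R, ∀ x, height x < R → x ∈ UminusSet K := by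
  obtain ⟨R, hR⟩ := (hK.image continuous_height).bddBelow
  obtain ⟨p, hp, h, hS⟩ := (isConnected_height_preimage (convex_Iio R) ⟨R - 1, by simp⟩
    ).exists_setOf_component_eq (F := Kᶜ)
    (P := fun L => ¬ BddBelow (Prod.fst '' (piA ⁻¹' L)))
    (fun x hx hxK => (hR ⟨x, hxK, rfl⟩).not_gt hx)
    (fun L hL => by
      rw [not_bddBelow_iff]
      intro t
      refine ⟨min R t - 1, ⟨(min R t - 1, 0), hL ?_, rfl⟩, by
        linarith [min_le_right R t]⟩
      change min R t - 1 < R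
      linarith [min_le_left R t])
    (fun L hL => by
      obtain ⟨_, ⟨w, hw, rfl⟩, hwR⟩ := not_bddBelow_iff.mp hL R
      exact ⟨piA w, hw, hwR⟩)
  exact ⟨p, hp, h, R, fun x hx => h.symm.subset (hS hx)⟩

section Compact

variable {K : Set Ann} (hK : IsCompact K)
include hK

theorem isOpen_uplusSet : IsOpen (UplusSet K) := by
  obtain ⟨p, -, h, -⟩ := exists_uplusSet_eq hK
  exact h ▸ hK.isClosed.isOpen_compl.connectedComponentIn

theorem isOpen_uminusSet : IsOpen (UminusSet K) := by
  obtain ⟨p, -, h, -⟩ := exists_uminusSet_eq hK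
  exact h ▸ hK.isClosed.isOpen_compl.connectedComponentIn

theorem isConnected_uplusSet : IsConnected (UplusSet K) := by
  obtain ⟨p, hp, h, -⟩ := exists_uplusSet_eq hK
  exact h ▸ isConnected_connectedComponentIn_iff.mpr hp

theorem isConnected_uminusSet : IsConnected (UminusSet K) := by
  obtain ⟨p, hp, h, -⟩ := exists_uminusSet_eq hK
  exact h ▸ isConnected_connectedComponentIn_iff.mpr hp

theorem not_bddAbove_uplusSet : ¬ BddAbove (height '' UplusSet K) := by
  obtain ⟨p, hp, h, R, hR⟩ := exists_uplusSet_eq hK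
  rw [not_bddAbove_iff]
  intro t
  refine ⟨max R t + 1, ⟨piA (max R t + 1, 0), hR _ ?_, rfl⟩, ?_⟩
  · rw [height_piA]
    linarith [le_max_left R t]
  · linarith [le_max_right R t]

theorem not_bddBelow_uminusSet : ¬ BddBelow (height '' UminusSet K) := by
  obtain ⟨p, hp, h, R, hR⟩ := exists_uminusSet_eq hK
  rw [not_bddBelow_iff]
  intro t
  refine ⟨min R t - 1, ⟨piA (min R t - 1, 0), hR _ ?_, rfl⟩, ?_⟩
  · rw [height_piA]
    linarith [min_le_left R t]
  · linarith [min_le_right R t]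

theorem connectedComponentIn_compl_eq_uplusSet {x : Ann} (hx : x ∈ UplusSet K) :
    connectedComponentIn Kᶜ x = UplusSet K := by
  obtain ⟨p, -, h, -⟩ := exists_uplusSet_eq hK
  rw [h] at hx ⊢
  exact (connectedComponentIn_eq hx).symm

theorem connectedComponentIn_compl_eq_uminusSet {x : Ann} (hx : x ∈ UminusSet K) :
    connectedComponentIn Kᶜ x = UminusSet K := by
  obtain ⟨p, -, h, -⟩ := exists_uminusSet_eq hK
  rw [h] at hx ⊢
  exact (connectedComponentIn_eq hx).symm

theorem subset_uplusSet {W : Set Ann} (hW : IsPreconnected W) (hWK : Disjoint W K)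
    (hb : ¬ BddAbove (height '' W)) : W ⊆ UplusSet K := by
  obtain ⟨p, -, h, R, hR⟩ := exists_uplusSet_eq hK
  obtain ⟨_, ⟨x, hx, rfl⟩, hxR⟩ := not_bddAbove_iff.mp hb R
  rw [← connectedComponentIn_compl_eq_uplusSet hK (hR x hxR)]
  exact hW.subset_connectedComponentIn hx (disjoint_left.mp hWK)

theorem subset_uminusSet {W : Set Ann} (hW : IsPreconnected W) (hWK : Disjoint W K)
    (hb : ¬ BddBelow (height '' W)) : W ⊆ UminusSet K := by
  obtain ⟨p, -, h, R, hR⟩ := exists_uminusSet_eq hK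
  obtain ⟨_, ⟨x, hx, rfl⟩, hxR⟩ := not_bddBelow_iff.mp hb R
  rw [← connectedComponentIn_compl_eq_uminusSet hK (hR x hxR)]
  exact hW.subset_connectedComponentIn hx (disjoint_left.mp hWK)

theorem disjoint_uplusSet_uminusSet (hne : UplusSet K ≠ UminusSet K) :
    Disjoint (UplusSet K) (UminusSet K) :=
  disjoint_left.mpr fun _ hx hx' => hne
    ((connectedComponentIn_compl_eq_uplusSet hK hx).symm.trans
      (connectedComponentIn_compl_eq_uminusSet hK hx'))

end Compact

theorem isAnnularContinuum_ends {A : Set Ann} (hA : IsAnnularContinuum A) :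
    Disjoint (UplusSet A) (UminusSet A) ∧ UplusSet A ∪ UminusSet A = Aᶜ := by
  obtain ⟨hc, -, U, V, hUV, hU, hV, hcomp⟩ := hA
  have key : ∀ W ∈ ({U, V} : Set (Set Ann)), ¬ BoundedA W → W = UplusSet A ∨ W = UminusSet A := by
    intro W hW hb
    rw [← hcomp] at hW
    obtain ⟨x, hx, rfl⟩ := hW
    rw [BoundedA, isBounded_iff_bddBelow_bddAbove, not_and_or] at hb
    rcases hb with hb | hb
    · exact .inr (connectedComponentIn_compl_eq_uminusSet hc ⟨hx, hb⟩)
    · exact .inl (connectedComponentIn_compl_eq_uplusSet hc ⟨hx, hb⟩)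
  have hU' := key U (by simp) hU
  have hV' := key V (by simp) hV
  have hmem : ∀ x ∈ Aᶜ, x ∈ U ∨ x ∈ V := by
    intro x hx
    have hx' : connectedComponentIn Aᶜ x ∈ ({U, V} : Set (Set Ann)) := hcomp ▸ ⟨x, hx, rfl⟩
    rcases hx' with h | h
    · exact .inl (h ▸ mem_connectedComponentIn hx)
    · exact .inr (h ▸ mem_connectedComponentIn hx)
  refine ⟨disjoint_uplusSet_uminusSet hc ?_, Subset.antisymm
    (union_subset (fun _ h => h.1) (fun _ h => h.1)) fun x hx => ?_⟩
  · intro h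
    rw [← h, or_self] at hU' hV'
    exact hUV (hU'.trans hV'.symm)
  · rcases hmem x hx with h | h
    · exact hU'.imp (·.subset h) (·.subset h)
    · exact hV'.imp (·.subset h) (·.subset h)

/-- A continuum on which the angle does not lift becomes an annular continuum after filling its
bounded complementary components. -/
theorem isAnnularContinuum_fill {K : Set Ann} (hK : IsCompact K) (hconn : IsConnected K)
    (hl : ¬ HasAngleLift K) : IsAnnularContinuum (UplusSet K ∪ UminusSet K)ᶜ := by
  have hop := isOpen_uplusSet hK
  have hom := isOpen_uminusSet hK
  have hcp := isConnected_uplusSet hK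
  have hcm := isConnected_uminusSet hK
  have hne : UplusSet K ≠ UminusSet K := fun h => hl <|
    hasAngleLift_of_joined_ends hK hcp.isPreconnected (disjoint_left.mpr fun _ hx => hx.1)
      (not_bddAbove_uplusSet hK) (h ▸ not_bddBelow_uminusSet hK)
  have hdisj := disjoint_uplusSet_uminusSet hK hne
  have hKF : K ⊆ (UplusSet K ∪ UminusSet K)ᶜ :=
    fun x hx h => h.elim (fun h => h.1 hx) (fun h => h.1 hx)
  have hFc : IsClosed (UplusSet K ∪ UminusSet K)ᶜ := (hop.union hom).isClosed_compl
  refine ⟨?_, ⟨hconn.nonempty.mono hKF, ?_⟩, UplusSet K, UminusSet K, hne, ?_, ?_, ?_⟩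
  · obtain ⟨-, -, -, R, hR⟩ := exists_uplusSet_eq hK
    obtain ⟨-, -, -, R', hR'⟩ := exists_uminusSet_eq hK
    refine (isCompact_height_preimage_Icc R' R).of_isClosed_subset hFc fun x hx => ⟨?_, ?_⟩
    · exact le_of_not_gt fun h => hx (.inr (hR' x h))
    · exact le_of_not_gt fun h => hx (.inl (hR x h))
  · obtain ⟨k, hk⟩ := hconn.nonempty
    refine isPreconnected_of_forall k fun y hy => ?_
    by_cases hyK : y ∈ K
    · exact ⟨K, hKF, hk, hyK, hconn.isPreconnected⟩
    set C := connectedComponentIn Kᶜ y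
    have hyC : y ∈ C := mem_connectedComponentIn hyK
    have hCF : C ⊆ (UplusSet K ∪ UminusSet K)ᶜ := by
      rintro x hx (h | h)
      · have := connectedComponentIn_compl_eq_uplusSet hK h
        rw [← connectedComponentIn_eq hx] at this
        exact hy (.inl (this ▸ hyC))
      · have := connectedComponentIn_compl_eq_uminusSet hK h
        rw [← connectedComponentIn_eq hx] at this
        exact hy (.inr (this ▸ hyC))
    have hCu : C ≠ univ := fun h =>
      connectedComponentIn_subset Kᶜ y (show k ∈ C from h ▸ mem_univ k) hk
    obtain ⟨z, hz⟩ := nonempty_frontier_iff.mpr ⟨⟨y, hyC⟩, hCu⟩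
    exact ⟨closure C ∪ K, union_subset (closure_minimal hCF hFc) hKF, .inr hk,
      .inl (subset_closure hyC), isPreconnected_connectedComponentIn.closure.union z hz.1
        (hK.isClosed.frontier_connectedComponentIn_compl_subset y hz) hconn.isPreconnected⟩
  · rw [BoundedA, image_fst_preimage_piA]
    exact fun h => not_bddAbove_uplusSet hK h.bddAbove
  · rw [BoundedA, image_fst_preimage_piA]
    exact fun h => not_bddBelow_uminusSet hK h.bddBelow
  · rw [compl_compl]
    have hp : ∀ x ∈ UplusSet K, connectedComponentIn (UplusSet K ∪ UminusSet K) x = UplusSet K :=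
      fun x hx => Subset.antisymm
        (IsPreconnected.subset_left_of_subset_union hop hom hdisj (connectedComponentIn_subset _ _)
          ⟨x, mem_connectedComponentIn (.inl hx), hx⟩ isPreconnected_connectedComponentIn)
        (hcp.isPreconnected.subset_connectedComponentIn hx subset_union_left)
    have hm : ∀ x ∈ UminusSet K, connectedComponentIn (UplusSet K ∪ UminusSet K) x = UminusSet K :=
      fun x hx => Subset.antisymm
        (IsPreconnected.subset_right_of_subset_union hop hom hdisj
          (connectedComponentIn_subset _ _)
          ⟨x, mem_connectedComponentIn (.inr hx), hx⟩ isPreconnected_connectedComponentIn)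
        (hcm.isPreconnected.subset_connectedComponentIn hx subset_union_right)
    ext C
    constructor
    · rintro ⟨x, hx | hx, rfl⟩
      · exact .inl (hp x hx)
      · exact .inr (hm x hx)
    · rintro (rfl | rfl)
      · obtain ⟨x, hx⟩ := hcp.nonempty
        exact ⟨x, .inl hx, (hp x hx).symm⟩
      · obtain ⟨x, hx⟩ := hcm.nonempty
        exact ⟨x, .inr hx, (hm x hx).symm⟩

theorem fill_subset_of_subset {K A : Set Ann} (hK : IsCompact K) (hA : IsAnnularContinuum A)
    (hKA : K ⊆ A) : (UplusSet K ∪ UminusSet K)ᶜ ⊆ A := by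
  rw [compl_subset_comm, ← (isAnnularContinuum_ends hA).2]
  have hd : ∀ x ∈ Aᶜ, x ∉ K := fun x hx hxK => hx (hKA hxK)
  exact union_subset_union
    (subset_uplusSet hK (isConnected_uplusSet hA.1).isPreconnected
      (disjoint_left.mpr fun x hx => hd x hx.1) (not_bddAbove_uplusSet hA.1))
    (subset_uminusSet hK (isConnected_uminusSet hA.1).isPreconnected
      (disjoint_left.mpr fun x hx => hd x hx.1) (not_bddBelow_uminusSet hA.1))

theorem fill_eq_of_isCircloid {K C : Set Ann} (hC : IsCircloid C) (hK : IsCompact K)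
    (hconn : IsConnected K) (hl : ¬ HasAngleLift K) (hKC : K ⊆ C) :
    (UplusSet K ∪ UminusSet K)ᶜ = C :=
  hC.2 _ (isAnnularContinuum_fill hK hconn hl) (fill_subset_of_subset hK hC.1 hKC)

theorem hasAngleLift_of_subset_inter {K C A : Set Ann} (hC : IsCircloid C)
    (hA : IsAnnularContinuum A) (hCA : ¬ C ⊆ A) (hK : IsCompact K) (hconn : IsConnected K)
    (hKCA : K ⊆ C ∩ A) : HasAngleLift K := by
  by_contra hl
  rw [← fill_eq_of_isCircloid hC hK hconn hl (hKCA.trans inter_subset_left)] at hCA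
  exact hCA (fill_subset_of_subset hK hA (hKCA.trans inter_subset_right))

theorem isCompact_connectedComponentIn {X : Set Ann} (hX : IsCompact X) (x : Ann) :
    IsCompact (connectedComponentIn X x) := by
  by_cases hx : x ∈ X
  · rw [connectedComponentIn_eq_image hx]
    have := isCompact_iff_compactSpace.mp hX
    exact isClosed_connectedComponent.isCompact.image continuous_subtype_val
  · rw [connectedComponentIn_eq_empty hx]
    exact isCompact_empty

theorem inessential_component_of_subset_inter {C A X : Set Ann} (hC : IsCircloid C)
    (hA : IsAnnularContinuum A) (hCA : ¬ C ⊆ A) (hX : IsCompact X) (hXCA : X ⊆ C ∩ A) {x : Ann}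
    (hx : x ∈ X) : Inessential (connectedComponentIn X x) :=
  have hc := isCompact_connectedComponentIn hX x
  (hasAngleLift_of_subset_inter hC hA hCA hc (isConnected_connectedComponentIn_iff.mpr hx)
    ((connectedComponentIn_subset X x).trans hXCA)).inessential hc

theorem disjoint_uplusSet_of_precA {C A : Set Ann} (hC : IsCircloid C)
    (hA : IsAnnularContinuum A) (hCA : PrecA C A) : Disjoint C (UplusSet A) := by
  have hCc := hC.1.1
  obtain ⟨hCd, hCu⟩ := isAnnularContinuum_ends hC.1
  obtain ⟨hAd, -⟩ := isAnnularContinuum_ends hA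
  have hCm : UminusSet C ⊆ UminusSet A := by
    refine subset_uminusSet hA.1 (isConnected_uminusSet hCc).isPreconnected ?_
      (not_bddBelow_uminusSet hCc)
    exact (hCd.symm.closure_right (isOpen_uminusSet hCc)).mono_right hCA
  have hfr : frontier (UminusSet C) ⊆ C \ UplusSet A := by
    intro x hx
    refine ⟨?_, fun hxA => ?_⟩
    · obtain ⟨p, -, h, -⟩ := exists_uminusSet_eq hCc
      rw [h] at hx
      exact hCc.isClosed.frontier_connectedComponentIn_compl_subset p hx
    · exact disjoint_left.mp ((hAd.mono_right hCm).closure_right (isOpen_uplusSet hA.1)) hxA hx.1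
  have hXc : IsCompact (C \ UplusSet A) := hCc.diff (isOpen_uplusSet hA.1)
  obtain ⟨-, -, -, R, hR⟩ := exists_uplusSet_eq hCc
  obtain ⟨-, -, -, R', hR'⟩ := exists_uminusSet_eq hCc
  have hl : ¬ HasAngleLift (C \ UplusSet A) := by
    refine not_hasAngleLift_of_frontier_subset hXc.isClosed hfr (R := max R (-R'))
      (fun x hx => hR' x ?_) (fun x hx => disjoint_left.mp hCd (hR x ?_))
    · linarith [le_max_right R (-R')]
    · linarith [le_max_left R (-R')]
  obtain ⟨K, hKX, hK, hconn, hKl⟩ := exists_connected_subset_not_hasAngleLift hXc hl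
  rw [← fill_eq_of_isCircloid hC hK hconn hKl (hKX.trans sdiff_subset)]
  refine disjoint_compl_left.mono_right (subset_union_of_subset_left (subset_uplusSet hK
    (isConnected_uplusSet hA.1).isPreconnected ?_ (not_bddAbove_uplusSet hA.1)) _)
  exact disjoint_sdiff_right.mono_right hKX

end Ann

/-- In situation (S), every connected component of C₁ ∩ C₂ is inessential and
contained in A, and every connected component of C₁ ∩ A and of A ∩ C₂ is
inessential. -/
theorem situationS_components_inessential_and_contained
    (C₁ C₂ A : Set Ann) (hS : SituationS C₁ C₂ A) :
    (∀ x ∈ C₁ ∩ C₂, Inessential (connectedComponentIn (C₁ ∩ C₂) x) ∧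
      connectedComponentIn (C₁ ∩ C₂) x ⊆ A) ∧
    (∀ x ∈ C₁ ∩ A, Inessential (connectedComponentIn (C₁ ∩ A) x)) ∧
    (∀ x ∈ A ∩ C₂, Inessential (connectedComponentIn (A ∩ C₂) x)) := by
  obtain ⟨hC₁, hC₂, hA, -, h₁, h₂, hC₁A, hC₂A⟩ := hS
  obtain ⟨hAd, hAu⟩ := Ann.isAnnularContinuum_ends hA
  have hd := Ann.disjoint_uplusSet_of_precA hC₁ hA h₁
  have hsub : C₁ ∩ C₂ ⊆ A := by
    rintro x ⟨hx₁, hx₂⟩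
    by_contra hxA
    rcases hAu.symm.subset hxA with hx | hx
    · exact disjoint_left.mp hd hx₁ hx
    · exact disjoint_left.mp (hAd.symm.closure_right (Ann.isOpen_uminusSet hA.1)) hx (h₂ hx₂)
  refine ⟨fun x hx => ⟨?_, (connectedComponentIn_subset _ _).trans hsub⟩, fun x hx => ?_,
    fun x hx => ?_⟩
  · exact Ann.inessential_component_of_subset_inter hC₁ hA hC₁A
      (hC₁.1.1.inter hC₂.1.1) (subset_inter inter_subset_left hsub) hx
  · exact Ann.inessential_component_of_subset_inter hC₁ hA hC₁A
      (hC₁.1.1.inter hA.1) subset_rfl hx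
  · exact Ann.inessential_component_of_subset_inter hC₂ hA hC₂A
      (hA.1.inter hC₂.1.1) (inter_comm A C₂).subset hx
end
end

section
/- Let f be a homeomorphism of 𝕋² = ℝ²/ℤ² homotopic to the identity with lift F : ℝ² → ℝ², and let U ⊂ 𝕋² be a set such that U ∪ f(U) ∪ … ∪ f^{j₀}(U) = 𝕋² for some j₀ ∈ ℕ. Suppose some point z ∈ ℝ² has a well-defined rotation vector w, i.e. lim_n (Fⁿ(z) − z)/n = w. Then there exists a point z′ ∈ ℝ² with π_{𝕋²}(z′) ∈ U and lim_n (Fⁿ(z′) − z′)/n = w. -/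
open Filter Metric Set

noncomputable section

/-- A point has rotation vector `w` under `g` as soon as its image does. -/
theorem tendsto_rotation_of_tendsto_rotation_image {E : Type*} [AddCommGroup E] [Module ℝ E]
    [TopologicalSpace E] [ContinuousAdd E] [ContinuousSMul ℝ E] (g : E → E) {x w : E}
    (h : Tendsto (fun n : ℕ => (n : ℝ)⁻¹ • (g^[n] (g x) - g x)) atTop (nhds w)) :
    Tendsto (fun n : ℕ => (n : ℝ)⁻¹ • (g^[n] x - x)) atTop (nhds w) := by
  rw [← tendsto_add_atTop_iff_nat 1]
  have hfac : Tendsto (fun n : ℕ => (n : ℝ) / (n + 1)) atTop (nhds 1) :=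
    tendsto_natCast_div_add_atTop 1
  have hinv : Tendsto (fun n : ℕ => 1 / ((n : ℝ) + 1)) atTop (nhds 0) :=
    tendsto_one_div_add_atTop_nhds_zero_nat
  have hsum := (hfac.smul h).add (hinv.smul_const (g x - x))
  rw [one_smul, zero_smul, add_zero] at hsum
  refine hsum.congr fun n => ?_
  have hn : (n : ℝ) + 1 ≠ 0 := by positivity
  rw [Function.iterate_succ_apply, smul_smul, one_div, Nat.cast_add_one]
  rcases Nat.eq_zero_or_pos n with rfl | hpos
  · simp
  · have hn' : (n : ℝ) ≠ 0 := by positivity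
    rw [show (n : ℝ) / (n + 1) * (n : ℝ)⁻¹ = ((n : ℝ) + 1)⁻¹ by field_simp, ← smul_add,
      sub_add_sub_cancel]

/-- A point has rotation vector `w` under `g` as soon as one of its iterates does. -/
theorem tendsto_rotation_of_tendsto_rotation_iterate {E : Type*} [AddCommGroup E] [Module ℝ E]
    [TopologicalSpace E] [ContinuousAdd E] [ContinuousSMul ℝ E] (g : E → E) (j : ℕ) {x w : E}
    (h : Tendsto (fun n : ℕ => (n : ℝ)⁻¹ • (g^[n] (g^[j] x) - g^[j] x)) atTop (nhds w)) :
    Tendsto (fun n : ℕ => (n : ℝ)⁻¹ • (g^[n] x - x)) atTop (nhds w) := by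
  induction j generalizing x with
  | zero => exact h
  | succ j ih => exact tendsto_rotation_of_tendsto_rotation_image g (ih h)

/-- If f is a torus homeomorphism homotopic to the identity with lift F, and
U ∪ f(U) ∪ … ∪ f^{j₀}(U) = 𝕋², then for any point z ∈ ℝ² with rotation vector
w there is a point z′ with π_{𝕋²}(z′) ∈ U having the same rotation vector w. -/
theorem rotation_vector_realized_over_finitely_covering_set
    (F : R2 ≃ₜ R2) (f : Torus ≃ₜ Torus)
    (hF : ∀ (x : R2) (v : ℤ × ℤ), F (x + ((v.1 : ℝ), (v.2 : ℝ))) = F x + ((v.1 : ℝ), (v.2 : ℝ)))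
    (hlift : ∀ x : R2, piT (F x) = f (piT x))
    (U : Set Torus) (j₀ : ℕ)
    (hcover : (⋃ j ∈ Finset.range (j₀ + 1), (⇑f)^[j] '' U) = Set.univ)
    (z w : R2)
    (hz : Tendsto (fun n : ℕ => ((n : ℝ))⁻¹ • ((⇑F)^[n] z - z)) atTop (nhds w)) :
    ∃ z' : R2, piT z' ∈ U ∧
      Tendsto (fun n : ℕ => ((n : ℝ))⁻¹ • ((⇑F)^[n] z' - z')) atTop (nhds w) := by
  have hmem : piT z ∈ ⋃ j ∈ Finset.range (j₀ + 1), (⇑f)^[j] '' U := hcover ▸ mem_univ _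
  simp only [mem_iUnion] at hmem
  obtain ⟨j, -, u, hu, huz⟩ := hmem
  obtain ⟨z', rfl⟩ := F.surjective.iterate j z
  refine ⟨z', ?_, tendsto_rotation_of_tendsto_rotation_iterate F j hz⟩
  have hsemi : Function.Semiconj piT F f := hlift
  rw [(hsemi.iterate_right j).eq z'] at huz
  exact f.injective.iterate j huz ▸ hu
end
end

section
/- Let A ⊂ 𝔸 be an annular continuum in the annulus and let Ã = π⁻¹(A) be its lift to ℝ². Then for every point z ∈ Ã and every M > 0 there exists a continuum Z with z ∈ Z ⊂ Ã and diam(pr₂(Z)) > M. -/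
open Filter Metric Set

noncomputable section

/-- On a preconnected set, a continuous real function with integer values is constant. -/
theorem IsPreconnected.eq_of_coe_addCircle_eq_zero {α : Type*} [TopologicalSpace α] {S : Set α}
    (hS : IsPreconnected S) {f : α → ℝ} (hf : ContinuousOn f S)
    (hint : ∀ x ∈ S, (f x : AddCircle (1 : ℝ)) = 0) {x y : α} (hx : x ∈ S) (hy : y ∈ S) :
    f x = f y := by
  refine hS.constant_of_mapsTo (T := range ((↑) : ℤ → ℝ)) ?_ hf ?_ hx hy
  · rw [isDiscrete_iff_discreteTopology]
    exact Int.isClosedEmbedding_coe_real.isEmbedding.toHomeomorph.symm.isEmbedding.discreteTopology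
  · intro w hw
    simpa using (AddCircle.coe_eq_zero_iff (1 : ℝ)).1 (hint w hw)

/-- The frontier of one of two disjoint open sets lies in the complement of their union. -/
theorem frontier_subset_compl_union {α : Type*} [TopologicalSpace α] {D E : Set α}
    (hD : IsOpen D) (hE : IsOpen E) (hDE : Disjoint D E) : frontier D ⊆ (D ∪ E)ᶜ := by
  intro x hx
  rw [hD.frontier_eq] at hx
  rintro (h | h)
  · exact hx.2 h
  · exact (hDE.closure_left hE).le_bot ⟨hx.1, h⟩

theorem continuousOn_indicator_of_frontier {α : Type*} [TopologicalSpace α] {D S : Set α}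
    {f : α → ℝ} (hf : Continuous f) (h : ∀ x ∈ S ∩ frontier D, f x = 0) :
    ContinuousOn (D.indicator f) S := by
  classical
  rw [← piecewise_eq_indicator]
  exact ContinuousOn.piecewise h hf.continuousOn continuousOn_const

/-- A Janiszewski-type statement: if the common complement of two disjoint open sets, containing
opposite ends of the plane, splits into two closed parts, then these parts cannot both
miss a horizontal line. -/
theorem not_separated_of_horizontal_lines {D E X Y : Set R2} (hD : IsOpen D) (hE : IsOpen E)
    (hDE : Disjoint D E) (hX : IsClosed X) (hY : IsClosed Y) (hXY : Disjoint X Y)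
    (hcov : X ∪ Y = (D ∪ E)ᶜ) {R a b : ℝ}
    (hDR : ∀ w : R2, R < w.1 → w ∈ D) (hER : ∀ w : R2, w.1 < -R → w ∈ E)
    (ha : ∀ w ∈ Y, w.2 ≠ a) (hb : ∀ w ∈ X, w.2 ≠ b) : False := by
  obtain ⟨l, hl0, hl1, -⟩ := exists_continuous_zero_one_of_isClosed hX hY hXY
  have hfr : frontier D ⊆ X ∪ Y := hcov ▸ frontier_subset_compl_union hD hE hDE
  have hg : Continuous (D.indicator fun w => (l w : AddCircle (1 : ℝ))) := by
    classical
    rw [← piecewise_eq_indicator]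
    refine Continuous.piecewise ?_ (AddCircle.continuous_mk' 1 |>.comp l.continuous)
      continuous_const
    intro w hw
    rcases hfr hw with h | h
    · simp [hl0 h]
    · simp [hl1 h]
  obtain ⟨e₀, he₀⟩ := QuotientAddGroup.mk_surjective
    (D.indicator (fun w => (l w : AddCircle (1 : ℝ))) (0 : R2))
  obtain ⟨G, ⟨-, hG⟩, -⟩ := (AddCircle.isCoveringMap_coe (1 : ℝ)).existsUnique_continuousMap_lifts
    ⟨_, hg⟩ (0 : R2) e₀ he₀
  have hG' : ∀ w, (G w : AddCircle (1 : ℝ)) = D.indicator (fun w => (l w : AddCircle (1 : ℝ))) w :=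
    fun w => congrFun hG w
  have h1 : ContinuousOn (fun w => G w - D.indicator l w) Yᶜ := by
    refine G.continuous.continuousOn.sub (continuousOn_indicator_of_frontier l.continuous ?_)
    rintro w ⟨hw, hw'⟩
    exact hl0 ((hfr hw').resolve_right hw)
  have h2 : ContinuousOn (fun w => G w - D.indicator (fun w => l w - 1) w) Xᶜ := by
    refine G.continuous.continuousOn.sub
      (continuousOn_indicator_of_frontier (l.continuous.sub continuous_const) ?_)
    rintro w ⟨hw, hw'⟩
    simp [hl1 ((hfr hw').resolve_left hw)]
  have i1 : ∀ w, ((G w - D.indicator l w : ℝ) : AddCircle (1 : ℝ)) = 0 := by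
    intro w
    rw [AddCircle.coe_sub, hG']
    by_cases hw : w ∈ D <;> simp [hw]
  have i2 : ∀ w, ((G w - D.indicator (fun w => l w - 1) w : ℝ) : AddCircle (1 : ℝ)) = 0 := by
    intro w
    rw [AddCircle.coe_sub, hG']
    by_cases hw : w ∈ D <;> simp [hw]
  have hor : ∀ c : ℝ, IsPreconnected ((univ : Set ℝ) ×ˢ ({c} : Set ℝ)) := fun c =>
    isPreconnected_univ.prod isPreconnected_singleton
  have ver : ∀ c : ℝ, IsPreconnected (({c} : Set ℝ) ×ˢ (univ : Set ℝ)) := fun c =>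
    isPreconnected_singleton.prod isPreconnected_univ
  have k1 := (hor a).eq_of_coe_addCircle_eq_zero
    (h1.mono fun w hw h => ha w h hw.2) (fun w _ => i1 w) (x := (R + 1, a)) (y := (-R - 1, a))
    (by simp) (by simp)
  have k2 := (hor b).eq_of_coe_addCircle_eq_zero
    (h2.mono fun w hw h => hb w h hw.2) (fun w _ => i2 w) (x := (R + 1, b)) (y := (-R - 1, b))
    (by simp) (by simp)
  have dD : ∀ t, ((R + 1, t) : R2) ∈ D := fun t => hDR _ (by simp)
  have dE : ∀ t, ((-R - 1, t) : R2) ∈ E := fun t => hER _ (by simp)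
  have dE' : ∀ t, ((-R - 1, t) : R2) ∉ D := fun t h => hDE.le_bot ⟨h, dE t⟩
  have hYc : D ∪ E ⊆ Yᶜ := fun w hw h => hcov.subset (Or.inr h) hw
  have k3 := (ver (R + 1)).eq_of_coe_addCircle_eq_zero
    (h1.mono fun w hw => hYc (Or.inl (hDR w (by simp [show w.1 = R + 1 from hw.1]))))
    (fun w _ => i1 w) (x := (R + 1, a)) (y := (R + 1, b)) (by simp) (by simp)
  have k4 := (ver (-R - 1)).eq_of_coe_addCircle_eq_zero
    (h1.mono fun w hw => hYc (Or.inr (hER w (by simp [show w.1 = -R - 1 from hw.1]))))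
    (fun w _ => i1 w) (x := (-R - 1, a)) (y := (-R - 1, b)) (by simp) (by simp)
  simp only [indicator_of_mem (dD _), indicator_of_notMem (dE' _)] at k1 k2 k3 k4
  linarith

/-- If the connected component of `x` in a compact set avoids a closed set `B`, then `x` has a
compact relatively clopen neighbourhood avoiding `B`. -/
theorem IsCompact.exists_clopen_part {α : Type*} [TopologicalSpace α] [T2Space α] {K B : Set α}
    (hK : IsCompact K) (hB : IsClosed B) {x : α} (hx : x ∈ K)
    (h : Disjoint (connectedComponentIn K x) B) :
    ∃ P ⊆ K, IsCompact P ∧ IsCompact (K \ P) ∧ x ∈ P ∧ Disjoint P B := by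
  have := isCompact_iff_compactSpace.1 hK
  have hsub : ⋂ s : {s : Set K // IsClopen s ∧ ⟨x, hx⟩ ∈ s}, (s : Set K) ⊆
      ((↑) : K → α) ⁻¹' Bᶜ := by
    rw [← connectedComponent_eq_iInter_isClopen]
    intro w hw hwB
    refine h.le_bot ⟨?_, hwB⟩
    rw [connectedComponentIn_eq_image hx]
    exact mem_image_of_mem _ hw
  have : Nonempty {s : Set K // IsClopen s ∧ ⟨x, hx⟩ ∈ s} := ⟨⟨univ, isClopen_univ, trivial⟩⟩
  obtain ⟨⟨Q, hQ, hxQ⟩, hQB⟩ := exists_subset_nhds_of_isCompact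
    (V := fun s : {s : Set K // IsClopen s ∧ ⟨x, hx⟩ ∈ s} => (s : Set K))
    (fun s t => ⟨⟨s ∩ t, s.2.1.inter t.2.1, s.2.2, t.2.2⟩, inter_subset_left, inter_subset_right⟩)
    (fun s => s.2.1.isClosed.isCompact) (U := ((↑) : K → α) ⁻¹' Bᶜ)
    (fun w hw => (hB.isOpen_compl.preimage continuous_subtype_val).mem_nhds (hsub hw))
  refine ⟨(↑) '' Q, by simp, hQ.isClosed.isCompact.image continuous_subtype_val, ?_,
    ⟨_, hxQ, rfl⟩, ?_⟩
  · have : K \ ((↑) '' Q) = ((↑) : K → α) '' Qᶜ := by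
      ext w
      simp only [Set.mem_sdiff, mem_image, Subtype.exists, mem_compl_iff]
      constructor
      · rintro ⟨h1, h2⟩
        exact ⟨w, h1, fun h3 => h2 ⟨w, h1, h3, rfl⟩, rfl⟩
      · rintro ⟨v, h1, h2, rfl⟩
        exact ⟨h1, fun ⟨u, hu, h3, h4⟩ => h2 (by subst h4; exact h3)⟩
    rw [this]
    exact hQ.compl.isClosed.isCompact.image continuous_subtype_val
  · rw [disjoint_left]
    rintro _ ⟨w, hw, rfl⟩
    exact hQB hw

theorem isClosed_annSub : IsClosed (annSub : Set R2) := by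
  have h : (annSub : Set R2) = {0} ×ˢ range ((↑) : ℤ → ℝ) := by
    ext ⟨u, v⟩
    simp [annSub, AddSubgroup.mem_prod, AddSubgroup.mem_zmultiples_iff]
  rw [h]
  exact isClosed_singleton.prod Int.isClosedEmbedding_coe_real.isClosed_range

instance : T2Space Ann :=
  haveI := isClosed_annSub
  inferInstance

theorem isQuotientMap_piA : Topology.IsQuotientMap piA := QuotientAddGroup.isQuotientMap_mk annSub

theorem piA_eq_iff {x y : R2} : piA x = piA y ↔ ∃ n : ℤ, x + ((0 : ℝ), (n : ℝ)) = y := by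
  have h : piA x = piA y ↔ -x + y ∈ annSub := QuotientAddGroup.eq
  rw [h]
  simp only [annSub, AddSubgroup.mem_prod, AddSubgroup.mem_bot, AddSubgroup.mem_zmultiples_iff,
    Prod.ext_iff, Prod.fst_add, Prod.snd_add, Prod.fst_neg, Prod.snd_neg, zsmul_eq_mul, mul_one]
  constructor
  · rintro ⟨h1, n, hn⟩
    exact ⟨n, by linarith, by linarith⟩
  · rintro ⟨n, h1, h2⟩
    exact ⟨by linarith, n, by linarith⟩

theorem piA_add_int (x : R2) (n : ℤ) : piA (x + ((0 : ℝ), (n : ℝ))) = piA x :=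
  (piA_eq_iff.2 ⟨n, rfl⟩).symm

theorem IsCompact.exists_abs_fst_le_of_piA_mem {A : Set Ann} (hA : IsCompact A) :
    ∃ R : ℝ, ∀ w, piA w ∈ A → |w.1| ≤ R := by
  let f : Ann →+ ℝ := QuotientAddGroup.lift annSub (AddMonoidHom.fst ℝ ℝ)
    (fun x hx => (AddSubgroup.mem_prod.mp hx).1)
  have hf : Continuous f := isQuotientMap_piA.continuous_iff.2 continuous_fst
  obtain ⟨R, hR⟩ := (hA.image hf).isBounded.exists_norm_le
  exact ⟨R, fun w hw => hR _ ⟨_, hw, rfl⟩⟩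

/-- The lift of the complement of an annular continuum splits into two open sets, each containing
one of the ends of the plane. -/
theorem IsAnnularContinuum.exists_separation {A : Set Ann} (hA : IsAnnularContinuum A) :
    ∃ (D E : Set R2) (R : ℝ), IsOpen D ∧ IsOpen E ∧ Disjoint D E ∧ D ∪ E = (piA ⁻¹' A)ᶜ ∧
      (∀ w : R2, R < w.1 → w ∈ D) ∧ (∀ w : R2, w.1 < -R → w ∈ E) := by
  obtain ⟨hAc, -, U, V, hUV, hU, hV, hC⟩ := hA
  obtain ⟨R, hR⟩ := hAc.exists_abs_fst_le_of_piA_mem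
  have : LocallyConnectedSpace Ann := isQuotientMap_piA.isCoinducing.locallyConnectedSpace
  have hcomp : ∀ W ∈ ({U, V} : Set (Set Ann)), ∃ x ∈ Aᶜ, W = connectedComponentIn Aᶜ x :=
    fun W hW => hC.superset hW
  have hopen : ∀ W ∈ ({U, V} : Set (Set Ann)), IsOpen (piA ⁻¹' W) := by
    intro W hW
    obtain ⟨x, -, rfl⟩ := hcomp W hW
    exact hAc.isClosed.isOpen_compl.connectedComponentIn.preimage isQuotientMap_piA.continuous
  have hcov : U ∪ V = Aᶜ := by
    apply Subset.antisymm
    · refine union_subset ?_ ?_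
      · obtain ⟨x, -, hx⟩ := hcomp U (by simp)
        exact hx ▸ connectedComponentIn_subset _ _
      · obtain ⟨x, -, hx⟩ := hcomp V (by simp)
        exact hx ▸ connectedComponentIn_subset _ _
    · intro x hx
      rcases hC.subset ⟨x, hx, rfl⟩ with h | h
      · exact Or.inl (h ▸ mem_connectedComponentIn hx)
      · exact Or.inr (h ▸ mem_connectedComponentIn hx)
  have hdisj : Disjoint U V := by
    obtain ⟨x, -, hx⟩ := hcomp U (by simp)
    obtain ⟨y, -, hy⟩ := hcomp V (by simp)
    rw [disjoint_left]
    intro w hwU hwV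
    rw [hx] at hwU
    rw [hy] at hwV
    exact hUV (by rw [hx, hy, connectedComponentIn_eq hwU, connectedComponentIn_eq hwV])
  have hpre : ∀ W ∈ ({U, V} : Set (Set Ann)), ∀ S : Set R2, IsPreconnected S →
      (∀ w ∈ S, piA w ∉ A) → (∃ w ∈ S, piA w ∈ W) → ∀ w ∈ S, piA w ∈ W := by
    rintro W hW S hS hSA ⟨w, hw, hwW⟩ v hv
    obtain ⟨x, -, rfl⟩ := hcomp W hW
    rw [connectedComponentIn_eq hwW]
    exact (hS.image piA isQuotientMap_piA.continuous.continuousOn).subset_connectedComponentIn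
      (mem_image_of_mem _ hw) (by rintro _ ⟨u, hu, rfl⟩; exact hSA u hu) (mem_image_of_mem _ hv)
  have hright : IsPreconnected {w : R2 | R < w.1} :=
    (convex_halfSpace_gt (LinearMap.fst ℝ ℝ ℝ).isLinear R).isPreconnected
  have hleft : IsPreconnected {w : R2 | w.1 < -R} :=
    (convex_halfSpace_lt (LinearMap.fst ℝ ℝ ℝ).isLinear (-R)).isPreconnected
  have hend : ∀ W ∈ ({U, V} : Set (Set Ann)), ¬ BoundedA W →
      (∀ w : R2, R < w.1 → piA w ∈ W) ∨ (∀ w : R2, w.1 < -R → piA w ∈ W) := by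
    intro W hW hWb
    have : ∃ w, piA w ∈ W ∧ R < |w.1| := by
      by_contra! hcon
      refine hWb (isBounded_iff_forall_norm_le.2 ⟨R, ?_⟩)
      rintro _ ⟨w, hw, rfl⟩
      exact hcon w hw
    obtain ⟨w, hw, hwR⟩ := this
    rcases lt_abs.1 hwR with h | h
    · refine Or.inl (hpre W hW _ hright (fun v hv hvA => ?_) ⟨w, h, hw⟩)
      exact absurd (hR v hvA) (not_le.2 (lt_abs.2 (Or.inl hv)))
    · refine Or.inr (hpre W hW _ hleft (fun v hv hvA => ?_) ⟨w, lt_neg_of_lt_neg h, hw⟩)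
      exact absurd (hR v hvA) (not_le.2 (lt_abs.2 (Or.inr (lt_neg_of_lt_neg hv))))
  have hcov' : piA ⁻¹' U ∪ piA ⁻¹' V = (piA ⁻¹' A)ᶜ := by
    rw [← preimage_union, hcov, preimage_compl]
  rcases hend U (by simp) hU with h1 | h1 <;> rcases hend V (by simp) hV with h2 | h2
  · exact absurd (h2 (R + 1, 0) (by simp)) (disjoint_left.1 hdisj (h1 (R + 1, 0) (by simp)))
  · exact ⟨_, _, R, hopen U (by simp), hopen V (by simp), hdisj.preimage _, hcov', h1, h2⟩
  · exact ⟨_, _, R, hopen V (by simp), hopen U (by simp), hdisj.symm.preimage _,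
      by rw [union_comm, hcov'], h2, h1⟩
  · exact absurd (h2 (-R - 1, 0) (by simp)) (disjoint_left.1 hdisj (h1 (-R - 1, 0) (by simp)))

/-- If the lift of a connected set `A` has a nonempty compact relatively clopen part `P`, then the
integer translates of `P` cover the lift. -/
theorem exists_add_int_mem_of_clopen_part {A : Set Ann} (hA : IsPreconnected A) {P : Set R2}
    (hPA : P ⊆ piA ⁻¹' A) (hP : IsCompact P) (hPc : IsClosed (piA ⁻¹' A \ P)) (hne : P.Nonempty)
    {w : R2} (hw : piA w ∈ A) : ∃ n : ℤ, w + ((0 : ℝ), (n : ℝ)) ∈ P := by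
  by_contra! hcon
  let T : Set R2 := ⋂ n : ℤ, (fun w : R2 => w + ((0 : ℝ), (n : ℝ))) ⁻¹' (piA ⁻¹' A \ P)
  have hT : IsClosed T := isClosed_iInter fun n => hPc.preimage (by fun_prop)
  have hTmem : ∀ v, v ∈ T ↔ piA v ∈ A ∧ ∀ n : ℤ, v + ((0 : ℝ), (n : ℝ)) ∉ P := by
    intro v
    simp only [T, mem_iInter, mem_preimage, Set.mem_sdiff, piA_add_int]
    exact ⟨fun h => ⟨(h 0).1, fun n => (h n).2⟩, fun h n => ⟨h.1, h.2 n⟩⟩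
  have hTpre : ∀ v, piA v ∈ piA '' T ↔ v ∈ T := by
    refine fun v => ⟨?_, mem_image_of_mem _⟩
    rintro ⟨u, hu, huv⟩
    obtain ⟨m, rfl⟩ := piA_eq_iff.1 huv
    rw [hTmem] at hu ⊢
    refine ⟨by rw [piA_add_int]; exact hu.1, fun n hn => hu.2 (m + n) ?_⟩
    convert! hn using 1
    ext <;> simp [add_assoc]
  have hTc : IsClosed (piA '' T) := by
    rw [← isQuotientMap_piA.isClosed_preimage]
    convert hT using 1
    ext v
    exact hTpre v
  obtain ⟨p, hp⟩ := hne
  obtain ⟨y, -, ⟨q, hq, rfl⟩, hyT⟩ := isPreconnected_closed_iff.1 hA (piA '' P) (piA '' T)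
    (hP.image isQuotientMap_piA.continuous).isClosed hTc (by
      intro y hy
      obtain ⟨v, rfl⟩ := isQuotientMap_piA.surjective y
      by_cases hv : ∃ n : ℤ, v + ((0 : ℝ), (n : ℝ)) ∈ P
      · obtain ⟨n, hn⟩ := hv
        exact Or.inl ⟨_, hn, piA_add_int v n⟩
      · exact Or.inr ⟨v, (hTmem v).2 ⟨hy, not_exists.1 hv⟩, rfl⟩)
    ⟨_, hPA hp, mem_image_of_mem _ hp⟩ ⟨_, hw, mem_image_of_mem _ ((hTmem w).2 ⟨hw, hcon⟩)⟩
  refine ((hTmem q).1 ((hTpre q).1 hyT)).2 0 ?_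
  convert! hq using 1
  ext <;> simp

/-- The lift of an annular continuum has no nonempty compact relatively clopen part. -/
theorem IsAnnularContinuum.not_isClosed_diff_of_isCompact {A : Set Ann}
    (hA : IsAnnularContinuum A) {P : Set R2} (hPA : P ⊆ piA ⁻¹' A) (hP : IsCompact P)
    (hne : P.Nonempty) : ¬ IsClosed (piA ⁻¹' A \ P) := by
  intro hPc
  obtain ⟨D, E, R, hD, hE, hDE, hcov, hDR, hER⟩ := hA.exists_separation
  obtain ⟨m, hm⟩ : ∃ m : ℤ, ∀ w ∈ P, |w.2| < m := by
    obtain ⟨r, hr⟩ := (hP.image continuous_snd).isBounded.exists_norm_le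
    obtain ⟨m, hm⟩ := exists_int_gt r
    exact ⟨m, fun w hw => (hr _ (mem_image_of_mem _ hw)).trans_lt hm⟩
  let X : Set R2 := ⋃ n ∈ Set.Icc (-m) m, (fun w : R2 => w + ((0 : ℝ), (n : ℝ))) ⁻¹' P
  let Y : Set R2 := ⋂ n ∈ Set.Icc (-m) m,
    (fun w : R2 => w + ((0 : ℝ), (n : ℝ))) ⁻¹' (piA ⁻¹' A \ P)
  have hXmem : ∀ v, v ∈ X ↔ ∃ n ∈ Set.Icc (-m) m, v + ((0 : ℝ), (n : ℝ)) ∈ P := by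
    simp [X]
  have hYmem : ∀ v, v ∈ Y ↔ ∀ n ∈ Set.Icc (-m) m, piA v ∈ A ∧ v + ((0 : ℝ), (n : ℝ)) ∉ P := by
    simp [Y, piA_add_int]
  have hm0 : (0 : ℤ) ∈ Set.Icc (-m) m := by
    obtain ⟨p, hp⟩ := hne
    have : (0 : ℝ) < m := (abs_nonneg _).trans_lt (hm p hp)
    have : 0 < m := by exact_mod_cast this
    constructor <;> linarith
  have hX : IsClosed X := (finite_Icc (-m) m).isClosed_biUnion fun n _ =>
    hP.isClosed.preimage (by fun_prop)
  have hY : IsClosed Y := isClosed_biInter fun n _ => hPc.preimage (by fun_prop)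
  refine not_separated_of_horizontal_lines hD hE hDE hX hY ?_ ?_ hDR hER (a := 0) (b := 2 * m)
    ?_ ?_
  · rw [disjoint_left]
    intro v hvX hvY
    obtain ⟨n, hn, hnP⟩ := (hXmem v).1 hvX
    exact ((hYmem v).1 hvY n hn).2 hnP
  · rw [hcov, compl_compl]
    ext v
    constructor
    · rintro (h | h)
      · obtain ⟨n, -, hnP⟩ := (hXmem v).1 h
        simpa [piA_add_int] using hPA hnP
      · exact ((hYmem v).1 h 0 hm0).1
    · intro hv
      by_cases h : v ∈ X
      · exact Or.inl h
      · exact Or.inr ((hYmem v).2 fun n hn => ⟨hv, fun hnP => h ((hXmem v).2 ⟨n, hn, hnP⟩)⟩)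
  · intro w hw hw0
    obtain ⟨n, hn⟩ := exists_add_int_mem_of_clopen_part hA.2.1.isPreconnected hPA hP hPc hne
      ((hYmem w).1 hw 0 hm0).1
    have h := hm _ hn
    simp only [Prod.snd_add, hw0, zero_add] at h
    have h' : |n| < m := by exact_mod_cast h
    exact ((hYmem w).1 hw n ⟨by linarith [(abs_lt.1 h').1], by linarith [(abs_lt.1 h').2]⟩).2 hn
  · intro w hw hwb
    obtain ⟨n, hn, hnP⟩ := (hXmem w).1 hw
    have h := (abs_lt.1 (hm _ hnP)).2
    simp only [Prod.snd_add, hwb] at h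
    have h' : -(m : ℝ) ≤ n := by exact_mod_cast hn.1
    linarith

/-- In the lift Ã = π⁻¹(A) of an annular continuum A ⊆ 𝔸, every point is
contained in subcontinua of Ã with arbitrarily large vertical extent:
for every z ∈ Ã and M > 0 there is a continuum Z with z ∈ Z ⊆ Ã and
diam(pr₂(Z)) > M. -/
theorem lift_of_annular_continuum_contains_tall_continua
    (A : Set Ann) (hA : IsAnnularContinuum A)
    (z : R2) (hz : z ∈ piA ⁻¹' A) (M : ℝ) (hM : 0 < M) :
    ∃ Z : Set R2, z ∈ Z ∧ Z ⊆ piA ⁻¹' A ∧ IsCompact Z ∧ IsConnected Z ∧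
      M < Metric.diam (Prod.snd '' Z) := by
  obtain ⟨R, hR⟩ := hA.1.exists_abs_fst_le_of_piA_mem
  have hAcl : IsClosed (piA ⁻¹' A) := hA.1.isClosed.preimage isQuotientMap_piA.continuous
  let K : Set R2 := piA ⁻¹' A ∩ {w | |w.2 - z.2| ≤ M + 1}
  let B : Set R2 := {w | M + 1 ≤ |w.2 - z.2|}
  have hKcl : IsClosed K := hAcl.inter (isClosed_le (by fun_prop) (by fun_prop))
  have hBcl : IsClosed B := isClosed_le (by fun_prop) (by fun_prop)
  have hK : IsCompact K := by
    refine ((isCompact_Icc (a := -R) (b := R)).prod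
      (isCompact_Icc (a := z.2 - (M + 1)) (b := z.2 + (M + 1)))).of_isClosed_subset hKcl ?_
    rintro w ⟨hwA, hw⟩
    have h := abs_le.1 (show |w.2 - z.2| ≤ M + 1 from hw)
    exact ⟨abs_le.1 (hR w hwA), by linarith [h.1], by linarith [h.2]⟩
  have hzK : z ∈ K := ⟨hz, by rw [mem_ofPred_eq, sub_self, abs_zero]; linarith⟩
  have hCK := connectedComponentIn_subset K z
  have hCc : IsCompact (connectedComponentIn K z) := by
    have := isCompact_iff_compactSpace.1 hK
    rw [connectedComponentIn_eq_image hzK]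
    exact isClosed_connectedComponent.isCompact.image continuous_subtype_val
  have hzC := mem_connectedComponentIn hzK
  by_cases hdisj : Disjoint (connectedComponentIn K z) B
  · obtain ⟨P, hPK, hP, hKP, hzP, hPB⟩ := hK.exists_clopen_part hBcl hzK hdisj
    refine absurd ?_ (hA.not_isClosed_diff_of_isCompact (hPK.trans inter_subset_left) hP ⟨z, hzP⟩)
    have : piA ⁻¹' A \ P = K \ P ∪ piA ⁻¹' A ∩ B := by
      ext w
      constructor
      · rintro ⟨hwA, hwP⟩
        rcases le_total |w.2 - z.2| (M + 1) with h | h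
        · exact Or.inl ⟨⟨hwA, h⟩, hwP⟩
        · exact Or.inr ⟨hwA, h⟩
      · rintro (h | h)
        · exact ⟨h.1.1, h.2⟩
        · exact ⟨h.1, fun hwP => hPB.le_bot ⟨hwP, h.2⟩⟩
    rw [this]
    exact hKP.isClosed.union (hAcl.inter hBcl)
  · obtain ⟨w, hwC, hwB⟩ := not_disjoint_iff.1 hdisj
    refine ⟨connectedComponentIn K z, hzC, hCK.trans inter_subset_left, hCc,
      ⟨⟨z, hzC⟩, isPreconnected_connectedComponentIn⟩, ?_⟩
    have h := dist_le_diam_of_mem (hCc.image continuous_snd).isBounded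
      (mem_image_of_mem Prod.snd hwC) (mem_image_of_mem Prod.snd hzC)
    rw [Real.dist_eq] at h
    have h' : M + 1 ≤ |w.2 - z.2| := hwB
    linarith
end
end
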